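/- Fix n ∈ ℕ. For b > 0 small enough, the eigenfunction φ_n of (𝒜₀ − b r ∂_r) with eigenvalue α_n = 2b(1 − n + 1/ln b + ᾱ_n), |ᾱ_n| ≤ C/(ln b)², constructed by matched asymptotics, can be chosen so that on the interval (0,∞): φ_0 never vanishes, and for n ≥ 1 the function φ_n has exactly n zeros. -/

import Mathlib

open Real MeasureTheory Set

/-- `Q(r) = 4r²/(1+r²)`. -/
noncomputable def Qfun (r : ℝ) : ℝ := 4 * r ^ 2 / (1 + r ^ 2)

/-- `U(r) = 8/(1+r²)²`. -/
noncomputable def Ufun (r : ℝ) : ℝ := 8 / (1 + r ^ 2) ^ 2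

/-- The operator `𝒜₀ f = f'' − f'/r + Q f'/r + Q' f/r`. -/
noncomputable def A0 (f : ℝ → ℝ) (r : ℝ) : ℝ :=
  deriv (deriv f) r - deriv f r / r + Qfun r * deriv f r / r + deriv Qfun r * f r / r

/-- The weight `ω_b(r) = e^{−b r²/2}/(r U(r))`. -/
noncomputable def omegaB (b r : ℝ) : ℝ := Real.exp (-b * r ^ 2 / 2) / (r * Ufun r)

noncomputable def wt (β y : ℝ) : ℝ := Real.exp (-y) * y ^ 2 / (β + |y|) ^ 2
noncomputable def m0 (β y : ℝ) : ℝ := Real.exp (-y) * (y / (β + |y|) ^ 2)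
noncomputable def mm (β μ y : ℝ) : ℝ := m0 β y * (2 * β / (β + |y|) - μ)
noncomputable def mtt (β μ y : ℝ) : ℝ := Real.exp (-y) / (β + |y|) ^ 2 * (2 * β / (β + |y|) - μ)

/-- derivative operator -/
noncomputable def GG (β μ : ℝ) (h : ℝ → ℝ) (s : ℝ) : ℝ :=
  Real.exp s * (β + |s|) ^ 2 * ∫ x in (0:ℝ)..1, x * mtt β μ (s * x) * h (s * x)

lemma babs_pos {β : ℝ} (hβ : 0 < β) (y : ℝ) : 0 < β + |y| := by positivity

lemma m0_cont {β : ℝ} (hβ : 0 < β) : Continuous (m0 β) := by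
  unfold m0
  have : ∀ y : ℝ, (β + |y|) ^ 2 ≠ 0 := fun y => by positivity
  fun_prop (disch := assumption)

lemma wt_cont {β : ℝ} (hβ : 0 < β) : Continuous (wt β) := by
  unfold wt
  have : ∀ y : ℝ, (β + |y|) ^ 2 ≠ 0 := fun y => by positivity
  fun_prop (disch := assumption)

lemma mm_cont {β : ℝ} (hβ : 0 < β) (μ : ℝ) : Continuous (mm β μ) := by
  unfold mm
  have h1 := m0_cont hβ
  have : ∀ y : ℝ, (β + |y|) ≠ 0 := fun y => by positivity
  fun_prop (disch := assumption)

lemma mtt_cont {β : ℝ} (hβ : 0 < β) (μ : ℝ) : Continuous (mtt β μ) := by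
  unfold mtt
  have h2 : ∀ y : ℝ, (β + |y|) ^ 2 ≠ 0 := fun y => by positivity
  have : ∀ y : ℝ, (β + |y|) ≠ 0 := fun y => by positivity
  fun_prop (disch := assumption)

lemma wt_pos {β y : ℝ} (hβ : 0 < β) (hy : 0 < y) : 0 < wt β y := by
  unfold wt; positivity

lemma GG_cont {β : ℝ} (hβ : 0 < β) (μ : ℝ) {h : ℝ → ℝ} (hh : Continuous h) :
    Continuous (GG β μ h) := by
  unfold GG
  have h1 := mtt_cont hβ μ
  apply Continuous.mul
  · fun_prop
  · apply intervalIntegral.continuous_parametric_intervalIntegral_of_continuous'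
    simp only [Function.uncurry_def]
    fun_prop

lemma GG_eq {β : ℝ} (hβ : 0 < β) (μ : ℝ) (h : ℝ → ℝ) {s : ℝ} (hs : 0 < s) :
    GG β μ h s = (∫ t in (0:ℝ)..s, mm β μ t * h t) / wt β s := by
  have e1 : ∀ t, mm β μ t * h t = t * mtt β μ t * h t := by
    intro t; unfold mm mtt m0; ring
  have e2 := intervalIntegral.integral_comp_mul_left (a := 0) (b := 1)
    (fun t => t * mtt β μ t * h t) hs.ne'
  simp only [mul_zero, mul_one] at e2
  simp_rw [e1]
  have e3 : (∫ t in (0:ℝ)..s, t * mtt β μ t * h t)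
      = s * ∫ x in (0:ℝ)..1, (s * x) * mtt β μ (s * x) * h (s * x) := by
    rw [e2, smul_eq_mul]; field_simp
  have e4 : (∫ x in (0:ℝ)..1, (s * x) * mtt β μ (s * x) * h (s * x))
      = s * ∫ x in (0:ℝ)..1, x * mtt β μ (s * x) * h (s * x) := by
    rw [← intervalIntegral.integral_const_mul]
    congr 1; ext x; ring
  rw [e3, e4]
  unfold GG wt
  have : 0 < β + |s| := by positivity
  generalize (∫ x in (0:ℝ)..1, x * mtt β μ (s * x) * h (s * x)) = I
  rw [Real.exp_neg]
  field_simp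

lemma mtt_abs_le {β : ℝ} (hβ : 0 < β) (μ : ℝ) {y : ℝ} (hy : 0 ≤ y) :
    |mtt β μ y| ≤ (2 + |μ|) / (β + y) ^ 2 := by
  unfold mtt
  rw [abs_of_nonneg hy, abs_mul, abs_of_nonneg (by positivity)]
  have h1 : |2 * β / (β + y) - μ| ≤ 2 + |μ| := by
    have : |2 * β / (β + y)| ≤ 2 := by
      rw [abs_of_nonneg (by positivity), div_le_iff₀ (by positivity)]; nlinarith
    exact (abs_sub _ _).trans (by linarith)
  have h2 : Real.exp (-y) ≤ 1 := by simpa using hy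
  calc _ ≤ 1 / (β + y) ^ 2 * (2 + |μ|) := by gcongr
    _ = _ := by ring

lemma GG_bound {β : ℝ} (hβ : 0 < β) (μ : ℝ) {h : ℝ → ℝ} {s c : ℝ} (hs : 0 ≤ s) (hc : 0 ≤ c)
    (hb : ∀ t, 0 ≤ t → t ≤ s → |h t| ≤ c) :
    |GG β μ h s| ≤ (2 + |μ|) * Real.exp ((1 + 1 / β) * s) * c := by
  unfold GG
  have hI : ‖∫ x in (0:ℝ)..1, x * mtt β μ (s * x) * h (s * x)‖
      ≤ ((2 + |μ|) * c / (β * (β + s))) * |1 - 0| := by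
    apply intervalIntegral.norm_integral_le_of_norm_le_const
    intro x hx
    rw [uIoc_of_le zero_le_one] at hx
    have hx0 : 0 ≤ x := hx.1.le
    have hsx : 0 ≤ s * x := by positivity
    have hsx1 : s * x ≤ s := by nlinarith [hx.2]
    have := mtt_abs_le hβ μ hsx
    have h3 := hb _ hsx hsx1
    rw [Real.norm_eq_abs, abs_mul, abs_mul, abs_of_nonneg hx0]
    have h4 : x / (β + s * x) ^ 2 ≤ 1 / (β * (β + s)) := by
      rw [div_le_div_iff₀ (by positivity) (by positivity)]
      have := hx.2
      have : x * β ≤ β := by nlinarith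
      nlinarith [mul_nonneg hβ.le hsx, mul_nonneg hsx hsx]
    calc x * |mtt β μ (s * x)| * |h (s * x)| ≤ x * ((2 + |μ|) / (β + s * x) ^ 2) * c := by gcongr
      _ = (2 + |μ|) * c * (x / (β + s * x) ^ 2) := by ring
      _ ≤ (2 + |μ|) * c * (1 / (β * (β + s))) := by gcongr
      _ = _ := by ring
  rw [Real.norm_eq_abs] at hI
  rw [abs_mul, abs_of_nonneg (by positivity), abs_of_nonneg hs]
  have h5 : 1 + s / β ≤ Real.exp (s / β) := by
    have := Real.add_one_le_exp (s / β); linarith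
  calc _ ≤ Real.exp s * (β + s) ^ 2 * (((2 + |μ|) * c / (β * (β + s))) * |1 - 0|) := by gcongr
    _ = (2 + |μ|) * c * (Real.exp s * (1 + s / β)) := by
        have : β + s ≠ 0 := by positivity
        simp; field_simp
    _ ≤ (2 + |μ|) * c * (Real.exp s * Real.exp (s / β)) := by gcongr
    _ = _ := by rw [← Real.exp_add]; ring_nf

lemma GG_sub {β : ℝ} (hβ : 0 < β) (μ : ℝ) {h k : ℝ → ℝ} (hh : Continuous h) (hk : Continuous k)
    (s : ℝ) : GG β μ (fun t => h t - k t) s = GG β μ h s - GG β μ k s := by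
  unfold GG
  have h1 := mtt_cont hβ μ
  rw [← mul_sub, ← intervalIntegral.integral_sub]
  · congr 2; ext x; ring
  · apply Continuous.intervalIntegrable; fun_prop
  · apply Continuous.intervalIntegrable; fun_prop

/-- solution predicate -/
def IsSol (β μ : ℝ) (f : ℝ → ℝ) : Prop :=
  Continuous f ∧ f 0 = 1 ∧ ∀ y, 0 < y → HasDerivAt f (GG β μ f y) y

lemma exists_sol {β : ℝ} (hβ : 0 < β) (μ : ℝ) : ∃ f, IsSol β μ f := by
  obtain ⟨C, hC⟩ : ∃ C, C = 2 + |μ| := ⟨_, rfl⟩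
  have hCpos : 0 < C := by rw [hC]; positivity
  obtain ⟨a, ha⟩ : ∃ a, a = 1 + 1 / β := ⟨_, rfl⟩
  have hapos : 0 < a := by rw [ha]; positivity
  set g : ℝ → ℝ := fun s => Real.exp (2 * C / a * Real.exp (a * |s|)) with hg
  have gcont : Continuous g := by fun_prop
  have gpos : ∀ s, 0 < g s := fun s => Real.exp_pos _
  have gone : ∀ s, 1 ≤ g s := fun s => Real.one_le_exp (by positivity)
  have gmono : ∀ s t, 0 ≤ s → s ≤ t → g s ≤ g t := by
    intro s t hs hst
    simp only [hg]
    rw [abs_of_nonneg hs, abs_of_nonneg (hs.trans hst)]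
    gcongr
  have key : ∀ h : ℝ → ℝ, Continuous h → ∀ c, 0 ≤ c → (∀ y, |h y| ≤ c * g y) → ∀ y,
      |∫ s in (0:ℝ)..|y|, GG β μ h s| ≤ c / 2 * g y := by
    intro h hh c hc hb y
    have hd : ∀ s, HasDerivAt (fun s => c / 2 * Real.exp (2 * C / a * Real.exp (a * s)))
        (c * C * Real.exp (a * s) * Real.exp (2 * C / a * Real.exp (a * s))) s := by
      intro s
      have h1 : HasDerivAt (fun s => a * s) a s := by simpa using (hasDerivAt_id s).const_mul a
      have := (((h1.exp).const_mul (2 * C / a)).exp).const_mul (c / 2)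
      refine this.congr_deriv ?_
      generalize Real.exp (2 * C / a * Real.exp (a * s)) = E
      field_simp
    have hint : ∫ s in (0:ℝ)..|y|, (c * C * Real.exp (a * s) * Real.exp (2 * C / a * Real.exp (a * s)))
        = c / 2 * Real.exp (2 * C / a * Real.exp (a * |y|)) - c / 2 * Real.exp (2 * C / a * Real.exp (a * 0)) := by
      apply intervalIntegral.integral_eq_sub_of_hasDerivAt (fun s _ => hd s)
      apply Continuous.intervalIntegrable; fun_prop
    have hle : ‖∫ s in (0:ℝ)..|y|, GG β μ h s‖ ≤ ∫ s in (0:ℝ)..|y|, (c * C * Real.exp (a * s) * Real.exp (2 * C / a * Real.exp (a * s))) := by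
      apply intervalIntegral.norm_integral_le_of_norm_le (abs_nonneg y)
      · apply Filter.Eventually.of_forall
        intro s hs
        have hs0 : 0 ≤ s := hs.1.le
        have := GG_bound hβ μ (h := h) (s := s) (c := c * g s) hs0 (by have := gpos s; positivity) (by
          intro t ht hts
          exact (hb t).trans (by have := gmono t s ht hts; gcongr))
        rw [Real.norm_eq_abs]
        rw [← hC, ← ha] at this
        refine this.trans (le_of_eq ?_)
        simp only [hg, abs_of_nonneg hs0]; ring
      · apply Continuous.intervalIntegrable; fun_prop
    rw [hint] at hle
    have : 0 ≤ c / 2 * Real.exp (2 * C / a * Real.exp (a * 0)) := by positivity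
    rw [Real.norm_eq_abs] at hle
    simp only [hg]; linarith
  have vcont : ∀ h : ℝ → ℝ, Continuous h → Continuous (fun y => ∫ s in (0:ℝ)..|y|, GG β μ h s) := by
    intro h hh
    have h1 := GG_cont hβ μ hh
    exact (intervalIntegral.continuous_primitive (fun a b => h1.intervalIntegrable a b) 0).comp continuous_abs
  let V : BoundedContinuousFunction ℝ ℝ → BoundedContinuousFunction ℝ ℝ := fun ρ =>
    BoundedContinuousFunction.ofNormedAddCommGroup
      (fun y => (1 + ∫ s in (0:ℝ)..|y|, GG β μ (fun t => g t * ρ t) s) / g y)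
      (by
        apply Continuous.div _ gcont (fun y => (gpos y).ne')
        exact continuous_const.add (vcont _ (gcont.mul ρ.continuous)))
      (1 + ‖ρ‖ / 2)
      (by
        intro y
        have := key (fun t => g t * ρ t) (gcont.mul ρ.continuous) ‖ρ‖ (norm_nonneg _) (by
          intro y; rw [abs_mul, abs_of_pos (gpos y), mul_comm]
          have := ρ.norm_coe_le_norm y
          rw [Real.norm_eq_abs] at this
          have := gpos y
          gcongr) y
        rw [Real.norm_eq_abs, abs_div, abs_of_pos (gpos y), div_le_iff₀ (gpos y)]
        have h1 := gone y
        calc _ ≤ |1| + |∫ s in (0:ℝ)..|y|, GG β μ (fun t => g t * ρ t) s| := abs_add_le _ _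
          _ ≤ 1 + ‖ρ‖ / 2 * g y := by rw [abs_one]; linarith
          _ ≤ _ := by nlinarith)
  have hV : ContractingWith (1/2) V := by
    constructor
    · norm_num
      
    · apply LipschitzWith.of_dist_le_mul
      intro ρ σ
      rw [BoundedContinuousFunction.dist_le (by positivity)]
      intro y
      have := key (fun t => g t * ρ t - g t * σ t) ((gcont.mul ρ.continuous).sub (gcont.mul σ.continuous))
        (dist ρ σ) dist_nonneg (by
          intro y
          rw [← mul_sub, abs_mul, abs_of_pos (gpos y), mul_comm]
          have := BoundedContinuousFunction.dist_coe_le_dist (f := ρ) (g := σ) y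
          rw [Real.dist_eq] at this
          have := gpos y
          gcongr) y
      have e1 : ∀ s, GG β μ (fun t => g t * ρ t - g t * σ t) s =
          GG β μ (fun t => g t * ρ t) s - GG β μ (fun t => g t * σ t) s := fun s =>
        GG_sub hβ μ (gcont.mul ρ.continuous) (gcont.mul σ.continuous) s
      simp_rw [e1] at this
      rw [intervalIntegral.integral_sub ((GG_cont hβ μ (h := fun t => g t * ρ t) (gcont.mul ρ.continuous)).intervalIntegrable _ _)
        ((GG_cont hβ μ (h := fun t => g t * σ t) (gcont.mul σ.continuous)).intervalIntegrable _ _)] at this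
      rw [Real.dist_eq]
      show |(1 + ∫ s in (0:ℝ)..|y|, GG β μ (fun t => g t * ρ t) s) / g y -
        (1 + ∫ s in (0:ℝ)..|y|, GG β μ (fun t => g t * σ t) s) / g y| ≤ _
      rw [← sub_div, add_sub_add_left_eq_sub, abs_div, abs_of_pos (gpos y), div_le_iff₀ (gpos y)]
      refine this.trans (le_of_eq ?_)
      have : (((1/2 : NNReal)) : ℝ) = 1/2 := by norm_num
      rw [this]; ring
  obtain ⟨ρ, hρ⟩ : ∃ ρ, V ρ = ρ := ⟨hV.fixedPoint, hV.fixedPoint_isFixedPt⟩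
  have hfc : Continuous (fun y => g y * ρ y) := gcont.mul ρ.continuous
  have hf : ∀ y, g y * ρ y = 1 + ∫ s in (0:ℝ)..|y|, GG β μ (fun t => g t * ρ t) s := by
    intro y
    have h1 : (V ρ) y = ρ y := by rw [hρ]
    have h2 : (V ρ) y = (1 + ∫ s in (0:ℝ)..|y|, GG β μ (fun t => g t * ρ t) s) / g y := rfl
    rw [← h1, h2]
    have := (gpos y).ne'
    field_simp
  refine ⟨fun y => g y * ρ y, hfc, ?_, ?_⟩
  · show g 0 * ρ 0 = 1
    rw [hf 0]; simp
  · intro y hy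
    have h1 : HasDerivAt (fun y => 1 + ∫ s in (0:ℝ)..y, GG β μ (fun t => g t * ρ t) s)
        (GG β μ (fun t => g t * ρ t) y) y :=
      ((GG_cont hβ μ hfc).integral_hasStrictDerivAt 0 y).hasDerivAt.const_add 1
    apply h1.congr_of_eventuallyEq
    filter_upwards [Ioi_mem_nhds hy] with z hz
    rw [hf z, abs_of_pos hz]

/-- comparison lemma -/
lemma cmp_deriv {a b : ℝ} {R H R' H' : ℝ → ℝ} (hab : a ≤ b)
    (hR : ContinuousOn R (Icc a b)) (hH : ContinuousOn H (Icc a b))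
    (dR : ∀ y, a < y → y < b → HasDerivAt R (R' y) y)
    (dH : ∀ y, a < y → y < b → HasDerivAt H (H' y) y)
    (hle : ∀ y, a < y → y < b → |R' y| ≤ H' y) : |R b - R a| ≤ H b - H a := by
  have h1 : MonotoneOn (fun y => H y - R y) (Icc a b) := by
    apply monotoneOn_of_deriv_nonneg (convex_Icc a b) (hH.sub hR)
    · intro y hy
      rw [interior_Icc] at hy
      exact ((dH y hy.1 hy.2).sub (dR y hy.1 hy.2)).differentiableAt.differentiableWithinAt
    · intro y hy
      rw [interior_Icc] at hy
      rw [((dH y hy.1 hy.2).sub (dR y hy.1 hy.2)).deriv]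
      have := (abs_le.1 (hle y hy.1 hy.2)).2
      linarith
  have h2 : MonotoneOn (fun y => H y + R y) (Icc a b) := by
    apply monotoneOn_of_deriv_nonneg (convex_Icc a b) (hH.add hR)
    · intro y hy
      rw [interior_Icc] at hy
      exact ((dH y hy.1 hy.2).add (dR y hy.1 hy.2)).differentiableAt.differentiableWithinAt
    · intro y hy
      rw [interior_Icc] at hy
      rw [((dH y hy.1 hy.2).add (dR y hy.1 hy.2)).deriv]
      have := (abs_le.1 (hle y hy.1 hy.2)).1
      linarith
  have e1 := h1 (left_mem_Icc.2 hab) (right_mem_Icc.2 hab) hab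
  have e2 := h2 (left_mem_Icc.2 hab) (right_mem_Icc.2 hab) hab
  simp only at e1 e2
  rw [abs_le]; constructor <;> linarith

lemma GG_kern {β : ℝ} (hβ : 0 < β) (μ : ℝ) {h : ℝ → ℝ} {s c K : ℝ}
    (hs : 0 < s) (hc : 0 ≤ c) (hK : 1 ≤ K)
    (hb : ∀ t, 0 < t → t ≤ s → |h t| ≤ c * √t * Real.exp (K * t)) :
    |GG β μ h s| ≤ 2 * (2 + |μ|) * c * √s * Real.exp (K * s) := by
  unfold GG
  rw [← intervalIntegral.integral_const_mul, ← Real.norm_eq_abs]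
  have hint : ∫ x in (0:ℝ)..1, ((2 + |μ|) * c * √s * Real.exp (K * s)) * x ^ (-(1/2) : ℝ)
      = 2 * (2 + |μ|) * c * √s * Real.exp (K * s) := by
    rw [intervalIntegral.integral_const_mul, integral_rpow (by left; norm_num)]
    norm_num; ring
  rw [← hint]
  apply intervalIntegral.norm_integral_le_of_norm_le zero_le_one
  · apply Filter.Eventually.of_forall
    intro x hx
    have hx0 : 0 < x := hx.1
    have hsx : 0 < s * x := by positivity
    have hsx1 : s * x ≤ s := by nlinarith [hx.2]
    have hh := hb _ hsx hsx1
    rw [Real.norm_eq_abs, abs_of_pos hs]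
    have hm : |mtt β μ (s * x)| ≤ Real.exp (-(s * x)) / (β + s * x) ^ 2 * (2 + |μ|) := by
      unfold mtt
      rw [abs_of_pos hsx, abs_mul, abs_of_nonneg (by positivity)]
      have h1 : |2 * β / (β + s * x) - μ| ≤ 2 + |μ| := by
        have : |2 * β / (β + s * x)| ≤ 2 := by
          rw [abs_of_nonneg (by positivity), div_le_iff₀ (by positivity)]; nlinarith
        exact (abs_sub _ _).trans (by linarith)
      gcongr
    have hx12 : √x * x ^ (-(1/2) : ℝ) = 1 := by
      rw [Real.sqrt_eq_rpow, ← Real.rpow_add hx0]; norm_num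
    have hxx : √x * √x = x := Real.mul_self_sqrt hx0.le
    have hx12' : x ^ (-(1/2) : ℝ) = √x / x := by
      rw [eq_div_iff hx0.ne']; nth_rewrite 2 [← hxx]
      calc _ = √x * (√x * x ^ (-(1/2) : ℝ)) := by ring
        _ = _ := by rw [hx12, mul_one]
    have hsq : √(s * x) = √s * √x := Real.sqrt_mul hs.le x
    have hk : x * x * (β + s) ^ 2 / (β + s * x) ^ 2 ≤ 1 := by
      rw [div_le_one (by positivity)]
      have : x * (β + s) ≤ β + s * x := by nlinarith [hx.2]
      have h0 : 0 ≤ x * (β + s) := by positivity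
      nlinarith
    have hexp : Real.exp s * Real.exp (-(s * x)) * Real.exp (K * (s * x)) ≤ Real.exp (K * s) := by
      rw [← Real.exp_add, ← Real.exp_add]
      apply Real.exp_le_exp.2
      nlinarith [mul_nonneg (sub_nonneg.2 hK) (sub_nonneg.2 hsx1)]
    rw [abs_mul, abs_of_pos (a := Real.exp s * (β + s) ^ 2) (by positivity), abs_mul, abs_mul, abs_of_pos hx0]
    calc Real.exp s * (β + s) ^ 2 * (x * |mtt β μ (s * x)| * |h (s * x)|)
        ≤ Real.exp s * (β + s) ^ 2 * (x * (Real.exp (-(s * x)) / (β + s * x) ^ 2 * (2 + |μ|)) *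
          (c * √(s * x) * Real.exp (K * (s * x)))) := by gcongr
      _ = (x * x * (β + s) ^ 2 / (β + s * x) ^ 2) *
          ((Real.exp s * Real.exp (-(s * x)) * Real.exp (K * (s * x))) * ((2 + |μ|) * c * √s)) *
            (√x / x) := by
            rw [hsq]; field_simp
      _ ≤ 1 * ((Real.exp (K * s)) * ((2 + |μ|) * c * √s)) * (√x / x) := by gcongr
      _ = _ := by rw [hx12']; ring
  · apply IntervalIntegrable.const_mul
    exact intervalIntegral.intervalIntegrable_rpow' (by norm_num)

lemma boot_step {β μ M : ℝ} (hβ : 0 < β) {R B : ℝ → ℝ} {Z c K a : ℝ}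
    (hM : |μ| ≤ M) (hK : 4 * (2 + M) ≤ K) (hc : 0 ≤ c) (ha : 0 ≤ a)
    (hRc : Continuous R) (hR0 : R 0 = 0)
    (hd : ∀ s, 0 < s → s ≤ Z → HasDerivAt R (B s + GG β μ R s) s)
    (hB : ∀ s, 0 < s → s ≤ Z → |B s| ≤ c / √s * Real.exp (K * s))
    (hR : ∀ y, 0 < y → y ≤ Z → |R y| ≤ a * √y * Real.exp (K * y)) :
    ∀ y, 0 < y → y ≤ Z → |R y| ≤ (2 * c + a / 2) * √y * Real.exp (K * y) := by
  intro y hy hyZ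
  have hM0 : 0 ≤ |μ| := abs_nonneg _
  have dH : ∀ y : ℝ, 0 < y → HasDerivAt (fun y => (2 * c + a / 2) * √y * Real.exp (K * y))
      ((2 * c + a / 2) * (1 / (2 * √y)) * Real.exp (K * y) +
        (2 * c + a / 2) * √y * (Real.exp (K * y) * K)) y := by
    intro y hy
    have h1 : HasDerivAt (fun y => K * y) K y := by simpa using (hasDerivAt_id y).const_mul K
    exact ((Real.hasDerivAt_sqrt hy.ne').const_mul (2 * c + a / 2)).mul h1.exp
  have := cmp_deriv (a := 0) (b := y) (R := R) (H := fun y => (2 * c + a / 2) * √y * Real.exp (K * y))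
    hy.le hRc.continuousOn (by fun_prop) (fun s hs hsy => hd s hs (hsy.le.trans hyZ))
    (fun s hs _ => dH s hs) (by
      intro s hs hsy
      have hsZ := hsy.le.trans hyZ
      have h1 := hB s hs hsZ
      have h2 := GG_kern hβ μ (h := R) (c := a) (K := K) hs ha (by linarith)
        (fun t ht hts => hR t ht (hts.trans hsZ))
      have hsq : 0 < √s := Real.sqrt_pos.2 hs
      refine (abs_add_le _ _).trans ?_
      have hE := Real.exp_pos (K * s)
      have h3 : 2 * (2 + |μ|) * a * √s * Real.exp (K * s) ≤ (a / 2) * √s * (Real.exp (K * s) * K) := by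
        have : 0 ≤ a * √s * Real.exp (K * s) := by positivity
        nlinarith
      have h4 : 0 ≤ a / 2 * (1 / (2 * √s)) * Real.exp (K * s) := by positivity
      have h5 : 0 ≤ 2 * c * √s * (Real.exp (K * s) * K) := by
        have : 0 ≤ K := by linarith
        positivity
      have h6 : c / √s * Real.exp (K * s) = 2 * c * (1 / (2 * √s)) * Real.exp (K * s) := by
        field_simp
      linarith)
  simpa [hR0] using this

lemma boot {β μ M : ℝ} (hβ : 0 < β) {R B : ℝ → ℝ} {Z c K a : ℝ}
    (hM : |μ| ≤ M) (hK : 4 * (2 + M) ≤ K) (hc : 0 ≤ c) (ha : 0 ≤ a)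
    (hRc : Continuous R) (hR0 : R 0 = 0)
    (hd : ∀ s, 0 < s → s ≤ Z → HasDerivAt R (B s + GG β μ R s) s)
    (hB : ∀ s, 0 < s → s ≤ Z → |B s| ≤ c / √s * Real.exp (K * s))
    (hR : ∀ y, 0 < y → y ≤ Z → |R y| ≤ a * √y) :
    ∀ y, 0 < y → y ≤ Z → |R y| ≤ 4 * c * √y * Real.exp (K * y) := by
  have hM0 : 0 ≤ |μ| := abs_nonneg _
  have key : ∀ k : ℕ, ∀ y, 0 < y → y ≤ Z →
      |R y| ≤ (4 * c + a * (1/2) ^ k) * √y * Real.exp (K * y) := by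
    intro k
    induction k with
    | zero =>
      intro y hy hyZ
      have h1 : 1 ≤ Real.exp (K * y) := Real.one_le_exp (by
        have : 0 ≤ K := by linarith
        positivity)
      have h2 := hR y hy hyZ
      calc |R y| ≤ a * √y * 1 := by linarith
        _ ≤ (4 * c + a * (1/2) ^ 0) * √y * Real.exp (K * y) := by
          gcongr; simp; linarith
    | succ k ih =>
      intro y hy hyZ
      have := boot_step hβ hM hK hc (a := 4 * c + a * (1/2) ^ k) (by positivity) hRc hR0 hd hB ih y hy hyZ
      refine this.trans (le_of_eq ?_)
      rw [pow_succ]; ring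
  intro y hy hyZ
  have ht : Filter.Tendsto (fun k : ℕ => (4 * c + a * (1/2) ^ k) * √y * Real.exp (K * y)) Filter.atTop
      (nhds ((4 * c + a * 0) * √y * Real.exp (K * y))) := by
    apply Filter.Tendsto.mul_const
    apply Filter.Tendsto.mul_const
    apply Filter.Tendsto.const_add
    apply Filter.Tendsto.const_mul
    exact tendsto_pow_atTop_nhds_zero_of_lt_one (by norm_num) (by norm_num)
  have := ge_of_tendsto' ht (fun k => key k y hy hyZ)
  simpa using this

lemma lin_bound {f f' : ℝ → ℝ} {Z c : ℝ} (hf : Continuous f) (h0 : f 0 = 0)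
    (hd : ∀ y, 0 < y → HasDerivAt f (f' y) y) (hb : ∀ y, 0 < y → y ≤ Z → |f' y| ≤ c) :
    ∀ y, 0 < y → y ≤ Z → |f y| ≤ c * y := by
  intro y hy hyZ
  have := cmp_deriv (R := f) (H := fun y => c * y) (H' := fun _ => c) hy.le hf.continuousOn
    (by fun_prop) (fun s hs _ => hd s hs)
    (fun s _ _ => by simpa using (hasDerivAt_id s).const_mul c)
    (fun s hs hsy => hb s hs (hsy.le.trans hyZ))
  simpa [h0] using this

lemma cont_bdd {f : ℝ → ℝ} (hf : Continuous f) (a b : ℝ) : ∃ c, 0 ≤ c ∧ ∀ y, a ≤ y → y ≤ b → |f y| ≤ c := by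
  obtain ⟨c, hc⟩ := (isCompact_Icc (a := a) (b := b)).exists_bound_of_continuousOn hf.continuousOn
  exact ⟨max c 0, le_max_right _ _, fun y h1 h2 => (hc y ⟨h1, h2⟩).trans (le_max_left _ _)⟩

lemma apriori {R R' : ℝ → ℝ} {Z : ℝ} (hR : Continuous R) (h0 : R 0 = 0) (hR' : Continuous R')
    (hd : ∀ y, 0 < y → HasDerivAt R (R' y) y) :
    ∃ a, 0 ≤ a ∧ ∀ y, 0 < y → y ≤ Z → |R y| ≤ a * √y := by
  obtain ⟨c, hc0, hc⟩ := cont_bdd hR' 0 Z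
  have h1 := lin_bound (Z := Z) hR h0 hd (fun y hy hyZ => hc y hy.le hyZ)
  refine ⟨c * √Z, by positivity, fun y hy hyZ => (h1 y hy hyZ).trans ?_⟩
  have : y = √y * √y := (Real.mul_self_sqrt hy.le).symm
  have h2 : √y ≤ √Z := Real.sqrt_le_sqrt hyZ
  calc c * y = c * (√y * √y) := by rw [← this]
    _ ≤ c * (√Z * √y) := by gcongr
    _ = _ := by ring

/-- continuity in the parameter -/
lemma mu_cont {β : ℝ} (hβ : 0 < β) {F : ℝ → ℝ → ℝ} (hF : ∀ μ, IsSol β μ (F μ)) {y : ℝ} (hy : 0 < y) :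
    Continuous (fun μ => F μ y) ∧ Continuous (fun μ => GG β μ (F μ) y) := by
  have key : ∀ ν, ∃ C, ∀ μ, |μ - ν| < 1 → |F μ y - F ν y| ≤ C * |μ - ν| ∧
      |GG β μ (F μ) y - GG β ν (F ν) y| ≤ C * |μ - ν| := by
    intro ν
    obtain ⟨hνc, hν0, hνd⟩ := hF ν
    set D : ℝ → ℝ := fun s => GG β 0 (F ν) s - GG β 1 (F ν) s with hD
    have hDc : Continuous D := (GG_cont hβ _ hνc).sub (GG_cont hβ _ hνc)
    have hDe : ∀ μ s, GG β μ (F ν) s - GG β ν (F ν) s = (ν - μ) * D s := by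
      intro μ s
      simp only [hD]
      unfold GG
      have h1 := fun μ => mtt_cont hβ μ
      have hi : ∀ μ, IntervalIntegrable (fun x => x * mtt β μ (s * x) * F ν (s * x)) volume 0 1 := by
        intro μ
        have := h1 μ
        apply Continuous.intervalIntegrable; fun_prop
      rw [← mul_sub, ← mul_sub, ← intervalIntegral.integral_sub (hi _) (hi _),
        ← intervalIntegral.integral_sub (hi _) (hi _), mul_left_comm (ν - μ), ← intervalIntegral.integral_const_mul (ν - μ)]
      congr 1
      apply intervalIntegral.integral_congr
      intro x _
      simp only [mtt]; ring
    obtain ⟨d, hd0, hd⟩ := cont_bdd hDc 0 y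
    set M := |ν| + 1
    set K := 4 * (2 + M)
    set E := 4 * (d * √y) * Real.exp (K * y)
    have hE : 0 ≤ E := by positivity
    refine ⟨E * √y + d + 2 * (2 + M) * E * √y * Real.exp (K * y), fun μ hμ => ?_⟩
    obtain ⟨hμc, hμ0, hμd⟩ := hF μ
    have hM : |μ| ≤ M := by
      have := abs_sub_abs_le_abs_sub μ ν
      simp only [M]; linarith
    have hM0 : 0 ≤ M := (abs_nonneg _).trans hM
    have hRd : ∀ s, 0 < s → HasDerivAt (fun t => F μ t - F ν t) (GG β μ (F μ) s - GG β ν (F ν) s) s :=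
      fun s hs => (hμd s hs).sub (hνd s hs)
    have heq : ∀ s, GG β μ (F μ) s - GG β ν (F ν) s =
        (ν - μ) * D s + GG β μ (fun t => F μ t - F ν t) s := by
      intro s; rw [← hDe, GG_sub hβ μ hμc hνc]; ring
    obtain ⟨a, ha0, ha⟩ := apriori (R := fun t => F μ t - F ν t) (Z := y) (hμc.sub hνc) (by simp [hμ0, hν0])
      ((GG_cont hβ μ hμc).sub (GG_cont hβ ν hνc)) hRd
    have hb := boot (R := fun t => F μ t - F ν t) (Z := y) (c := |μ - ν| * (d * √y)) (K := K) hβ hM le_rfl (by positivity) ha0 (hμc.sub hνc) (by simp [hμ0, hν0])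
      (B := fun s => (ν - μ) * D s) (fun s hs _ => by rw [← heq]; exact hRd s hs)
      (by
        intro s hs hsy
        have h1 : 1 ≤ Real.exp (K * s) := Real.one_le_exp (by positivity)
        have h2 : √s ≤ √y := Real.sqrt_le_sqrt hsy
        have hs' : 0 < √s := Real.sqrt_pos.2 hs
        have h3 : 1 ≤ √y / √s := by rw [le_div_iff₀ hs']; linarith
        rw [abs_mul, abs_sub_comm]
        calc |μ - ν| * |D s| ≤ |μ - ν| * d := by gcongr; exact hd s hs.le hsy
          _ = |μ - ν| * d * 1 * 1 := by ring
          _ ≤ |μ - ν| * d * (√y / √s) * Real.exp (K * s) := by gcongr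
          _ = _ := by ring) ha
    have hb' : ∀ t, 0 < t → t ≤ y → |F μ t - F ν t| ≤ (E * |μ - ν|) * √t * Real.exp (K * t) := by
      intro t ht hty
      have h1 : 1 ≤ Real.exp (K * y) := Real.one_le_exp (by positivity)
      refine (hb t ht hty).trans ?_
      have : 4 * (|μ - ν| * (d * √y)) ≤ E * |μ - ν| := ?_
      · gcongr
      simp only [E]
      calc 4 * (|μ - ν| * (d * √y)) = 4 * (d * √y) * 1 * |μ - ν| := by ring
        _ ≤ _ := by gcongr
    have hk := GG_kern hβ μ (h := fun t => F μ t - F ν t) (K := K) hy (by positivity) (by simp only [K]; linarith) hb'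
    constructor
    · refine (hb y hy le_rfl).trans ?_
      calc 4 * (|μ - ν| * (d * √y)) * √y * Real.exp (K * y) = (E * √y) * |μ - ν| := by simp only [E]; ring
        _ ≤ _ := by gcongr; have : 0 ≤ 2 * (2 + M) * E * √y * Real.exp (K * y) := by positivity
                    linarith
    · rw [heq]
      refine (abs_add_le _ _).trans ?_
      have h1 : |(ν - μ) * D y| ≤ d * |μ - ν| := by
        rw [abs_mul, abs_sub_comm, mul_comm]; gcongr; exact hd y hy.le le_rfl
      have h2 : 2 * (2 + |μ|) * (E * |μ - ν|) * √y * Real.exp (K * y) ≤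
        2 * (2 + M) * (E * |μ - ν|) * √y * Real.exp (K * y) := by gcongr
      have h3 : 0 ≤ E * √y * |μ - ν| := by positivity
      nlinarith
  have lip : ∀ g : ℝ → ℝ, (∀ ν, ∃ C, ∀ μ, |μ - ν| < 1 → |g μ - g ν| ≤ C * |μ - ν|) → Continuous g := by
    intro g hg
    rw [continuous_iff_continuousAt]
    intro ν
    obtain ⟨C, hC⟩ := hg ν
    have : Filter.Tendsto (fun μ => g μ - g ν) (nhds ν) (nhds 0) := by
      apply squeeze_zero_norm' (a := fun μ => C * |μ - ν|)
      · filter_upwards [Metric.ball_mem_nhds ν one_pos] with μ hμ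
        rw [Metric.mem_ball, Real.dist_eq] at hμ
        exact hC μ hμ
      · have : Continuous (fun μ => C * |μ - ν|) := by fun_prop
        simpa using this.tendsto ν
    simpa [ContinuousAt] using this.add_const (g ν)
  constructor
  · exact lip _ (fun ν => by obtain ⟨C, hC⟩ := key ν; exact ⟨C, fun μ h => (hC μ h).1⟩)
  · exact lip _ (fun ν => by obtain ⟨C, hC⟩ := key ν; exact ⟨C, fun μ h => (hC μ h).2⟩)

lemma int_A {β s : ℝ} (hβ : 0 < β) (hs : 0 ≤ s) :
    ∫ t in (0:ℝ)..s, 2 * β * t / (β + |t|) ^ 3 = s ^ 2 / (β + s) ^ 2 := by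
  have h1 : ∫ t in (0:ℝ)..s, 2 * β * t / (β + |t|) ^ 3 = ∫ t in (0:ℝ)..s, 2 * β * t / (β + t) ^ 3 := by
    apply intervalIntegral.integral_congr
    intro t ht
    rw [uIcc_of_le hs] at ht
    simp only [abs_of_nonneg ht.1]
  rw [h1, intervalIntegral.integral_eq_sub_of_hasDerivAt (f := fun t => t ^ 2 / (β + t) ^ 2)]
  · simp
  · intro t ht
    rw [uIcc_of_le hs] at ht
    have : β + t ≠ 0 := by have := ht.1; positivity
    have h2 : HasDerivAt (fun t => (β + t) ^ 2) (2 * (β + t)) t := by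
      simpa using ((hasDerivAt_id t).const_add β).fun_pow 2
    have h3 : HasDerivAt (fun t => t ^ 2) (2 * t) t := by
      simpa using (hasDerivAt_id' t).fun_pow 2
    refine (h3.div h2 (by positivity)).congr_deriv ?_
    field_simp; ring
  · apply ContinuousOn.intervalIntegrable
    rw [uIcc_of_le hs]
    apply ContinuousOn.div (by fun_prop) (by fun_prop)
    intro t ht
    have := ht.1; positivity

lemma int_Psi {β s : ℝ} (hβ : 0 < β) (hs : 0 ≤ s) :
    ∫ t in (0:ℝ)..s, t / (β + |t|) ^ 2 = Real.log (1 + s / β) - s / (β + s) := by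
  have h1 : ∫ t in (0:ℝ)..s, t / (β + |t|) ^ 2 = ∫ t in (0:ℝ)..s, t / (β + t) ^ 2 := by
    apply intervalIntegral.integral_congr
    intro t ht
    rw [uIcc_of_le hs] at ht
    simp only [abs_of_nonneg ht.1]
  rw [h1, intervalIntegral.integral_eq_sub_of_hasDerivAt (f := fun t => Real.log (β + t) + β / (β + t))]
  · have e : 1 + s / β = (β + s) / β := by field_simp
    rw [e, Real.log_div (by positivity) hβ.ne']
    simp; field_simp; ring
  · intro t ht
    rw [uIcc_of_le hs] at ht
    have h0 : β + t ≠ 0 := by have := ht.1; positivity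
    have h2 : HasDerivAt (fun t => β + t) 1 t := by
      simpa using ((hasDerivAt_id t).const_add β)
    refine ((h2.log h0).add ((hasDerivAt_const t β).div h2 h0)).congr_deriv ?_
    field_simp; ring
  · apply ContinuousOn.intervalIntegrable
    rw [uIcc_of_le hs]
    apply ContinuousOn.div (by fun_prop) (by fun_prop)
    intro t ht
    have := ht.1; positivity

lemma cont_A {β : ℝ} (hβ : 0 < β) : Continuous (fun t => 2 * β * t / (β + |t|) ^ 3) := by
  have : ∀ y : ℝ, (β + |y|) ^ 3 ≠ 0 := fun y => by positivity
  fun_prop (disch := assumption)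

lemma cont_Psi {β : ℝ} (hβ : 0 < β) : Continuous (fun t => t / (β + |t|) ^ 2) := by
  have : ∀ y : ℝ, (β + |y|) ^ 2 ≠ 0 := fun y => by positivity
  fun_prop (disch := assumption)

lemma cont_B2 {β : ℝ} (hβ : 0 < β) : Continuous (fun t : ℝ => 2 * β / (β + |t|)) := by
  have : ∀ y : ℝ, (β + |y|) ≠ 0 := fun y => by positivity
  fun_prop (disch := assumption)

lemma I1_bd {β s : ℝ} (hβ : 0 < β) (hs : 0 < s) :
    |(β + s) ^ 2 / s ^ 2 * ∫ t in (0:ℝ)..s, m0 β t * (2 * β / (β + |t|))| ≤ 1 := by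
  have hc := (m0_cont hβ).mul (cont_B2 hβ)
  have h0 : 0 ≤ ∫ t in (0:ℝ)..s, m0 β t * (2 * β / (β + |t|)) := by
    apply intervalIntegral.integral_nonneg hs.le
    intro t ht
    have := ht.1
    unfold m0; positivity
  have h1 : ∫ t in (0:ℝ)..s, m0 β t * (2 * β / (β + |t|)) ≤ ∫ t in (0:ℝ)..s, 2 * β * t / (β + |t|) ^ 3 := by
    apply intervalIntegral.integral_mono_on hs.le (hc.intervalIntegrable _ _) ((cont_A hβ).intervalIntegrable _ _)
    intro t ht
    have h1 := ht.1
    have h2 : Real.exp (-t) ≤ 1 := by simpa using h1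
    unfold m0
    calc Real.exp (-t) * (t / (β + |t|) ^ 2) * (2 * β / (β + |t|)) ≤ 1 * (t / (β + |t|) ^ 2) * (2 * β / (β + |t|)) := by gcongr
      _ = _ := by field_simp
  rw [int_A hβ hs.le] at h1
  rw [abs_of_nonneg (by positivity)]
  calc _ ≤ (β + s) ^ 2 / s ^ 2 * (s ^ 2 / (β + s) ^ 2) := by gcongr
    _ = 1 := by field_simp

lemma log_one_add_le {q : ℝ} (hq : 0 ≤ q) : Real.log (1 + q) ≤ q := by
  have := Real.log_le_sub_one_of_pos (show 0 < 1 + q by linarith); linarith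

lemma log_one_add_ge {q : ℝ} (hq : 0 ≤ q) : q / (1 + q) ≤ Real.log (1 + q) := by
  have := Real.one_sub_inv_le_log_of_pos (show 0 < 1 + q by linarith)
  have h : 1 - (1 + q)⁻¹ = q / (1 + q) := by field_simp; ring
  linarith

lemma Psi0_bd {β s : ℝ} (hβ : 0 < β) (hβ1 : β < 1) (hs : 0 < s) :
    |(β + s) ^ 2 / s ^ 2 * (Real.log (1 + s / β) - s / (β + s)) - (-Real.log β)| ≤ |Real.log s| + 4 := by
  obtain ⟨q, hq⟩ : ∃ q, q = s / β := ⟨_, rfl⟩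
  have hq0 : 0 < q := by rw [hq]; positivity
  have hsq : s = q * β := by rw [hq]; field_simp
  have e1 : (β + s) ^ 2 / s ^ 2 = (1 + q) ^ 2 / q ^ 2 := by rw [hsq]; field_simp
  have e2 : s / (β + s) = q / (1 + q) := by rw [hsq]; field_simp
  rw [e1, e2, ← hq]
  have l1 := log_one_add_le hq0.le
  have l2 := log_one_add_ge hq0.le
  have hLneg : Real.log β < 0 := Real.log_neg hβ hβ1
  rcases le_total q 1 with h | h
  · have hsβ : s ≤ β := by rw [hsq]; nlinarith
    have h1 : Real.log s ≤ Real.log β := Real.log_le_log hs hsβ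
    have h2 : |Real.log s| = - Real.log s := abs_of_nonpos (by linarith)
    have h3 : 0 ≤ (1 + q) ^ 2 / q ^ 2 * (Real.log (1 + q) - q / (1 + q)) :=
      mul_nonneg (by positivity) (by linarith)
    have h4 : (1 + q) ^ 2 / q ^ 2 * (Real.log (1 + q) - q / (1 + q)) ≤ 2 := by
      calc _ ≤ (1 + q) ^ 2 / q ^ 2 * (q - q / (1 + q)) := by gcongr
        _ = 1 + q := by field_simp; ring
        _ ≤ 2 := by linarith
    rw [h2, abs_le]; constructor <;> linarith
  · have e3 : Real.log (1 + q) = Real.log (β + s) - Real.log β := by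
      rw [← Real.log_div (by positivity) hβ.ne']; congr 1; rw [hsq]; field_simp
    have e4 : (1 + q) ^ 2 / q ^ 2 * (Real.log (1 + q) - q / (1 + q)) =
        Real.log (1 + q) + (2 / q + 1 / q ^ 2) * Real.log (1 + q) - (1 + q) / q := by
      field_simp; ring
    have h0 : 0 ≤ Real.log (1 + q) := Real.log_nonneg (by linarith)
    have h5 : 0 ≤ (2 / q + 1 / q ^ 2) * Real.log (1 + q) := by positivity
    have h6 : (2 / q + 1 / q ^ 2) * Real.log (1 + q) ≤ 3 := by
      calc _ ≤ (2 / q + 1 / q ^ 2) * q := by gcongr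
        _ = 2 + 1 / q := by field_simp
        _ ≤ 3 := by
          have : 1 / q ≤ 1 := by rw [div_le_one hq0]; exact h
          linarith
    have h7 : (1 + q) / q ≤ 2 := by rw [div_le_iff₀ hq0]; linarith
    have h8 : 0 ≤ (1 + q) / q := by positivity
    have hsβ : β ≤ s := by rw [hsq]; nlinarith
    have g1 : Real.log s ≤ Real.log (β + s) := Real.log_le_log hs (by linarith)
    have g2 : Real.log (β + s) ≤ Real.log s + 1 := by
      calc Real.log (β + s) ≤ Real.log (2 * s) := Real.log_le_log (by linarith) (by linarith)
        _ = Real.log 2 + Real.log s := Real.log_mul (by norm_num) hs.ne'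
        _ ≤ _ := by have := Real.log_two_lt_d9; linarith
    have g3 := abs_le.1 (le_refl |Real.log s|)
    rw [e4, abs_le]; constructor <;> linarith

lemma Psi_bd {β s : ℝ} (hβ : 0 < β) (hβ1 : β < 1) (hs : 0 < s) :
    |(β + s) ^ 2 / s ^ 2 * (∫ t in (0:ℝ)..s, m0 β t) - (-Real.log β)| ≤ |Real.log s| + 4 + s := by
  have h0 := Psi0_bd hβ hβ1 hs
  rw [← int_Psi hβ hs.le] at h0
  have h1 : |(∫ t in (0:ℝ)..s, m0 β t) - ∫ t in (0:ℝ)..s, t / (β + |t|) ^ 2| ≤ s ^ 2 / (β + s) ^ 2 * |s - 0| := by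
    rw [← intervalIntegral.integral_sub ((m0_cont hβ).intervalIntegrable _ _) ((cont_Psi hβ).intervalIntegrable _ _),
      ← Real.norm_eq_abs]
    apply intervalIntegral.norm_integral_le_of_norm_le_const
    intro t ht
    rw [uIoc_of_le hs.le] at ht
    have ht0 := ht.1
    unfold m0
    rw [abs_of_pos ht0, Real.norm_eq_abs]
    have e : Real.exp (-t) * (t / (β + t) ^ 2) - t / (β + t) ^ 2 = -((1 - Real.exp (-t)) * (t / (β + t) ^ 2)) := by ring
    have h2 : 0 ≤ 1 - Real.exp (-t) := by
      have : Real.exp (-t) ≤ 1 := by simpa using ht0.le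
      linarith
    have h3 : 1 - Real.exp (-t) ≤ t := by have := Real.add_one_le_exp (-t); linarith
    rw [e, abs_neg, abs_of_nonneg (by positivity)]
    calc _ ≤ t * (t / (β + t) ^ 2) := by gcongr
      _ = (t / (β + t)) ^ 2 := by field_simp
      _ ≤ (s / (β + s)) ^ 2 := by
        gcongr 1
        rw [div_le_div_iff₀ (by positivity) (by positivity)]
        nlinarith [ht.2]
      _ = _ := by rw [div_pow]
  rw [sub_zero, abs_of_pos hs] at h1
  set X := ∫ t in (0:ℝ)..s, m0 β t
  set X' := ∫ t in (0:ℝ)..s, t / (β + |t|) ^ 2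
  have e : (β + s) ^ 2 / s ^ 2 * X - (-Real.log β) = ((β + s) ^ 2 / s ^ 2 * X' - (-Real.log β)) +
    (β + s) ^ 2 / s ^ 2 * (X - X') := by ring
  rw [e]
  refine (abs_add_le _ _).trans ?_
  have : |(β + s) ^ 2 / s ^ 2 * (X - X')| ≤ s := by
    rw [abs_mul, abs_of_nonneg (by positivity)]
    calc _ ≤ (β + s) ^ 2 / s ^ 2 * (s ^ 2 / (β + s) ^ 2 * s) := by gcongr
      _ = s := by field_simp
  linarith

lemma abs_log_le {s : ℝ} (hs : 0 < s) : |Real.log s| ≤ 2 * √s + 2 / √s := by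
  have hq : 0 < √s := Real.sqrt_pos.2 hs
  have e : Real.log s = 2 * Real.log √s := by rw [Real.log_sqrt hs.le]; ring
  have h1 := Real.log_le_sub_one_of_pos hq
  have h2 := Real.one_sub_inv_le_log_of_pos hq
  have h3 : 2 / √s = 2 * (√s)⁻¹ := by ring
  have h4 : 0 < (√s)⁻¹ := by positivity
  rw [e, h3, abs_le]; constructor <;> linarith

lemma L_sqrt {β : ℝ} (hβ : 0 < β) : (-Real.log β) * √β ≤ 2 := by
  have hq : 0 < √β := Real.sqrt_pos.2 hβ
  have e : Real.log β = 2 * Real.log √β := by rw [Real.log_sqrt hβ.le]; ring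
  have h2 := Real.one_sub_inv_le_log_of_pos hq
  have h3 : -Real.log β ≤ 2 * (√β)⁻¹ := by rw [e]; linarith
  calc _ ≤ 2 * (√β)⁻¹ * √β := by gcongr
    _ = 2 := by field_simp

lemma frac_sqrt {β t : ℝ} (hβ : 0 < β) (ht : 0 < t) : 2 * β / (β + t) ≤ √β * (√t)⁻¹ := by
  have h1 : 0 < √β := Real.sqrt_pos.2 hβ
  have h2 : 0 < √t := Real.sqrt_pos.2 ht
  have e1 : √β * √β = β := Real.mul_self_sqrt hβ.le
  have e2 : √t * √t = t := Real.mul_self_sqrt ht.le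
  rw [div_le_iff₀ (by positivity)]
  have : √β * (√t)⁻¹ * (√β * √β + √t * √t) - 2 * (√β * √β) = √β * (√t)⁻¹ * (√β - √t) ^ 2 := by
    field_simp; ring
  rw [e1, e2] at this
  nlinarith [show 0 ≤ √β * (√t)⁻¹ * (√β - √t) ^ 2 by positivity]

lemma int_invsqrt {s : ℝ} (hs : 0 ≤ s) : IntervalIntegrable (fun t => (√t)⁻¹) volume 0 s ∧
    ∫ t in (0:ℝ)..s, (√t)⁻¹ = 2 * √s := by
  have e : ∀ t ∈ uIoc 0 s, t ^ (-(1/2) : ℝ) = (√t)⁻¹ := by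
    intro t ht
    rw [uIoc_of_le hs] at ht
    rw [Real.sqrt_eq_rpow, Real.rpow_neg ht.1.le]
  have h1 : IntervalIntegrable (fun t : ℝ => t ^ (-(1/2) : ℝ)) volume 0 s :=
    intervalIntegral.intervalIntegrable_rpow' (by norm_num)
  constructor
  · exact h1.congr e
  · rw [← intervalIntegral.integral_congr_ae (Filter.Eventually.of_forall e), integral_rpow (by left; norm_num),
      Real.sqrt_eq_rpow]
    norm_num; ring

/-- kernel difference -/
lemma kfac {β s t : ℝ} (hβ : 0 < β) (ht : 0 < t) (hts : t ≤ s) :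
    0 ≤ (β + s) ^ 2 * t ^ 2 / (s ^ 2 * (β + t) ^ 2) ∧
    (β + s) ^ 2 * t ^ 2 / (s ^ 2 * (β + t) ^ 2) ≤ 1 ∧
    1 - (β + s) ^ 2 * t ^ 2 / (s ^ 2 * (β + t) ^ 2) ≤ 2 * β / (β + t) := by
  have hs : 0 < s := ht.trans_le hts
  have e : (β + s) ^ 2 * t ^ 2 / (s ^ 2 * (β + t) ^ 2) = ((β + s) * t / (s * (β + t))) ^ 2 := by
    field_simp
  set x := (β + s) * t / (s * (β + t)) with hx
  have hx0 : 0 ≤ x := by positivity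
  have hx1 : x ≤ 1 := by rw [hx, div_le_one (by positivity)]; nlinarith
  have hx2 : t / (β + t) ≤ x := by
    rw [hx, div_le_div_iff₀ (by positivity) (by positivity)]
    have : 0 ≤ t * (β + t) * β := by positivity
    nlinarith
  have hx3 : t / (β + t) = 1 - β / (β + t) := by field_simp; ring
  have h4 : 2 * β / (β + t) = 2 * (β / (β + t)) := by ring
  rw [e]
  refine ⟨by positivity, by nlinarith, ?_⟩
  rw [h4]; nlinarith

set_option maxHeartbeats 2000000 in
lemma R_est (ν A Y : ℝ) (hν : 0 ≤ ν) (hA : 0 ≤ A) (hY : 0 < Y) (N N' q : ℝ → ℝ) (hqc : Continuous q) (hN'c : Continuous N')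
    (hNq : ∀ t, N t = t * q t) (hNd : ∀ t, HasDerivAt N (N' t) t)
    (hN' : ∀ s, 0 < s → N' s = Real.exp s * (-ν - ν * ∫ t in (0:ℝ)..s, Real.exp (-t) * q t)) :
    ∃ C, 0 < C ∧ ∀ β, 0 < β → β ≤ Real.exp (-1) → ∀ μ, |μ - ν| ≤ A / (-Real.log β) → ∀ f, IsSol β μ f →
      ∀ y, 0 < y → y ≤ Y → |f y - (1 + (-Real.log β) * N y)| ≤ C * √y ∧
        |GG β μ f y - (-Real.log β) * N' y| ≤ C / √y := by
  have hNc : Continuous N := by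
    have : N = fun t => t * q t := funext hNq
    rw [this]; fun_prop
  obtain ⟨Q, hQ0, hQ⟩ := cont_bdd hqc 0 Y
  set M := ν + A
  have hM0 : 0 ≤ M := by positivity
  set K := 4 * (2 + M)
  have hK0 : 0 ≤ K := by positivity
  set c := Real.exp Y * (√Y + M * ((2 * √Y + 2 / √Y) * √Y + 2 * Y + 2 + (4 + Y) * √Y) + A * √Y + Q * (4 * (1 + ν) * Y + A * Y * √Y)) with hc
  have hc0 : 0 ≤ c := by positivity
  refine ⟨4 * c * Real.exp (K * Y) + 1 + c + 2 * (2 + M) * (4 * c) * Y * Real.exp (K * Y), by positivity, ?_⟩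
  intro β hβ hβ1 μ hμ f hf y hy hyY
  obtain ⟨L, hL⟩ : ∃ L, L = -Real.log β := ⟨_, rfl⟩
  rw [← hL] at hμ ⊢
  have hL1 : 1 ≤ L := by
    have := Real.log_le_log hβ hβ1
    rw [Real.log_exp] at this; linarith
  have hLpos : 0 < L := by linarith
  have hβlt : β < 1 := hβ1.trans_lt (by rw [Real.exp_lt_one_iff]; norm_num)
  have hAL : A / L ≤ A := by rw [div_le_iff₀ hLpos]; nlinarith
  have hμM : |μ| ≤ M := by
    have h1 := abs_sub_abs_le_abs_sub μ ν
    rw [abs_of_nonneg hν] at h1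
    simp only [M]; linarith
  obtain ⟨hfc, hf0, hfd⟩ := hf
  obtain ⟨h, hh⟩ : ∃ h : ℝ → ℝ, h = fun t => 1 + L * N t := ⟨_, rfl⟩
  have hhc : Continuous h := by rw [hh]; fun_prop
  have hGR : ∀ s, GG β μ f s - L * N' s = (GG β μ h s - L * N' s) + GG β μ (fun t => f t - h t) s := by
    intro s; rw [GG_sub hβ μ hfc hhc]; ring
  have hRd : ∀ s, 0 < s → HasDerivAt (fun t => f t - h t) (GG β μ f s - L * N' s) s := by
    intro s hs
    rw [hh]
    exact (hfd s hs).sub (((hNd s).const_mul L).const_add 1)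
  have hR0 : f 0 - h 0 = 0 := by rw [hh, hf0]; simp [hNq]
  obtain ⟨a, ha0, ha⟩ := apriori (R := fun t => f t - h t) (Z := Y) (hfc.sub hhc) hR0
    ((GG_cont hβ μ hfc).sub (continuous_const.mul hN'c)) hRd
  have hB : ∀ s, 0 < s → s ≤ Y → |GG β μ h s - L * N' s| ≤ c / √s := by
    intro s hs hsY
    have i1 : IntervalIntegrable (fun t => m0 β t * (2 * β / (β + |t|))) volume 0 s :=
      ((m0_cont hβ).mul (cont_B2 hβ)).intervalIntegrable _ _
    have i2 : IntervalIntegrable (fun t => m0 β t) volume 0 s := (m0_cont hβ).intervalIntegrable _ _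
    have i3 : IntervalIntegrable (fun t => mm β μ t * N t) volume 0 s :=
      ((mm_cont hβ μ).mul hNc).intervalIntegrable _ _
    have i4 : IntervalIntegrable (fun t => Real.exp (-t) * q t) volume 0 s := by
      apply Continuous.intervalIntegrable; fun_prop
    have e1 : ∫ t in (0:ℝ)..s, mm β μ t * h t = (∫ t in (0:ℝ)..s, m0 β t * (2 * β / (β + |t|)))
        - μ * (∫ t in (0:ℝ)..s, m0 β t) + L * ∫ t in (0:ℝ)..s, mm β μ t * N t := by
      rw [← intervalIntegral.integral_const_mul, ← intervalIntegral.integral_const_mul,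
        ← intervalIntegral.integral_sub i1 (i2.const_mul μ),
        ← intervalIntegral.integral_add (i1.sub (i2.const_mul μ)) (i3.const_mul L)]
      apply intervalIntegral.integral_congr
      intro t _
      simp only [hh, mm]; ring
    have hI1 := I1_bd hβ hs
    have hPsi := Psi_bd hβ hβlt hs
    rw [← hL] at hPsi
    have hI3 : |(β + s) ^ 2 / s ^ 2 * (∫ t in (0:ℝ)..s, mm β μ t * N t) + ν * ∫ t in (0:ℝ)..s, Real.exp (-t) * q t|
        ≤ Q * ((1 + ν) * √β * (2 * √s) + A / L * s) := by
      rw [← intervalIntegral.integral_const_mul, ← intervalIntegral.integral_const_mul,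
        ← intervalIntegral.integral_add (i3.const_mul _) (i4.const_mul _), ← Real.norm_eq_abs]
      obtain ⟨j1, j2⟩ := int_invsqrt hs.le
      have hj : ∫ t in (0:ℝ)..s, (Q * ((1 + ν) * √β) * (√t)⁻¹ + Q * (A / L)) = Q * ((1 + ν) * √β * (2 * √s) + A / L * s) := by
        rw [intervalIntegral.integral_add (j1.const_mul _) (intervalIntegrable_const), intervalIntegral.integral_const_mul, j2]
        simp; ring
      rw [← hj]
      apply intervalIntegral.norm_integral_le_of_norm_le hs.le
      · apply Filter.Eventually.of_forall
        intro t ht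
        have ht0 := ht.1
        obtain ⟨k0, k1, k2⟩ := kfac hβ ht0 ht.2
        set k := (β + s) ^ 2 * t ^ 2 / (s ^ 2 * (β + t) ^ 2) with hk
        have e2 : (β + s) ^ 2 / s ^ 2 * (mm β μ t * N t) + ν * (Real.exp (-t) * q t) =
            Real.exp (-t) * q t * (k * (2 * β / (β + t)) + ν * (1 - k) + k * (ν - μ)) := by
          rw [hNq, mm, m0, abs_of_pos ht0, hk]
          field_simp; ring
        rw [e2, Real.norm_eq_abs, abs_mul, abs_mul, abs_of_pos (Real.exp_pos _)]
        have h1 : Real.exp (-t) ≤ 1 := by simpa using ht0.le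
        have h2 := hQ t ht0.le (ht.2.trans hsY)
        have h3 := frac_sqrt hβ ht0
        have h4 : 0 ≤ 2 * β / (β + t) := by positivity
        have h5 : |k * (2 * β / (β + t)) + ν * (1 - k) + k * (ν - μ)| ≤ (1 + ν) * (√β * (√t)⁻¹) + A / L := by
          have a1 : |k * (ν - μ)| ≤ A / L := by
            rw [abs_mul, abs_of_nonneg k0, abs_sub_comm]
            have := abs_nonneg (μ - ν)
            nlinarith
          have a2 : |k * (2 * β / (β + t)) + ν * (1 - k)| ≤ (1 + ν) * (√β * (√t)⁻¹) := by
            rw [abs_of_nonneg (by have : 0 ≤ 1 - k := by linarith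
                                  positivity)]
            have b1 : k * (2 * β / (β + t)) ≤ 2 * β / (β + t) := by nlinarith
            have b2 : ν * (1 - k) ≤ ν * (√β * (√t)⁻¹) := by gcongr; linarith
            linarith
          exact (abs_add_le _ _).trans (by linarith)
        calc _ ≤ 1 * Q * ((1 + ν) * (√β * (√t)⁻¹) + A / L) := by gcongr
          _ = _ := by ring
      · exact (j1.const_mul _).add intervalIntegrable_const
    have e3 : GG β μ h s - L * N' s = Real.exp s * (((β + s) ^ 2 / s ^ 2 * ∫ t in (0:ℝ)..s, m0 β t * (2 * β / (β + |t|)))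
        - μ * ((β + s) ^ 2 / s ^ 2 * (∫ t in (0:ℝ)..s, m0 β t) - L) + L * (ν - μ) +
        L * ((β + s) ^ 2 / s ^ 2 * (∫ t in (0:ℝ)..s, mm β μ t * N t) + ν * ∫ t in (0:ℝ)..s, Real.exp (-t) * q t)) := by
      rw [GG_eq hβ μ h hs, e1, hN' s hs, wt, abs_of_pos hs, Real.exp_neg]
      generalize (∫ t in (0:ℝ)..s, m0 β t * (2 * β / (β + |t|))) = X1
      generalize (∫ t in (0:ℝ)..s, m0 β t) = X2
      generalize (∫ t in (0:ℝ)..s, mm β μ t * N t) = X3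
      generalize (∫ t in (0:ℝ)..s, Real.exp (-t) * q t) = X4
      have := (Real.exp_pos s).ne'
      field_simp; ring
    rw [e3, abs_mul, abs_of_pos (Real.exp_pos _)]
    have hsq : 0 < √s := Real.sqrt_pos.2 hs
    have hsqY : √s ≤ √Y := Real.sqrt_le_sqrt hsY
    have hss : √s * √s = s := Real.mul_self_sqrt hs.le
    have b1 : |L * (ν - μ)| ≤ A := by
      rw [abs_mul, abs_of_pos hLpos, abs_sub_comm]
      rw [le_div_iff₀ hLpos] at hμ; linarith
    have hlog := abs_log_le hs
    have b2 : |μ * ((β + s) ^ 2 / s ^ 2 * (∫ t in (0:ℝ)..s, m0 β t) - L)| ≤ M * (2 * √s + 2 / √s + 4 + s) := by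
      rw [abs_mul]; gcongr; linarith
    have b3 : |L * ((β + s) ^ 2 / s ^ 2 * (∫ t in (0:ℝ)..s, mm β μ t * N t) + ν * ∫ t in (0:ℝ)..s, Real.exp (-t) * q t)|
        ≤ Q * (4 * (1 + ν) * √s + A * s) := by
      rw [abs_mul, abs_of_pos hLpos]
      have hLs := L_sqrt hβ
      rw [← hL] at hLs
      calc _ ≤ L * (Q * ((1 + ν) * √β * (2 * √s) + A / L * s)) := by gcongr
        _ = Q * ((1 + ν) * (L * √β) * (2 * √s) + A * s) := by field_simp
        _ ≤ Q * ((1 + ν) * 2 * (2 * √s) + A * s) := by gcongr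
        _ = _ := by ring
    have b4 : ∀ x1 x2 x3 x4 : ℝ, |x1 - x2 + x3 + x4| ≤ |x1| + |x2| + |x3| + |x4| := by
      intro x1 x2 x3 x4
      have := abs_add_le (x1 - x2 + x3) x4
      have := abs_add_le (x1 - x2) x3
      have := abs_sub x1 x2
      linarith
    rw [le_div_iff₀ hsq]
    have hexp : Real.exp s ≤ Real.exp Y := Real.exp_le_exp.2 hsY
    calc _ ≤ Real.exp Y * (1 + M * (2 * √s + 2 / √s + 4 + s) + A + Q * (4 * (1 + ν) * √s + A * s)) * √s := by
          gcongr
          refine (b4 _ _ _ _).trans ?_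
          linarith
      _ = Real.exp Y * (√s + M * (2 * s + 2 + (4 + s) * √s) + A * √s + Q * (4 * (1 + ν) * s + A * s * √s)) := by
          have key : ∀ σ S : ℝ, 0 < σ → σ * σ = S →
            Real.exp Y * (1 + M * (2 * σ + 2 / σ + 4 + S) + A + Q * (4 * (1 + ν) * σ + A * S)) * σ
            = Real.exp Y * (σ + M * (2 * S + 2 + (4 + S) * σ) + A * σ + Q * (4 * (1 + ν) * S + A * S * σ)) := by
            intro σ S h1 h2; subst h2; field_simp; ring
          exact key _ _ hsq hss
      _ ≤ Real.exp Y * (√Y + M * (2 * Y + 2 + (4 + Y) * √Y) + A * √Y + Q * (4 * (1 + ν) * Y + A * Y * √Y)) := by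
          gcongr
      _ ≤ c := by
          rw [hc]; gcongr
          have : 0 ≤ (2 * √Y + 2 / √Y) * √Y := by positivity
          linarith
  have hone : ∀ s, 0 < s → 1 ≤ Real.exp (K * s) := fun s hs => Real.one_le_exp (by positivity)
  have hb := boot (R := fun t => f t - h t) (Z := Y) (c := c) (K := K) hβ hμM le_rfl hc0 ha0 (hfc.sub hhc) hR0
    (B := fun s => GG β μ h s - L * N' s) (fun s hs _ => by rw [← hGR]; exact hRd s hs)
    (fun s hs hsY => by
      refine (hB s hs hsY).trans ?_
      have := hone s hs
      have h0 : 0 ≤ c / √s := by positivity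
      nlinarith) ha
  have hk := GG_kern hβ μ (h := fun t => f t - h t) (K := K) hy (by positivity) (by simp only [K]; linarith)
      (fun t ht hty => hb t ht (hty.trans hyY))
  have hEy : Real.exp (K * y) ≤ Real.exp (K * Y) := Real.exp_le_exp.2 (by gcongr)
  have hsy : 0 < √y := Real.sqrt_pos.2 hy
  have p0 : 0 ≤ 4 * c * Real.exp (K * Y) := by positivity
  have p1 : 0 ≤ 2 * (2 + M) * (4 * c) * Y * Real.exp (K * Y) := by positivity
  constructor
  · have h1 := hb y hy hyY
    simp only [hh] at h1
    refine h1.trans ?_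
    calc 4 * c * √y * Real.exp (K * y) ≤ 4 * c * √y * Real.exp (K * Y) := by gcongr
      _ = (4 * c * Real.exp (K * Y)) * √y := by ring
      _ ≤ _ := by gcongr; linarith
  · rw [hGR]
    refine (abs_add_le _ _).trans ?_
    have h1 := hB y hy hyY
    have hyy : √y * √y = y := Real.mul_self_sqrt hy.le
    have h2 : 2 * (2 + |μ|) * (4 * c) * √y * Real.exp (K * y) ≤ 2 * (2 + M) * (4 * c) * Y * Real.exp (K * Y) / √y := by
      rw [le_div_iff₀ hsy]
      calc 2 * (2 + |μ|) * (4 * c) * √y * Real.exp (K * y) * √y = 2 * (2 + |μ|) * (4 * c) * (√y * √y) * Real.exp (K * y) := by ring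
        _ = 2 * (2 + |μ|) * (4 * c) * y * Real.exp (K * y) := by rw [hyy]
        _ ≤ _ := by gcongr
    calc _ ≤ c / √y + 2 * (2 + M) * (4 * c) * Y * Real.exp (K * Y) / √y := by linarith
      _ = (c + 2 * (2 + M) * (4 * c) * Y * Real.exp (K * Y)) / √y := by ring
      _ ≤ _ := by gcongr; linarith

open Polynomial in
noncomputable def pp : ℕ → Polynomial ℝ
  | 0 => 1
  | (n+1) => C (1 / ((n:ℝ) + 1)) * ((C (n:ℝ) - X) * pp n + X * derivative (pp n))

open Polynomial in
lemma pp_rec (n : ℕ) : C ((n:ℝ) + 1) * pp (n+1) = (C (n:ℝ) - X) * pp n + X * derivative (pp n) := by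
  rw [pp, ← mul_assoc, ← C_mul]
  have : ((n:ℝ) + 1) * (1 / ((n:ℝ) + 1)) = 1 := by field_simp
  rw [this]; simp

open Polynomial in
lemma pp_core (n : ℕ) : derivative (pp (n+1)) = derivative (pp n) - pp n ∧
    X * derivative (pp (n+1)) = C ((n:ℝ) + 1) * pp (n+1) - C (n:ℝ) * pp n ∧
    X * derivative (derivative (pp n)) = X * derivative (pp n) - C (n:ℝ) * pp n := by
  have step : ∀ n : ℕ, X * derivative (derivative (pp n)) = X * derivative (pp n) - C (n:ℝ) * pp n →
      derivative (pp (n+1)) = derivative (pp n) - pp n ∧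
      X * derivative (pp (n+1)) = C ((n:ℝ) + 1) * pp (n+1) - C (n:ℝ) * pp n := by
    intro n ih
    have hne : C ((n:ℝ) + 1) ≠ 0 := by
      rw [Ne, C_eq_zero]; positivity
    have h1 := congrArg derivative (pp_rec n)
    simp only [derivative_mul, derivative_add, derivative_sub, derivative_C, derivative_X, zero_mul, zero_add, zero_sub] at h1
    have ha : derivative (pp (n+1)) = derivative (pp n) - pp n := by
      apply mul_left_cancel₀ hne
      rw [C_add, C_1] at h1 ⊢
      linear_combination h1 + ih
    refine ⟨ha, ?_⟩
    rw [pp_rec, ha]; ring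
  have ode : ∀ n : ℕ, X * derivative (derivative (pp n)) = X * derivative (pp n) - C (n:ℝ) * pp n := by
    intro n
    induction n with
    | zero => simp [pp]
    | succ n ih =>
      obtain ⟨ha, hb⟩ := step n ih
      have h1 := congrArg derivative hb
      simp only [derivative_mul, derivative_sub, derivative_C, derivative_X, zero_mul, zero_add, one_mul] at h1
      push_cast
      rw [C_add, C_1] at *
      linear_combination h1 - hb + C (n:ℝ) * ha
  exact ⟨(step n (ode n)).1, (step n (ode n)).2, ode n⟩

noncomputable def PP (n : ℕ) (y : ℝ) : ℝ := (pp n).eval y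
noncomputable def PD (n : ℕ) (y : ℝ) : ℝ := (Polynomial.derivative (pp n)).eval y
noncomputable def QQ (n : ℕ) (y : ℝ) : ℝ := (Polynomial.divX (pp n)).eval y

lemma PP_cont (n : ℕ) : Continuous (PP n) := (pp n).continuous
lemma PD_cont (n : ℕ) : Continuous (PD n) := (Polynomial.derivative (pp n)).continuous
lemma QQ_cont (n : ℕ) : Continuous (QQ n) := (Polynomial.divX (pp n)).continuous
lemma PP_hasDeriv (n : ℕ) (y : ℝ) : HasDerivAt (PP n) (PD n y) y := (pp n).hasDerivAt y

lemma PP_zero_fun (y : ℝ) : PP 0 y = 1 := by simp [PP, pp]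
lemma PD_zero_fun (y : ℝ) : PD 0 y = 0 := by simp [PD, pp]

lemma PP_rec (n : ℕ) (y : ℝ) : ((n:ℝ) + 1) * PP (n+1) y = (n - y) * PP n y + y * PD n y := by
  simpa [PP, PD] using congrArg (Polynomial.eval y) (pp_rec n)
lemma PD_succ (n : ℕ) (y : ℝ) : PD (n+1) y = PD n y - PP n y := by
  simpa [PP, PD] using congrArg (Polynomial.eval y) (pp_core n).1
lemma PD_succ' (n : ℕ) (y : ℝ) : y * PD (n+1) y = ((n:ℝ) + 1) * PP (n+1) y - n * PP n y := by
  simpa [PP, PD] using congrArg (Polynomial.eval y) (pp_core n).2.1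

lemma PP_at_zero (n : ℕ) : PP (n+1) 0 = 0 ∧ PD (n+1) 0 = -1 := by
  induction n with
  | zero =>
    have h1 := PP_rec 0 0
    have h2 := PD_succ 0 0
    simp [PP_zero_fun, PD_zero_fun] at h1 h2
    exact ⟨by simpa using h1, by simpa using h2⟩
  | succ n ih =>
    have h1 := PP_rec (n+1) 0
    have h2 := PD_succ (n+1) 0
    rw [ih.1] at h1
    rw [ih.1, ih.2] at h2
    constructor
    · have : ((n+1:ℕ):ℝ) + 1 ≠ 0 := by positivity
      simp at h1
      rcases h1 with h | h
      · exfalso; apply this; push_cast; linarith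
      · exact h
    · linarith

lemma pp_eq_X_mul (n : ℕ) : pp (n+1) = Polynomial.X * Polynomial.divX (pp (n+1)) := by
  have h := Polynomial.divX_mul_X_add (pp (n+1))
  have h0 : (pp (n+1)).coeff 0 = 0 := by
    rw [Polynomial.coeff_zero_eq_eval_zero]; exact (PP_at_zero n).1
  rw [h0, Polynomial.C_0, add_zero] at h
  rw [mul_comm]; exact h.symm

lemma PP_eq (n : ℕ) (y : ℝ) : PP (n+1) y = y * QQ (n+1) y := by
  simpa [PP, QQ] using congrArg (Polynomial.eval y) (pp_eq_X_mul n)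

/-- second derivative relation -/
lemma PD_hasDeriv (n : ℕ) (y : ℝ) : HasDerivAt (PD (n+1)) (PD (n+1) y - (n+1) * QQ (n+1) y) y := by
  have h := (Polynomial.derivative (pp (n+1))).hasDerivAt y
  refine h.congr_deriv ?_
  have h2 := (pp_core (n+1)).2.2
  have h3 : Polynomial.derivative (Polynomial.derivative (pp (n+1))) = Polynomial.derivative (pp (n+1)) -
      Polynomial.C ((n+1:ℕ):ℝ) * Polynomial.divX (pp (n+1)) := by
    apply mul_left_cancel₀ (Polynomial.X_ne_zero (R := ℝ))
    rw [h2]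
    nth_rewrite 2 [pp_eq_X_mul n]
    ring
  rw [h3]; simp [PD, QQ]

lemma PD_int (n : ℕ) (s : ℝ) : Real.exp (-s) * PD (n+1) s = -1 - (n+1) * ∫ t in (0:ℝ)..s, Real.exp (-t) * QQ (n+1) t := by
  have hd : ∀ t, HasDerivAt (fun t => Real.exp (-t) * PD (n+1) t) (-(n+1) * (Real.exp (-t) * QQ (n+1) t)) t := by
    intro t
    have h1 : HasDerivAt (fun t : ℝ => Real.exp (-t)) (Real.exp (-t) * -1) t := (hasDerivAt_neg t).exp
    refine (h1.mul (PD_hasDeriv n t)).congr_deriv ?_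
    ring
  have hq := QQ_cont (n+1)
  have h := intervalIntegral.integral_eq_sub_of_hasDerivAt (a := 0) (b := s) (fun t _ => hd t)
    (by apply Continuous.intervalIntegrable; fun_prop)
  rw [intervalIntegral.integral_const_mul, (PP_at_zero n).2] at h
  simp at h; linarith

/-- N data -/
lemma N_identity (n : ℕ) (s : ℝ) : (n:ℝ) * PD n s =
    Real.exp s * (-(n:ℝ) - n * ∫ t in (0:ℝ)..s, Real.exp (-t) * (n * QQ n t)) := by
  cases n with
  | zero => simp
  | succ n =>
    have h := PD_int n s
    have e : ∀ t, Real.exp (-t) * (((n+1:ℕ):ℝ) * QQ (n+1) t) = ((n+1:ℕ):ℝ) * (Real.exp (-t) * QQ (n+1) t) := fun t => by ring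
    simp_rw [e]
    rw [intervalIntegral.integral_const_mul]
    have h2 : PD (n+1) s = Real.exp s * (Real.exp (-s) * PD (n+1) s) := by
      rw [← mul_assoc, ← Real.exp_add]; simp
    rw [h2, h]; push_cast; ring

lemma nPP_eq (n : ℕ) (y : ℝ) : (n:ℝ) * PP n y = y * (n * QQ n y) := by
  cases n with
  | zero => simp
  | succ n => rw [PP_eq]; ring

lemma PP_PD_ne (n : ℕ) {x : ℝ} (hx : 0 < x) : PP n x = 0 → PD n x ≠ 0 := by
  induction n with
  | zero => intro h; simp [PP_zero_fun] at h
  | succ n ih =>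
    intro h h'
    rcases Nat.eq_zero_or_pos n with h0 | h0
    · subst h0
      have := PD_succ 0 x
      rw [h', PD_zero_fun, PP_zero_fun] at this
      norm_num at this
    · have h1 := PD_succ' n x
      rw [h, h'] at h1
      have h2 : PP n x = 0 := by
        have : (n:ℝ) ≠ 0 := by positivity
        have h3 : (n:ℝ) * PP n x = 0 := by linarith
        exact (mul_eq_zero.1 h3).resolve_left this
      have h3 := PD_succ n x
      rw [h', h2] at h3
      exact ih h2 (by linarith)

open Polynomial in
lemma pp_natDegree (n : ℕ) : (pp n).natDegree ≤ n := by
  induction n with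
  | zero => simp [pp]
  | succ n ih =>
    rw [pp]
    refine (natDegree_C_mul_le _ _).trans ?_
    refine (natDegree_add_le _ _).trans (max_le ?_ ?_)
    · refine natDegree_mul_le.trans ?_
      have : (C (n:ℝ) - X).natDegree ≤ 1 := by
        refine (natDegree_sub_le _ _).trans ?_
        simp
      omega
    · refine natDegree_mul_le.trans ?_
      have := natDegree_derivative_le (pp n)
      simp; omega

lemma pp_ne (n : ℕ) : pp n ≠ 0 := by
  cases n with
  | zero => simp [pp]
  | succ n =>
    intro h
    have := (PP_at_zero n).2
    simp [PD, h] at this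

lemma poly_exp_bd (p : Polynomial ℝ) {ε : ℝ} (hε : 0 < ε) : ∃ C, 0 < C ∧ ∀ y, 0 ≤ y → |p.eval y| ≤ C * Real.exp (ε * y) := by
  induction p using Polynomial.induction_on' with
  | add p q hp hq =>
    obtain ⟨C1, h1, H1⟩ := hp
    obtain ⟨C2, h2, H2⟩ := hq
    refine ⟨C1 + C2, by positivity, fun y hy => ?_⟩
    rw [Polynomial.eval_add]
    refine (abs_add_le _ _).trans ?_
    have := H1 y hy
    have := H2 y hy
    linarith
  | monomial k a =>
    refine ⟨|a| * (k.factorial / ε ^ k) + 1, by positivity, fun y hy => ?_⟩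
    rw [Polynomial.eval_monomial, abs_mul, abs_of_nonneg (a := y ^ k) (by positivity)]
    have h := Real.pow_div_factorial_le_exp (x := ε * y) (by positivity) k
    have h2 : y ^ k ≤ (k.factorial / ε ^ k) * Real.exp (ε * y) := by
      rw [mul_pow, div_le_iff₀ (by positivity)] at h
      rw [div_mul_eq_mul_div, le_div_iff₀ (by positivity)]
      linarith
    have := Real.exp_pos (ε * y)
    calc |a| * y ^ k ≤ |a| * ((k.factorial / ε ^ k) * Real.exp (ε * y)) := by gcongr
      _ ≤ _ := by nlinarith

lemma poly_exp_tendsto (p : Polynomial ℝ) : Filter.Tendsto (fun y => Real.exp (-y) * p.eval y) Filter.atTop (nhds 0) := by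
  have := p.tendsto_div_exp_atTop
  refine this.congr (fun y => ?_)
  rw [Real.exp_neg]; field_simp

/-- exactly n positive roots for p_{n+1} -/
lemma pp_roots (n : ℕ) : ∃ t : Finset ℝ, t.card = n ∧ ∀ x, x ∈ t ↔ (0 < x ∧ PP (n+1) x = 0) := by
  have upper : ∀ n : ℕ, ∀ t : Finset ℝ, (∀ x, x ∈ t ↔ (0 < x ∧ PP (n+1) x = 0)) → t.card ≤ n := by
    intro n t ht
    have h0 : (0:ℝ) ∉ t := by rw [ht]; simp
    have h1 : insert 0 t ⊆ (pp (n+1)).roots.toFinset := by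
      intro x hx
      rw [Multiset.mem_toFinset, Polynomial.mem_roots (pp_ne _)]
      rcases Finset.mem_insert.1 hx with h | h
      · rw [h]; exact (PP_at_zero n).1
      · exact ((ht x).1 h).2
    have h2 := (Finset.card_le_card h1).trans (Multiset.toFinset_card_le _)
    have h3 := (Polynomial.card_roots' (pp (n+1))).trans (pp_natDegree (n+1))
    rw [Finset.card_insert_of_notMem h0] at h2
    omega
  have ex : ∀ n : ℕ, ∃ t : Finset ℝ, ∀ x, x ∈ t ↔ (0 < x ∧ PP (n+1) x = 0) := by
    intro n
    refine ⟨(pp (n+1)).roots.toFinset.filter (fun x => 0 < x), fun x => ?_⟩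
    rw [Finset.mem_filter, Multiset.mem_toFinset, Polynomial.mem_roots (pp_ne _)]
    exact and_comm
  have lower : ∀ n : ℕ, ∀ t : Finset ℝ, (∀ x, x ∈ t ↔ (0 < x ∧ PP (n+1) x = 0)) → n ≤ t.card := by
    intro n
    induction n with
    | zero => intro t _; omega
    | succ n ih =>
      intro t ht
      obtain ⟨s, hs⟩ := ex n
      have hsc := ih s hs
      -- F
      set F : ℝ → ℝ := fun y => y ^ (n+1) * (Real.exp (-y) * PP (n+1) y) with hF
      set F' : ℝ → ℝ := fun y => y ^ n * (Real.exp (-y) * (((n+2:ℕ):ℝ) * PP (n+2) y)) with hF'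
      have hd : ∀ y, HasDerivAt F (F' y) y := by
        intro y
        have h1 : HasDerivAt (fun t : ℝ => Real.exp (-t)) (Real.exp (-y) * -1) y := (hasDerivAt_neg y).exp
        refine ((hasDerivAt_pow (n+1) y).mul (h1.mul (PP_hasDeriv (n+1) y))).congr_deriv ?_
        have h2 := PP_rec (n+1) y
        simp only [hF']
        push_cast at h2 ⊢
        have h3 : ((n:ℝ) + 2) * PP (n+2) y = (n + 1 - y) * PP (n+1) y + y * PD (n+1) y := by
          rw [← h2]; ring
        rw [h3]; simp; ring
      have hFc : Continuous F := continuous_iff_continuousAt.2 (fun y => (hd y).continuousAt)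
      have hlim : Filter.Tendsto F Filter.atTop (nhds 0) := by
        have := poly_exp_tendsto (Polynomial.X ^ (n+1) * pp (n+1))
        refine this.congr (fun y => ?_)
        simp [hF, PP]; ring
      have hroot : ∀ z, 0 < z → F' z = 0 → z ∈ t := by
        intro z hz h
        rw [ht]
        refine ⟨hz, ?_⟩
        simp only [hF'] at h
        have h1 := (mul_eq_zero.1 h).resolve_left (by positivity)
        have h2 := (mul_eq_zero.1 h1).resolve_left (Real.exp_pos _).ne'
        exact (mul_eq_zero.1 h2).resolve_left (by positivity)
      have hF0 : ∀ x ∈ insert 0 s, 0 ≤ x ∧ F x = 0 := by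
        intro x hx
        rcases Finset.mem_insert.1 hx with h | h
        · rw [h]; simp [hF]
        · have := (hs x).1 h
          exact ⟨this.1.le, by simp [hF, this.2]⟩
      -- beyond
      have beyond : ∀ x, 0 ≤ x → F x = 0 → ∃ z, x < z ∧ z ∈ t := by
        intro x hx0 hx
        by_contra hcon
        push Not at hcon
        have hne : ∀ z ∈ Ioi x, F' z ≠ 0 := fun z hz h => hcon z hz (hroot z (hx0.trans_lt hz) h)
        have hge : ∀ᶠ y in Filter.atTop, x + 1 ≤ y := Filter.eventually_ge_atTop _
        rcases hasDerivWithinAt_forall_lt_or_forall_gt_of_forall_ne (convex_Ioi x)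
          (fun z _ => (hd z).hasDerivWithinAt) hne with h | h
        · have hanti : StrictAntiOn F (Ici x) := by
            apply strictAntiOn_of_deriv_neg (convex_Ici x) hFc.continuousOn
            intro z hz
            rw [interior_Ici] at hz
            rw [(hd z).deriv]; exact h z hz
          have h1 := hanti (by simp : x ∈ Ici x) (by simp : x + 1 ∈ Ici x) (by linarith)
          have : 0 ≤ F (x+1) := by
            apply le_of_tendsto hlim
            filter_upwards [hge] with y hy
            exact hanti.antitoneOn (by simp : x + 1 ∈ Ici x) (by simp; linarith) hy
          rw [hx] at h1; linarith
        · have hmono : StrictMonoOn F (Ici x) := by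
            apply strictMonoOn_of_deriv_pos (convex_Ici x) hFc.continuousOn
            intro z hz
            rw [interior_Ici] at hz
            rw [(hd z).deriv]; exact h z hz
          have h1 := hmono (by simp : x ∈ Ici x) (by simp : x + 1 ∈ Ici x) (by linarith)
          have : F (x+1) ≤ 0 := by
            apply ge_of_tendsto hlim
            filter_upwards [hge] with y hy
            exact hmono.monotoneOn (by simp : x + 1 ∈ Ici x) (by simp; linarith) hy
          rw [hx] at h1; linarith
      -- upper end
      obtain ⟨T, hT⟩ : ∃ T : ℝ, (∀ x ∈ insert 0 s, x < T) ∧ ∀ x ∈ t, x < T := by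
        obtain ⟨T, hT⟩ := (insert 0 s ∪ t).bddAbove
        refine ⟨T + 1, fun x hx => ?_, fun x hx => ?_⟩
        · have : x ≤ T := hT (by simp only [Finset.coe_union]; left; exact hx)
          linarith
        · have : x ≤ T := hT (by simp only [Finset.coe_union]; right; exact hx)
          linarith
      have hTn : T ∉ insert 0 s := fun h => lt_irrefl _ (hT.1 T h)
      have h0s : (0:ℝ) ∉ s := by rw [hs]; simp
      have hcard := Finset.card_le_of_interleaved (s := insert T (insert 0 s)) (t := t) (by
        intro x hx y hy hxy _
        rcases Finset.mem_insert.1 hx with hxT | hx'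
        · exfalso
          rcases Finset.mem_insert.1 hy with h | h
          · rw [hxT, h] at hxy; exact lt_irrefl _ hxy
          · have := hT.1 y h; linarith
        · obtain ⟨hx0, hFx⟩ := hF0 x hx'
          rcases Finset.mem_insert.1 hy with h | h
          · obtain ⟨z, hz, hzt⟩ := beyond x hx0 hFx
            exact ⟨z, hzt, hz, by rw [h]; exact hT.2 z hzt⟩
          · obtain ⟨_, hFy⟩ := hF0 y h
            obtain ⟨z, hz, hz2⟩ := exists_hasDerivAt_eq_zero hxy hFc.continuousOn (hFx.trans hFy.symm) (fun z _ => hd z)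
            exact ⟨z, hroot z (hx0.trans_lt hz.1) hz2, hz.1, hz.2⟩)
      rw [Finset.card_insert_of_notMem hTn, Finset.card_insert_of_notMem h0s] at hcard
      omega
  obtain ⟨t, ht⟩ := ex n
  exact ⟨t, le_antisymm (upper n t ht) (lower n t ht), ht⟩

open Polynomial in
lemma exists_A (n : ℕ) : ∃ A : Polynomial ℝ, X * (derivative A - A) = C ((n:ℝ) + 1) * (pp (n+1)) ^ 2 ∧ A.eval 0 = -1 := by
  induction n with
  | zero =>
    refine ⟨-(1 + X), ?_, by simp⟩
    have h : pp 1 = -X := by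
      have := pp_rec 0
      simpa [pp] using this
    simp [h]; ring
  | succ n ih =>
    obtain ⟨A, h1, h2⟩ := ih
    refine ⟨A + derivative (pp (n+2)) * (pp (n+1) - pp (n+2)), ?_, ?_⟩
    · have ha := (pp_core (n+1)).1
      have hb := (pp_core (n+1)).2.1
      have hc := (pp_core (n+2)).2.2
      simp only [derivative_add, derivative_mul, derivative_sub]
      push_cast at *
      simp only [C_add, C_1, C_ofNat] at *
      have ha' : derivative (pp (n+1)) = derivative (pp (n+2)) + pp (n+1) := by
        rw [ha]; ring
      rw [ha']
      linear_combination h1 + (pp (n+1) - pp (n+2)) * hc + pp (n+1) * hb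
    · simp only [eval_add, eval_mul, eval_sub]
      have := (PP_at_zero n).1
      have h3 := (PP_at_zero (n+1)).1
      simp only [PP] at this h3
      rw [this, h3, h2]; simp

/-- c(T) -/
lemma c_tendsto (n : ℕ) : Filter.Tendsto (fun T => ((n:ℝ) + 1) * ∫ y in (0:ℝ)..T, Real.exp (-y) * (QQ (n+1) y * PP (n+1) y)) Filter.atTop (nhds 1) := by
  obtain ⟨A, h1, h2⟩ := exists_A n
  have h3 : Polynomial.derivative A - A = Polynomial.C ((n:ℝ) + 1) * (Polynomial.divX (pp (n+1)) * pp (n+1)) := by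
    apply mul_left_cancel₀ (Polynomial.X_ne_zero (R := ℝ))
    rw [h1, pow_two]
    nth_rewrite 1 [pp_eq_X_mul n]
    ring
  have hd : ∀ y, HasDerivAt (fun y => Real.exp (-y) * A.eval y) (((n:ℝ) + 1) * (Real.exp (-y) * (QQ (n+1) y * PP (n+1) y))) y := by
    intro y
    have hh : HasDerivAt (fun t : ℝ => Real.exp (-t)) (Real.exp (-y) * -1) y := (hasDerivAt_neg y).exp
    refine (hh.mul (A.hasDerivAt y)).congr_deriv ?_
    have h4 := congrArg (Polynomial.eval y) h3
    simp at h4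
    simp only [QQ, PP]
    linear_combination Real.exp (-y) * h4
  have hq := QQ_cont (n+1)
  have hp := PP_cont (n+1)
  have e : ∀ T, ((n:ℝ) + 1) * ∫ y in (0:ℝ)..T, Real.exp (-y) * (QQ (n+1) y * PP (n+1) y) = Real.exp (-T) * A.eval T + 1 := by
    intro T
    rw [← intervalIntegral.integral_const_mul, intervalIntegral.integral_eq_sub_of_hasDerivAt (fun t _ => hd t)
      (by apply Continuous.intervalIntegrable; fun_prop), h2]
    simp
  simp_rw [e]
  simpa using (poly_exp_tendsto A).add_const 1

lemma PP_large (n : ℕ) : ∃ Y0, 0 < Y0 ∧ ∀ y, Y0 ≤ y → 1 ≤ |PP (n+1) y| ∧ |PD (n+1) y| ≤ |PP (n+1) y| := by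
  have hdeg : 0 < (pp (n+1)).degree := by
    by_contra h
    push Not at h
    have h2 := Polynomial.eq_C_of_degree_le_zero h
    have h3 := (PP_at_zero n).2
    rw [PD, h2] at h3
    simp at h3
  have t1 := Polynomial.abs_tendsto_atTop (pp (n+1)) hdeg
  have t2 := Polynomial.div_tendsto_zero_of_degree_lt _ _ (Polynomial.degree_derivative_lt (pp_ne (n+1)))
  have e1 := t1.eventually_ge_atTop 1
  have e2 := t2.eventually (Metric.ball_mem_nhds (0:ℝ) one_pos)
  obtain ⟨Y0, hY⟩ := (e1.and e2).exists_forall_of_atTop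
  refine ⟨max Y0 1, by positivity, fun y hy => ?_⟩
  obtain ⟨h1, h2⟩ := hY y ((le_max_left _ _).trans hy)
  refine ⟨h1, ?_⟩
  rw [dist_zero_right, Real.norm_eq_abs, abs_div, div_lt_one (by linarith)] at h2
  exact h2.le

lemma arc_bound {X X' : ℝ → ℝ} {a b C γ : ℝ} (hγ : 0 < γ) (hC : 0 ≤ C) (ha : 0 ≤ a) (hab : a ≤ b)
    (hX : ContinuousOn X (Icc a b)) (hd : ∀ y, a < y → y < b → HasDerivAt X (X' y) y)
    (hb : ∀ y, a < y → y < b → |X' y| ≤ C * (√γ / (√y * (γ + y)))) : |X b - X a| ≤ 4 * C := by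
  have hg : 0 < √γ := Real.sqrt_pos.2 hγ
  have h := cmp_deriv (R := X) (H := fun y => 2 * C * Real.arctan (√y / √γ))
    (H' := fun y => C * (√γ / (√y * (γ + y)))) hab hX (by fun_prop) hd
    (by
      intro y hy _
      have hy0 : 0 < y := ha.trans_lt hy
      have hs : 0 < √y := Real.sqrt_pos.2 hy0
      refine ((((Real.hasDerivAt_sqrt hy0.ne').div_const √γ).arctan).const_mul (2 * C)).congr_deriv ?_
      rw [div_pow, Real.sq_sqrt hy0.le, Real.sq_sqrt hγ.le]
      have e : √γ ^ 2 = γ := Real.sq_sqrt hγ.le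
      have : γ + y ≠ 0 := by positivity
      field_simp
      rw [e]) hb
  have h1 := Real.arctan_lt_pi_div_two (√b / √γ)
  have h2 : 0 ≤ Real.arctan (√a / √γ) := Real.arctan_nonneg.2 (by positivity)
  have h3 := Real.pi_le_four
  nlinarith

lemma PD_hasDeriv' (n : ℕ) (y : ℝ) : HasDerivAt (PD n) (PD n y - n * QQ n y) y := by
  cases n with
  | zero =>
    have : PD 0 = fun _ => 0 := funext PD_zero_fun
    rw [this]; simpa using hasDerivAt_const y (0:ℝ)
  | succ n => have := PD_hasDeriv n y; push_cast; exact this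

lemma wt_hasDeriv {β y : ℝ} (hβ : 0 < β) (hy : 0 < y) :
    HasDerivAt (wt β) (m0 β y * (-y + 2 * β / (β + y))) y := by
  have h1 : HasDerivAt (fun y => Real.exp (-y) * y ^ 2 / (β + y) ^ 2) (m0 β y * (-y + 2 * β / (β + y))) y := by
    have hh : HasDerivAt (fun t : ℝ => Real.exp (-t)) (Real.exp (-y) * -1) y := (hasDerivAt_neg y).exp
    have h2 : HasDerivAt (fun t => (β + t) ^ 2) (2 * (β + y)) y := by
      simpa using ((hasDerivAt_id' y).const_add β).fun_pow 2
    have h3 : HasDerivAt (fun t => t ^ 2) (2 * y) y := by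
      simpa using (hasDerivAt_id' y).fun_pow 2
    refine ((hh.mul h3).div h2 (by positivity)).congr_deriv ?_
    unfold m0; rw [abs_of_pos hy]; simp only [Pi.mul_apply]
    field_simp; ring
  apply h1.congr_of_eventuallyEq
  filter_upwards [Ioi_mem_nhds hy] with z hz
  have hz : 0 < z := hz
  rw [wt, abs_of_pos hz]

noncomputable def J1 (n : ℕ) (β : ℝ) (f : ℝ → ℝ) (T : ℝ) : ℝ := ∫ y in (0:ℝ)..T, m0 β y * f y * PP n y
noncomputable def J2 (n : ℕ) (β : ℝ) (f : ℝ → ℝ) (T : ℝ) : ℝ :=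
  ∫ y in (0:ℝ)..T, m0 β y * (2 * β / (β + |y|)) * f y * (PP n y - PD n y)

noncomputable def WW (n : ℕ) (β μ : ℝ) (f : ℝ → ℝ) (y : ℝ) : ℝ :=
  wt β y * (GG β μ f y * PP n y - f y * PD n y)

lemma WW_hasDeriv (n : ℕ) {β μ : ℝ} (hβ : 0 < β) {f : ℝ → ℝ} (hf : IsSol β μ f) {y : ℝ} (hy : 0 < y) :
    HasDerivAt (WW n β μ f) (m0 β y * f y * ((n - μ) * PP n y + 2 * β / (β + y) * (PP n y - PD n y))) y := by
  obtain ⟨hfc, hf0, hfd⟩ := hf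
  have hw := wt_pos hβ hy
  have hΦ : HasDerivAt (fun y => ∫ t in (0:ℝ)..y, mm β μ t * f t) (mm β μ y * f y) y :=
    (((mm_cont hβ μ).mul hfc).integral_hasStrictDerivAt 0 y).hasDerivAt
  have h1 := (hΦ.mul (PP_hasDeriv n y)).sub ((wt_hasDeriv hβ hy).mul ((hfd y hy).mul (PD_hasDeriv' n y)))
  have h2 : HasDerivAt (WW n β μ f) _ y := h1.congr_of_eventuallyEq (by
    filter_upwards [Ioi_mem_nhds hy] with z hz
    have hz : 0 < z := hz
    have hwz := wt_pos hβ hz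
    simp only [WW, Pi.mul_apply, Pi.sub_apply]
    rw [GG_eq hβ μ f hz]
    field_simp)
  refine h2.congr_deriv ?_
  have e1 : (∫ t in (0:ℝ)..y, mm β μ t * f t) = wt β y * GG β μ f y := by
    rw [GG_eq hβ μ f hy]; field_simp
  have e2 := nPP_eq n y
  have e3 : wt β y = y * m0 β y := by unfold wt m0; ring
  simp only [Pi.mul_apply]
  rw [e1, e3, mm, abs_of_pos hy]
  linear_combination (-m0 β y * f y) * e2

lemma WW_eq (n : ℕ) {β μ : ℝ} (hβ : 0 < β) {f : ℝ → ℝ} (hf : IsSol β μ f) {T : ℝ} (hT : 0 ≤ T) :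
    WW n β μ f T = (n - μ) * J1 n β f T + J2 n β f T := by
  have hfc := hf.1
  have hm := m0_cont hβ
  have hP := PP_cont n
  have hP' := PD_cont n
  have hG := GG_cont hβ μ hfc
  have hw := wt_cont hβ
  have hB := cont_B2 hβ
  have hWc : Continuous (WW n β μ f) := by unfold WW; fun_prop
  have h := intervalIntegral.integral_eq_sub_of_hasDerivAt_of_le hT hWc.continuousOn
    (f' := fun y => m0 β y * f y * ((n - μ) * PP n y + 2 * β / (β + |y|) * (PP n y - PD n y)))
    (fun y hy => by
      have := WW_hasDeriv n hβ hf hy.1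
      rw [abs_of_pos hy.1]; exact this) (by apply Continuous.intervalIntegrable; fun_prop)
  have h0 : WW n β μ f 0 = 0 := by simp [WW, wt]
  rw [h0, sub_zero] at h
  rw [← h, J1, J2, ← intervalIntegral.integral_const_mul, ← intervalIntegral.integral_add
    (by apply Continuous.intervalIntegrable; fun_prop) (by apply Continuous.intervalIntegrable; fun_prop)]
  apply intervalIntegral.integral_congr
  intro y _
  simp only; ring

lemma m0_nonneg {β y : ℝ} (hβ : 0 < β) (hy : 0 ≤ y) : 0 ≤ m0 β y := by unfold m0; positivity

lemma m0_le {β y : ℝ} (hβ : 0 < β) (hy : 0 < y) : m0 β y * y ≤ Real.exp (-y) := by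
  unfold m0
  rw [abs_of_pos hy]
  have : y / (β + y) ^ 2 * y ≤ 1 := by
    rw [div_mul_eq_mul_div, div_le_one (by positivity)]; nlinarith
  have := Real.exp_pos (-y)
  nlinarith

lemma poly_dom (p : Polynomial ℝ) : ∃ C, 0 < C ∧ ∀ y, 0 ≤ y → (1 + y) * |p.eval y| * Real.exp (-(y/4)) ≤ C := by
  obtain ⟨C, hC, h⟩ := poly_exp_bd ((1 + Polynomial.X) * p) (ε := 1/4) (by norm_num)
  refine ⟨C, hC, fun y hy => ?_⟩
  have h1 := h y hy
  simp only [Polynomial.eval_mul, Polynomial.eval_add, Polynomial.eval_one, Polynomial.eval_X, abs_mul] at h1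
  rw [abs_of_nonneg (by linarith : 0 ≤ 1 + y)] at h1
  calc _ ≤ C * Real.exp (1/4 * y) * Real.exp (-(y/4)) := by gcongr
    _ = C := by rw [mul_assoc, ← Real.exp_add]; ring_nf; simp

lemma exp_le_q {y : ℝ} (hy : 0 ≤ y) : Real.exp (-y) ≤ Real.exp (-(y/4)) ∧
    Real.exp (-y) * Real.exp (y/2) ≤ Real.exp (-(y/4)) := by
  rw [← Real.exp_add]
  constructor <;> apply Real.exp_le_exp.2 <;> linarith

lemma J1_deriv (n : ℕ) {β : ℝ} (hβ : 0 < β) {f : ℝ → ℝ} (hf : Continuous f) (y : ℝ) :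
    HasDerivAt (J1 n β f) (m0 β y * f y * PP n y) y := by
  have hm := m0_cont hβ
  have hP := PP_cont n
  have hc : Continuous (fun y => m0 β y * f y * PP n y) := by fun_prop
  exact (hc.integral_hasStrictDerivAt 0 y).hasDerivAt

lemma J2_deriv (n : ℕ) {β : ℝ} (hβ : 0 < β) {f : ℝ → ℝ} (hf : Continuous f) (y : ℝ) :
    HasDerivAt (J2 n β f) (m0 β y * (2 * β / (β + |y|)) * f y * (PP n y - PD n y)) y := by
  have hm := m0_cont hβ
  have hP := PP_cont n
  have hP' := PD_cont n
  have hB := cont_B2 hβ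
  have hc : Continuous (fun y => m0 β y * (2 * β / (β + |y|)) * f y * (PP n y - PD n y)) := by fun_prop
  exact (hc.integral_hasStrictDerivAt 0 y).hasDerivAt

lemma m0y_eq {β y : ℝ} (hy : 0 < y) : m0 β y * y = Real.exp (-y) * (y ^ 2 / (β + y) ^ 2) := by
  unfold m0; rw [abs_of_pos hy]; ring

lemma sqfrac {β y : ℝ} (hβ : 0 < β) (hy : 0 < y) : 0 ≤ y ^ 2 / (β + y) ^ 2 ∧ y ^ 2 / (β + y) ^ 2 ≤ 1 ∧
    |y ^ 2 / (β + y) ^ 2 - 1| ≤ 2 * β / (β + y) := by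
  have h1 : y ^ 2 / (β + y) ^ 2 ≤ 1 := by
    rw [div_le_one (by positivity)]; nlinarith
  refine ⟨by positivity, h1, ?_⟩
  rw [abs_of_nonpos (by linarith)]
  have e : y ^ 2 / (β + y) ^ 2 = (1 - β / (β + y)) ^ 2 := by field_simp; ring
  have e2 : 2 * β / (β + y) = 2 * (β / (β + y)) := by ring
  rw [e, e2]; nlinarith [sq_nonneg (β / (β + y))]

noncomputable def cT (n : ℕ) (T : ℝ) : ℝ := ((n:ℝ) + 1) * ∫ y in (0:ℝ)..T, Real.exp (-y) * (QQ (n+1) y * PP (n+1) y)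

set_option maxHeartbeats 1000000 in
lemma J1_est_succ (n : ℕ) (C0 : ℝ) (hC0 : 0 < C0) : ∃ C, 0 < C ∧ ∀ β, 0 < β → β ≤ Real.exp (-1) → ∀ f : ℝ → ℝ, Continuous f →
    ∀ T, 0 < T → (∀ y, 0 < y → y ≤ T → |f y - (1 + (-Real.log β) * (((n+1:ℕ):ℝ) * PP (n+1) y))| ≤ C0 * √y * Real.exp (y/2)) →
    |J1 (n+1) β f T - cT n T * (-Real.log β)| ≤ C := by
  obtain ⟨k1, hk1, K1⟩ := poly_dom (Polynomial.X * Polynomial.divX (pp (n+1)))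
  obtain ⟨k2, hk2, K2⟩ := poly_dom ((1 + Polynomial.X) * Polynomial.divX (pp (n+1)))
  obtain ⟨k3, hk3, K3⟩ := poly_dom (Polynomial.divX (pp (n+1)) * pp (n+1))
  refine ⟨4 * (C0 * k1 + k2 + (n+1) * 2 * k3), by positivity, ?_⟩
  intro β hβ hβ1 f hf T hT hR
  obtain ⟨L, hL⟩ : ∃ L, L = -Real.log β := ⟨_, rfl⟩
  rw [← hL] at hR ⊢
  have hL0 : 0 ≤ L := by
    have := Real.log_le_log hβ hβ1
    rw [Real.log_exp] at this; linarith
  have hq := QQ_cont (n+1)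
  have hp := PP_cont (n+1)
  have hcd : ∀ y, HasDerivAt (cT n) (((n:ℝ) + 1) * (Real.exp (-y) * (QQ (n+1) y * PP (n+1) y))) y := by
    intro y
    have hc : Continuous (fun y => Real.exp (-y) * (QQ (n+1) y * PP (n+1) y)) := by fun_prop
    exact ((hc.integral_hasStrictDerivAt 0 y).hasDerivAt).const_mul _
  have hd : ∀ y, HasDerivAt (fun T => J1 (n+1) β f T - cT n T * L)
      (m0 β y * f y * PP (n+1) y - ((n:ℝ) + 1) * (Real.exp (-y) * (QQ (n+1) y * PP (n+1) y)) * L) y :=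
    fun y => (J1_deriv (n+1) hβ hf y).sub ((hcd y).mul_const L)
  have h := arc_bound (X := fun T => J1 (n+1) β f T - cT n T * L) (a := 0) (b := T) (γ := 1)
    (C := C0 * k1 + k2 + (n+1) * 2 * k3) one_pos (by positivity) le_rfl hT.le
    (fun y _ => (hd y).continuousAt.continuousWithinAt) (fun y _ _ => hd y) (by
      intro y hy hyT
      have hRy := hR y hy hyT.le
      have hs : 0 < √y := Real.sqrt_pos.2 hy
      have hss : √y * √y = y := Real.mul_self_sqrt hy.le
      obtain ⟨x1, x2⟩ := exp_le_q hy.le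
      obtain ⟨s1, s2, s3⟩ := sqfrac hβ hy
      have g1 := K1 y hy.le
      have g2 := K2 y hy.le
      have g3 := K3 y hy.le
      simp only [Polynomial.eval_mul, Polynomial.eval_add, Polynomial.eval_one, Polynomial.eval_X, abs_mul] at g1 g2 g3
      rw [abs_of_pos hy] at g1
      rw [abs_of_pos (by linarith : 0 < 1 + y)] at g2
      change (1 + y) * (y * |QQ (n+1) y|) * _ ≤ _ at g1
      change (1 + y) * ((1 + y) * |QQ (n+1) y|) * _ ≤ _ at g2
      change (1 + y) * (|QQ (n+1) y| * |PP (n+1) y|) * _ ≤ _ at g3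
      have hmP : m0 β y * PP (n+1) y = Real.exp (-y) * (y ^ 2 / (β + y) ^ 2) * QQ (n+1) y := by
        rw [PP_eq, ← mul_assoc, m0y_eq hy]
      set q := QQ (n+1) y
      set p := PP (n+1) y
      set E := Real.exp (-(y/4))
      set ρ := y ^ 2 / (β + y) ^ 2
      have hE : 0 < E := Real.exp_pos _
      have hf2 := frac_sqrt hβ hy
      have hLs := L_sqrt hβ
      rw [← hL] at hLs
      have e : m0 β y * f y * p - ((n:ℝ) + 1) * (Real.exp (-y) * (q * p)) * L =
        Real.exp (-y) * ρ * q * (f y - (1 + L * (((n+1:ℕ):ℝ) * p))) + Real.exp (-y) * ρ * q + L * (n+1) * (Real.exp (-y) * (q * p)) * (ρ - 1) := by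
        rw [← hmP]; push_cast; 
        have : L * (n+1) * (Real.exp (-y) * (q * p)) * (ρ - 1) = L * (n+1) * p * (Real.exp (-y) * ρ * q) - L * (n+1) * (Real.exp (-y) * (q * p)) := by ring
        rw [this, ← hmP]; ring
      have t1 : |Real.exp (-y) * ρ * q * (f y - (1 + L * (((n+1:ℕ):ℝ) * p)))| ≤ C0 * k1 * (1 / (√y * (1 + y))) := by
        rw [abs_mul, abs_mul, abs_mul, abs_of_pos (Real.exp_pos _), abs_of_nonneg s1]
        calc _ ≤ Real.exp (-y) * 1 * |q| * (C0 * √y * Real.exp (y/2)) := by gcongr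
          _ = C0 * (√y * |q|) * (Real.exp (-y) * Real.exp (y/2)) := by ring
          _ ≤ C0 * (√y * |q|) * E := by gcongr
          _ = C0 * ((1 + y) * ((√y * √y) * |q|) * E) * (1 / (√y * (1 + y))) := by field_simp
          _ ≤ C0 * k1 * (1 / (√y * (1 + y))) := by rw [hss]; gcongr
      have t2 : |Real.exp (-y) * ρ * q| ≤ k2 * (1 / (√y * (1 + y))) := by
        rw [abs_mul, abs_mul, abs_of_pos (Real.exp_pos _), abs_of_nonneg s1]
        have : √y ≤ 1 + y := by nlinarith [sq_nonneg (√y - 1)]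
        calc _ ≤ E * 1 * |q| := by gcongr
          _ = ((1 + y) * (√y * |q|) * E) * (1 / (√y * (1 + y))) := by field_simp
          _ ≤ ((1 + y) * ((1 + y) * |q|) * E) * (1 / (√y * (1 + y))) := by gcongr
          _ ≤ _ := by gcongr
      have t3 : |L * (n+1) * (Real.exp (-y) * (q * p)) * (ρ - 1)| ≤ (n+1) * 2 * k3 * (1 / (√y * (1 + y))) := by
        rw [abs_mul, abs_mul, abs_mul, abs_mul, abs_mul, abs_of_pos (Real.exp_pos _), abs_of_nonneg hL0, abs_of_nonneg (by positivity : (0:ℝ) ≤ n + 1)]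
        calc _ ≤ L * (n+1) * (E * (|q| * |p|)) * (√β * (√y)⁻¹) := by gcongr; exact s3.trans hf2
          _ = (n+1) * (L * √β) * ((1 + y) * (|q| * |p|) * E) * (1 / (√y * (1 + y))) := by field_simp
          _ ≤ (n+1) * 2 * k3 * (1 / (√y * (1 + y))) := by gcongr
      rw [e, Real.sqrt_one]
      refine (abs_add_le _ _).trans ((add_le_add (abs_add_le _ _) le_rfl).trans ?_)
      linarith)
  have h0 : J1 (n+1) β f 0 - cT n 0 * L = 0 := by simp [J1, cT]
  simp only [h0, sub_zero] at h
  exact h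

lemma J1_est_zero (C0 T0 : ℝ) (hC0 : 0 < C0) (hT0 : 0 < T0) : ∃ C, 0 < C ∧ ∀ β, 0 < β → β ≤ Real.exp (-1) → ∀ f : ℝ → ℝ, Continuous f →
    ∀ T, T0 ≤ T → (∀ y, 0 < y → y ≤ T → |f y - (1 + (-Real.log β) * (((0:ℕ):ℝ) * PP 0 y))| ≤ C0 * √y * Real.exp (y/2)) →
    |J1 0 β f T - (-Real.log β)| ≤ C := by
  refine ⟨4 * (4 * C0) + 4 * (1 / √T0) + (|Real.log T0| + 4 + T0) + (2 + 1 / T0), by positivity, ?_⟩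
  intro β hβ hβ1 f hf T hT hR
  have hβlt : β < 1 := hβ1.trans_lt (by rw [Real.exp_lt_one_iff]; norm_num)
  have hmc := m0_cont hβ
  have hMd : ∀ y, HasDerivAt (fun T => ∫ y in (0:ℝ)..T, m0 β y) (m0 β y) y :=
    fun y => (hmc.integral_hasStrictDerivAt 0 y).hasDerivAt
  have hexp1 : ∀ y : ℝ, 0 < y → (1 + y) * Real.exp (-y) ≤ 1 := by
    intro y hy
    have := Real.add_one_le_exp y
    rw [Real.exp_neg, ← div_eq_mul_inv, div_le_one (Real.exp_pos _)]; linarith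
  -- part 1
  have hd : ∀ y, HasDerivAt (fun T => J1 0 β f T - ∫ y in (0:ℝ)..T, m0 β y) (m0 β y * f y * PP 0 y - m0 β y) y :=
    fun y => (J1_deriv 0 hβ hf y).sub (hMd y)
  have hTpos : 0 < T := hT0.trans_le hT
  have p1 := arc_bound (X := fun T => J1 0 β f T - ∫ y in (0:ℝ)..T, m0 β y) (a := 0) (b := T) (γ := 1)
    (C := 4 * C0) one_pos (by positivity) le_rfl hTpos.le
    (fun y _ => (hd y).continuousAt.continuousWithinAt) (fun y _ _ => hd y) (by
      intro y hy hyT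
      have hRy := hR y hy hyT.le
      simp only [Nat.cast_zero, zero_mul, mul_zero, add_zero] at hRy
      have hs : 0 < √y := Real.sqrt_pos.2 hy
      have hss : √y * √y = y := Real.mul_self_sqrt hy.le
      have e : m0 β y * f y * PP 0 y - m0 β y = m0 β y * (f y - 1) := by rw [PP_zero_fun]; ring
      rw [e, abs_mul, abs_of_nonneg (m0_nonneg hβ hy.le), Real.sqrt_one]
      have h1 := m0_le hβ hy
      have h2 : (1 + y) * Real.exp (-(y/2)) ≤ 4 := by
        have := Real.add_one_le_exp (y/2)
        rw [Real.exp_neg, ← div_eq_mul_inv, div_le_iff₀ (Real.exp_pos _)]; linarith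
      calc m0 β y * |f y - 1| ≤ m0 β y * (C0 * √y * Real.exp (y/2)) := by
            have := m0_nonneg hβ hy.le
            gcongr
        _ = C0 * ((m0 β y * (√y * √y)) * Real.exp (y/2)) * (1 + y) * (1 / (√y * (1 + y))) := by field_simp
        _ ≤ C0 * (Real.exp (-y) * Real.exp (y/2)) * (1 + y) * (1 / (√y * (1 + y))) := by rw [hss]; gcongr
        _ = C0 * ((1 + y) * Real.exp (-(y/2))) * (1 / (√y * (1 + y))) := by
            rw [← Real.exp_add]; ring_nf
        _ ≤ C0 * 4 * (1 / (√y * (1 + y))) := by gcongr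
        _ = _ := by ring)
  have p2 := arc_bound (X := fun T => ∫ y in (0:ℝ)..T, m0 β y) (a := T0) (b := T) (γ := 1)
    (C := 1 / √T0) one_pos (by positivity) hT0.le hT
    (fun y _ => (hMd y).continuousAt.continuousWithinAt) (fun y _ _ => hMd y) (by
      intro y hy0 hyT
      have hy : 0 < y := hT0.trans hy0
      have hs : 0 < √y := Real.sqrt_pos.2 hy
      have hss : √y * √y = y := Real.mul_self_sqrt hy.le
      have h1 := m0_le hβ hy
      have h3 := hexp1 y hy
      have hs0 : 0 < √T0 := Real.sqrt_pos.2 hT0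
      have hs1 : √T0 ≤ √y := Real.sqrt_le_sqrt hy0.le
      rw [abs_of_nonneg (m0_nonneg hβ hy.le), Real.sqrt_one]
      calc m0 β y = (m0 β y * (√y * √y)) * (1 + y) * (1 / √y) * (1 / (√y * (1 + y))) := by field_simp
        _ ≤ Real.exp (-y) * (1 + y) * (1 / √y) * (1 / (√y * (1 + y))) := by rw [hss]; gcongr
        _ ≤ 1 * (1 / √T0) * (1 / (√y * (1 + y))) := by
            gcongr; linarith
        _ = _ := by ring)
  have p3 := Psi_bd hβ hβlt hT0
  have p4 : |∫ t in (0:ℝ)..T0, m0 β t| ≤ (1 / β) * |T0 - 0| := by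
    rw [← Real.norm_eq_abs]
    apply intervalIntegral.norm_integral_le_of_norm_le_const
    intro t ht
    rw [uIoc_of_le hT0.le] at ht
    have ht0 := ht.1
    rw [Real.norm_eq_abs, abs_of_nonneg (m0_nonneg hβ ht0.le), m0, abs_of_pos ht0]
    have h1 : Real.exp (-t) ≤ 1 := by simpa using ht0.le
    have h2 : t / (β + t) ^ 2 ≤ 1 / β := by
      rw [div_le_div_iff₀ (by positivity) hβ]; nlinarith
    calc _ ≤ 1 * (1 / β) := by gcongr
      _ = _ := by ring
  rw [sub_zero, abs_of_pos hT0] at p4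
  have h0 : J1 0 β f 0 - ∫ y in (0:ℝ)..0, m0 β y = 0 := by simp [J1]
  simp only [h0, sub_zero] at p1
  set X := ∫ t in (0:ℝ)..T0, m0 β t
  set X2 := ∫ t in (0:ℝ)..T, m0 β t
  have p5 : |((β + T0) ^ 2 / T0 ^ 2 - 1) * X| ≤ 2 + 1 / T0 := by
    have e : (β + T0) ^ 2 / T0 ^ 2 - 1 = β * (2 / T0 + β / T0 ^ 2) := by field_simp; ring
    rw [e, abs_mul, abs_of_nonneg (by positivity)]
    calc _ ≤ β * (2 / T0 + β / T0 ^ 2) * (1 / β * T0) := by gcongr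
      _ = 2 + β / T0 := by field_simp
      _ ≤ _ := by gcongr
  have e : J1 0 β f T - (-Real.log β) = (J1 0 β f T - X2) + (X2 - X) + ((β + T0) ^ 2 / T0 ^ 2 * X - (-Real.log β))
    - ((β + T0) ^ 2 / T0 ^ 2 - 1) * X := by ring
  rw [e]
  refine (abs_sub _ _).trans ?_
  have a1 := abs_add_le (J1 0 β f T - X2 + (X2 - X)) ((β + T0) ^ 2 / T0 ^ 2 * X - (-Real.log β))
  have a2 := abs_add_le (J1 0 β f T - X2) (X2 - X)
  linarith

lemma L_bds {β : ℝ} (hβ : 0 < β) (hβ1 : β ≤ Real.exp (-1)) : 1 ≤ -Real.log β ∧ √β * (1 + (-Real.log β)) ≤ 32 / (-Real.log β) ∧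
    β ≤ 2 / (-Real.log β) := by
  have h1 : 1 ≤ -Real.log β := by
    have := Real.log_le_log hβ hβ1
    rw [Real.log_exp] at this; linarith
  obtain ⟨L, hL⟩ : ∃ L, L = -Real.log β := ⟨_, rfl⟩
  have hs : 0 < √β := Real.sqrt_pos.2 hβ
  have hss : 0 < √(√β) := Real.sqrt_pos.2 hs
  have h2 := L_sqrt hs
  rw [Real.log_sqrt hβ.le] at h2
  have h2' : L * √(√β) ≤ 4 := by rw [hL]; linarith
  have h3 := L_sqrt hβ
  rw [← hL] at h1 h3 ⊢
  have h4 : √(√β) ^ 2 = √β := Real.sq_sqrt hs.le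
  have h6 : √β ^ 2 = β := Real.sq_sqrt hβ.le
  have h5 : L ^ 2 * √β ≤ 16 := by
    rw [← h4]
    have : 0 ≤ L * √(√β) := by positivity
    nlinarith
  have h7 : √β ≤ 1 := by
    apply Real.sqrt_le_one.2
    exact hβ1.trans (by rw [Real.exp_le_one_iff]; norm_num)
  refine ⟨h1, ?_, ?_⟩
  · rw [le_div_iff₀ (by linarith)]
    nlinarith [mul_nonneg hs.le (by linarith : 0 ≤ L), mul_nonneg (mul_nonneg hs.le (by linarith : 0 ≤ L)) (by linarith : 0 ≤ L - 1)]
  · rw [le_div_iff₀ (by linarith), ← h6]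
    nlinarith [mul_nonneg (mul_nonneg hs.le (by linarith : 0 ≤ L)) (by linarith : 0 ≤ 1 - √β)]

lemma pmd_eq (n : ℕ) (y : ℝ) : PP n y - PD n y = 1 + y * (Polynomial.divX (pp n - Polynomial.derivative (pp n))).eval y := by
  have h := congrArg (Polynomial.eval y) (Polynomial.divX_mul_X_add (pp n - Polynomial.derivative (pp n)))
  have h0 : (pp n - Polynomial.derivative (pp n)).coeff 0 = 1 := by
    rw [Polynomial.coeff_zero_eq_eval_zero, Polynomial.eval_sub]
    change PP n 0 - PD n 0 = 1
    cases n with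
    | zero => rw [PP_zero_fun, PD_zero_fun]; norm_num
    | succ n => obtain ⟨a, b⟩ := PP_at_zero n; rw [a, b]; norm_num
  rw [h0] at h
  simp only [Polynomial.eval_add, Polynomial.eval_mul, Polynomial.eval_X, Polynomial.eval_C, Polynomial.eval_sub] at h ⊢
  change _ = PP n y - PD n y at h
  linarith

set_option maxHeartbeats 1000000 in
lemma J2_est (n : ℕ) (C0 T0 : ℝ) (hC0 : 0 < C0) (hT0 : 0 < T0) : ∃ C, 0 < C ∧ ∀ β, 0 < β → β ≤ Real.exp (-1) → ∀ f : ℝ → ℝ, Continuous f →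
    ∀ T, T0 ≤ T → (∀ y, 0 < y → y ≤ T → |f y - (1 + (-Real.log β) * ((n:ℝ) * PP n y))| ≤ C0 * √y * Real.exp (y/2)) →
    |J2 n β f T - 1| ≤ C / (-Real.log β) := by
  obtain ⟨k1, hk1, K1⟩ := poly_dom (pp n - Polynomial.derivative (pp n))
  obtain ⟨k2, hk2, K2⟩ := poly_dom ((pp n - Polynomial.derivative (pp n)) * (Polynomial.C (n:ℝ) * Polynomial.divX (pp n)))
  obtain ⟨k3, hk3, K3⟩ := poly_dom (Polynomial.divX (pp n - Polynomial.derivative (pp n)))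
  obtain ⟨K, hKdef⟩ : ∃ K, K = C0 * k1 + k2 + 1 + k3 := ⟨_, rfl⟩
  have hK : 0 < K := by rw [hKdef]; positivity
  refine ⟨8 * K * 32 + 2 * 2 / T0, by positivity, ?_⟩
  intro β hβ hβ1 f hf T hT hR
  obtain ⟨b1, b2, b3⟩ := L_bds hβ hβ1
  obtain ⟨L, hL⟩ : ∃ L, L = -Real.log β := ⟨_, rfl⟩
  rw [← hL] at hR b1 b2 b3 ⊢
  have hT1 : 0 < T := hT0.trans_le hT
  have hsb : 0 < √β := Real.sqrt_pos.2 hβ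
  have hsbb : √β * √β = β := Real.mul_self_sqrt hβ.le
  have hd : ∀ y, HasDerivAt (fun T => J2 n β f T - ∫ t in (0:ℝ)..T, 2 * β * t / (β + |t|) ^ 3)
      (m0 β y * (2 * β / (β + |y|)) * f y * (PP n y - PD n y) - 2 * β * y / (β + |y|) ^ 3) y :=
    fun y => (J2_deriv n hβ hf y).sub ((cont_A hβ).integral_hasStrictDerivAt 0 y).hasDerivAt
  have h := arc_bound (X := fun T => J2 n β f T - ∫ t in (0:ℝ)..T, 2 * β * t / (β + |t|) ^ 3) (a := 0) (b := T) (γ := β)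
    (C := 2 * √β * (K * (1 + L))) hβ (by positivity) le_rfl hT1.le
    (fun y _ => (hd y).continuousAt.continuousWithinAt) (fun y _ _ => hd y) (by
      intro y hy hyT
      have hRy := hR y hy hyT.le
      have hs : 0 < √y := Real.sqrt_pos.2 hy
      have hss : √y * √y = y := Real.mul_self_sqrt hy.le
      have hs1 : √y ≤ 1 + y := by nlinarith [sq_nonneg (√y - 1)]
      obtain ⟨x1, x2⟩ := exp_le_q hy.le
      have g1 := K1 y hy.le
      have g2 := K2 y hy.le
      have g3 := K3 y hy.le
      have hpd := pmd_eq n y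
      simp only [Polynomial.eval_mul, Polynomial.eval_sub, Polynomial.eval_C, abs_mul] at g1 g2
      change (1 + y) * |PP n y - PD n y| * _ ≤ _ at g1
      change (1 + y) * (|PP n y - PD n y| * (|(n:ℝ)| * |QQ n y|)) * _ ≤ _ at g2
      rw [nPP_eq] at hRy
      set S := (Polynomial.divX (pp n - Polynomial.derivative (pp n))).eval y
      set D := PP n y - PD n y
      set q := QQ n y
      set E := Real.exp (-(y/4))
      have hE : 0 < E := Real.exp_pos _
      have e1 : m0 β y * (2 * β / (β + |y|)) * f y * D - 2 * β * y / (β + |y|) ^ 3 =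
          2 * β * y / (β + y) ^ 3 * (Real.exp (-y) * f y * D - 1) := by
        unfold m0; rw [abs_of_pos hy]; field_simp
      have e2 : Real.exp (-y) * f y * D - 1 = Real.exp (-y) * D * (f y - (1 + L * (y * (n * q)))) +
          L * (y * (Real.exp (-y) * (D * (n * q)))) + (Real.exp (-y) - 1) + y * (Real.exp (-y) * S) := by
        have : Real.exp (-y) * D = Real.exp (-y) * (1 + y * S) := by rw [← hpd]
        linear_combination this
      have t1 : |Real.exp (-y) * D * (f y - (1 + L * (y * (n * q))))| ≤ C0 * k1 * √y := by
        rw [abs_mul, abs_mul, abs_of_pos (Real.exp_pos _)]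
        calc _ ≤ Real.exp (-y) * |D| * (C0 * √y * Real.exp (y/2)) := by gcongr
          _ = C0 * ((1 * |D|) * (Real.exp (-y) * Real.exp (y/2))) * √y := by ring
          _ ≤ C0 * (((1 + y) * |D|) * E) * √y := by gcongr; linarith
          _ ≤ _ := by gcongr
      have t2 : |L * (y * (Real.exp (-y) * (D * (n * q))))| ≤ L * k2 * √y := by
        rw [abs_mul, abs_mul, abs_mul, abs_mul, abs_mul, abs_of_pos (Real.exp_pos _), abs_of_pos hy, abs_of_pos (by linarith : 0 < L)]
        calc _ ≤ L * (y * (E * (|D| * (|(n:ℝ)| * |q|)))) := by gcongr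
          _ = L * (√y * (|D| * (|(n:ℝ)| * |q|)) * E) * √y := by nth_rw 1 [← hss]; ring
          _ ≤ L * ((1 + y) * (|D| * (|(n:ℝ)| * |q|)) * E) * √y := by gcongr
          _ ≤ _ := by gcongr
      have t3 : |Real.exp (-y) - 1| ≤ √y := by
        have a1 : Real.exp (-y) ≤ 1 := by simpa using hy.le
        have a2 := Real.add_one_le_exp (-y)
        have a3 := Real.exp_pos (-y)
        rw [abs_of_nonpos (by linarith)]
        rcases le_total (√y) 1 with h | h
        · nlinarith
        · linarith
      have t4 : |y * (Real.exp (-y) * S)| ≤ k3 * √y := by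
        rw [abs_mul, abs_mul, abs_of_pos (Real.exp_pos _), abs_of_pos hy]
        calc _ ≤ y * (E * |S|) := by gcongr
          _ = (√y * |S| * E) * √y := by nth_rw 1 [← hss]; ring
          _ ≤ ((1 + y) * |S| * E) * √y := by gcongr
          _ ≤ _ := by gcongr
      have t5 : |Real.exp (-y) * f y * D - 1| ≤ K * (1 + L) * √y := by
        rw [e2]
        refine (abs_add_le _ _).trans ((add_le_add ((abs_add_le _ _).trans (add_le_add (abs_add_le _ _) le_rfl)) le_rfl).trans ?_)
        have : C0 * k1 + L * k2 + 1 + k3 ≤ K * (1 + L) := by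
          rw [hKdef]; nlinarith [mul_pos hC0 hk1, mul_nonneg (mul_pos hC0 hk1).le (by linarith : 0 ≤ L), mul_nonneg hk3.le (by linarith : 0 ≤ L)]
        nlinarith
      rw [e1, abs_mul, abs_of_nonneg (by positivity)]
      calc _ ≤ 2 * β * y / (β + y) ^ 3 * (K * (1 + L) * √y) := by gcongr
        _ = (y ^ 2 / (β + y) ^ 2) * (2 * (√β * √β) * (K * (1 + L)) * (1 / (√y * (β + y)))) := by
          rw [hsbb]
          have : y ^ 2 = y * (√y * √y) := by rw [hss]; ring
          rw [this]; field_simp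
        _ ≤ 1 * (2 * (√β * √β) * (K * (1 + L)) * (1 / (√y * (β + y)))) := by
          gcongr; exact (sqfrac hβ hy).2.1
        _ = _ := by ring)
  have h0 : J2 n β f 0 - ∫ t in (0:ℝ)..0, 2 * β * t / (β + |t|) ^ 3 = 0 := by simp [J2]
  simp only [h0, sub_zero] at h
  rw [int_A hβ hT1.le] at h
  have h2 := (sqfrac hβ hT1).2.2
  have h3 : 2 * β / (β + T) ≤ 2 * (2 / L) / T0 := by
    gcongr; linarith
  have e : J2 n β f T - 1 = (J2 n β f T - T ^ 2 / (β + T) ^ 2) + (T ^ 2 / (β + T) ^ 2 - 1) := by ring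
  rw [e]
  refine (abs_add_le _ _).trans ?_
  have h4 : 4 * (2 * √β * (K * (1 + L))) ≤ 8 * K * (32 / L) := by
    calc _ = 8 * K * (√β * (1 + L)) := by ring
      _ ≤ _ := by gcongr
  have e5 : (8 * K * 32 + 2 * 2 / T0) / L = 8 * K * (32 / L) + 2 * (2 / L) / T0 := by ring
  rw [e5]; linarith

lemma mono_of_deriv {u u' : ℝ → ℝ} {a b : ℝ} (hab : a ≤ b) (hu : ∀ y, a ≤ y → y ≤ b → HasDerivAt u (u' y) y)
    (h : ∀ y, a < y → y < b → 0 ≤ u' y) : u a ≤ u b := by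
  have hm : MonotoneOn u (Icc a b) := by
    apply monotoneOn_of_deriv_nonneg (convex_Icc a b)
    · exact fun y hy => (hu y hy.1 hy.2).continuousAt.continuousWithinAt
    · intro y hy
      rw [interior_Icc] at hy
      exact (hu y hy.1.le hy.2.le).differentiableAt.differentiableWithinAt
    · intro y hy
      rw [interior_Icc] at hy
      rw [(hu y hy.1.le hy.2.le).deriv]; exact h y hy.1 hy.2
  exact hm ⟨le_rfl, hab⟩ ⟨hab, le_rfl⟩ hab

lemma trapP {u v u' v' : ℝ → ℝ} {Y : ℝ} (hu : ∀ y, Y ≤ y → HasDerivAt u (u' y) y)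
    (hv : ∀ y, Y ≤ y → HasDerivAt v (v' y) y)
    (h : ∀ y, Y ≤ y → 0 < u y → 0 < v y → 0 ≤ u' y ∧ 0 ≤ v' y) (hu0 : 0 < u Y) (hv0 : 0 < v Y) :
    ∀ y, Y ≤ y → u Y ≤ u y ∧ v Y ≤ v y := by
  intro T hT
  have huc : ContinuousOn u (Icc Y T) := fun y hy => (hu y hy.1).continuousAt.continuousWithinAt
  have hvc : ContinuousOn v (Icc Y T) := fun y hy => (hv y hy.1).continuousAt.continuousWithinAt
  have hcl : IsClosed ({y | u Y ≤ u y ∧ v Y ≤ v y} ∩ Icc Y T) := by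
    have c1 := huc.preimage_isClosed_of_isClosed isClosed_Icc (isClosed_Ici (a := u Y))
    have c2 := hvc.preimage_isClosed_of_isClosed isClosed_Icc (isClosed_Ici (a := v Y))
    convert c1.inter c2 using 1
    ext y; simp only [mem_inter_iff, mem_ofPred_eq, mem_preimage, mem_Ici]; tauto
  have hsub := hcl.Icc_subset_of_forall_exists_gt ⟨le_rfl, le_rfl⟩ (by
    rintro x ⟨⟨hx1, hx2⟩, hx3, hx4⟩ z hz
    have ev1 : ∀ᶠ y in nhds x, 0 < u y := (hu x hx3).continuousAt.eventually (lt_mem_nhds (hu0.trans_le hx1))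
    have ev2 : ∀ᶠ y in nhds x, 0 < v y := (hv x hx3).continuousAt.eventually (lt_mem_nhds (hv0.trans_le hx2))
    obtain ⟨ε, hε, hb⟩ := Metric.eventually_nhds_iff.1 (ev1.and ev2)
    have hz : x < z := hz
    set w := min z (x + ε/2)
    have hw1 : x < w := lt_min hz (by linarith)
    have hpos : ∀ y, x ≤ y → y ≤ w → 0 < u y ∧ 0 < v y := by
      intro y h1 h2
      have : y ≤ x + ε/2 := h2.trans (min_le_right _ _)
      apply hb
      rw [Real.dist_eq, abs_of_nonneg (by linarith)]; linarith
    refine ⟨w, ⟨?_, ?_⟩, hw1, min_le_left _ _⟩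
    · refine hx1.trans (mono_of_deriv hw1.le (fun y h1 _ => hu y (hx3.trans h1)) ?_)
      intro y h1 h2
      obtain ⟨a, b⟩ := hpos y h1.le h2.le
      exact (h y (hx3.trans h1.le) a b).1
    · refine hx2.trans (mono_of_deriv hw1.le (fun y h1 _ => hv y (hx3.trans h1)) ?_)
      intro y h1 h2
      obtain ⟨a, b⟩ := hpos y h1.le h2.le
      exact (h y (hx3.trans h1.le) a b).2)
  exact hsub ⟨hT, le_rfl⟩

lemma growG {q q' : ℝ → ℝ} {Y c C : ℝ} (hc : 0 < c) (hq : ∀ y, Y ≤ y → HasDerivAt q (q' y) y)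
    (h1 : ∀ y, Y ≤ y → c * Real.exp (3 / 4 * y) ≤ q' y) (h2 : ∀ y, Y ≤ y → q y ≤ C * Real.exp (y / 4)) : False := by
  have key : ∀ y, Y ≤ y → q Y - 4 * c / 3 * Real.exp (3 / 4 * Y) ≤ q y - 4 * c / 3 * Real.exp (3 / 4 * y) := by
    intro y hy
    refine mono_of_deriv (u := fun y => q y - 4 * c / 3 * Real.exp (3 / 4 * y)) (u' := fun y => q' y - c * Real.exp (3 / 4 * y)) hy ?_ ?_
    · intro z hz _
      refine ((hq z hz).sub ((((hasDerivAt_id' z).const_mul (3/4:ℝ)).exp).const_mul (4 * c / 3))).congr_deriv ?_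
      ring
    · intro z hz _
      have := h1 z hz.le; linarith
  set K := q Y - 4 * c / 3 * Real.exp (3 / 4 * Y)
  have hx : ∀ᶠ y in Filter.atTop, (|C| + |K|) / c + 1 ≤ Real.exp (y/4) :=
    (Real.tendsto_exp_atTop.comp (Filter.tendsto_id.atTop_div_const (by norm_num : (0:ℝ) < 4))).eventually_ge_atTop _
  obtain ⟨y, hy1, hy2⟩ := (hx.and (Filter.eventually_ge_atTop Y)).exists
  have a := key y hy2
  have b := h2 y hy2
  have e : Real.exp (3 / 4 * y) = Real.exp (y/4) ^ 3 := by rw [← Real.exp_nat_mul]; ring_nf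
  rw [e] at a
  set x := Real.exp (y/4)
  have hx1 : 1 ≤ x := by
    have : 0 ≤ (|C| + |K|) / c := by positivity
    linarith
  have hx2 : |C| + |K| < c * x := by
    have : (|C| + |K|) / c < x := by linarith
    rw [div_lt_iff₀ hc] at this; linarith
  have h3 : 4 * c / 3 * x ^ 3 ≤ C * x - K := by linarith
  have h4 : C * x ≤ |C| * x := by gcongr; exact le_abs_self C
  have h5 : -K ≤ |K| * x := by nlinarith [neg_abs_le K, abs_nonneg K]
  have h6 : (|C| + |K|) * x < c * x * x := by gcongr
  nlinarith [mul_nonneg hc.le (mul_nonneg (sq_nonneg x) (by linarith : 0 ≤ x - 1)), mul_pos hc (by positivity : 0 < x ^ 3)]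

lemma GG_hasDeriv {β μ : ℝ} (hβ : 0 < β) {f : ℝ → ℝ} (hf : IsSol β μ f) {y : ℝ} (hy : 0 < y) :
    HasDerivAt (GG β μ f) ((2 * β / (β + y) - μ) / y * f y + (1 - 2 * β / (y * (β + y))) * GG β μ f y) y := by
  obtain ⟨hfc, hf0, hfd⟩ := hf
  have hw := wt_pos hβ hy
  have hΦ : HasDerivAt (fun y => ∫ t in (0:ℝ)..y, mm β μ t * f t) (mm β μ y * f y) y :=
    (((mm_cont hβ μ).mul hfc).integral_hasStrictDerivAt 0 y).hasDerivAt
  have h2 : HasDerivAt (GG β μ f) _ y := (hΦ.div (wt_hasDeriv hβ hy) hw.ne').congr_of_eventuallyEq (by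
    filter_upwards [Ioi_mem_nhds hy] with z hz
    have hz : 0 < z := hz
    rw [GG_eq hβ μ f hz]; rfl)
  refine h2.congr_deriv ?_
  have e1 : (∫ t in (0:ℝ)..y, mm β μ t * f t) = wt β y * GG β μ f y := by
    rw [GG_eq hβ μ f hy]; field_simp
  have e3 : wt β y = y * m0 β y := by unfold wt m0; ring
  have hm : 0 < m0 β y := by
    rw [e3] at hw; exact (mul_pos_iff_of_pos_left hy).1 hw
  rw [e1, e3, mm, abs_of_pos hy]
  generalize GG β μ f y = g
  field_simp
  ring

lemma pos_right {u : ℝ → ℝ} {c x : ℝ} (h : HasDerivAt u c x) (h0 : u x = 0) (hc : 0 < c) :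
    ∀ᶠ y in nhdsWithin x (Ioi x), 0 < u y := by
  have h1 := (hasDerivAt_iff_tendsto_slope.1 h).eventually (lt_mem_nhds hc)
  have h2 := h1.filter_mono (nhdsWithin_mono x (fun y (hy : x < y) => ne_of_gt hy))
  filter_upwards [h2, self_mem_nhdsWithin] with y hy hxy
  have hxy : x < y := hxy
  rw [slope_def_field, h0, sub_zero] at hy
  exact (div_pos_iff_of_pos_right (by linarith)).1 hy

/-- nondegeneracy -/
lemma nondeg {β μ : ℝ} (hβ : 0 < β) {f : ℝ → ℝ} (hf : IsSol β μ f) {y : ℝ} (hy : 0 < y) (h0 : f y = 0) :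
    GG β μ f y ≠ 0 := by
  intro hg
  have hfc := hf.1
  have key : ∀ a, 0 < a → a < y → f a = 0 := by
    intro a ha hay
    obtain ⟨K, hK⟩ : ∃ K, K = 1 + (2 + |μ|) / a + 2 * (1 + 2 / a) := ⟨_, rfl⟩
    have hK0 : 0 < K := by rw [hK]; positivity
    have hm := mono_of_deriv (u := fun t => (f t ^ 2 + GG β μ f t ^ 2) * Real.exp (K * t))
      (u' := fun t => ((2 * f t * GG β μ f t + 2 * GG β μ f t * ((2 * β / (β + t) - μ) / t * f t + (1 - 2 * β / (t * (β + t))) * GG β μ f t))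
        + (f t ^ 2 + GG β μ f t ^ 2) * K) * Real.exp (K * t)) hay.le (by
          intro t ht _
          have ht0 : 0 < t := ha.trans_le ht
          refine ((((hf.2.2 t ht0).fun_pow 2).add ((GG_hasDeriv hβ hf ht0).fun_pow 2)).mul
            (((hasDerivAt_id' t).const_mul K).exp)).congr_deriv ?_
          simp only [Pi.add_apply]; push_cast; ring) (by
          intro t ht _
          have ht0 : 0 < t := ha.trans ht
          have b1 : 2 * β / (β + t) ≤ 2 := by rw [div_le_iff₀ (by positivity)]; linarith
          have b1' : 0 ≤ 2 * β / (β + t) := by positivity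
          have c1 : |(2 * β / (β + t) - μ) / t| ≤ (2 + |μ|) / a := by
            rw [abs_div, abs_of_pos ht0]
            have : |2 * β / (β + t) - μ| ≤ 2 + |μ| := by
              refine (abs_sub _ _).trans ?_
              rw [abs_of_nonneg b1']; linarith
            gcongr
          have c2 : |1 - 2 * β / (t * (β + t))| ≤ 1 + 2 / a := by
            refine (abs_sub _ _).trans ?_
            have : 2 * β / (t * (β + t)) ≤ 2 / a := by
              calc _ = (2 * β / (β + t)) / t := by field_simp
                _ ≤ 2 / a := by gcongr
            rw [abs_one, abs_of_nonneg (by positivity)]; linarith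
          apply mul_nonneg _ (Real.exp_pos _).le
          generalize GG β μ f t = g
          generalize (2 * β / (β + t) - μ) / t = p at *
          generalize (1 - 2 * β / (t * (β + t))) = r at *
          generalize f t = x
          set A := (2 + |μ|) / a
          set B := 1 + 2 / a
          have hB : 0 < B := by positivity
          have i1 : -(A * (x ^ 2 + g ^ 2)) ≤ 2 * g * (p * x) := by
            have : |2 * g * (p * x)| ≤ A * (x ^ 2 + g ^ 2) := by
              calc |2 * g * (p * x)| = |p| * |2 * x * g| := by rw [← abs_mul]; ring_nf
                _ ≤ A * (x ^ 2 + g ^ 2) := by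
                  have : 0 ≤ A := (abs_nonneg p).trans c1
                  gcongr
                  rw [abs_le]; constructor <;> nlinarith [sq_nonneg (x - g), sq_nonneg (x + g)]
            exact (abs_le.1 this).1
          have i2 : -(2 * B * g ^ 2) ≤ 2 * g * (r * g) := by
            have := (abs_le.1 c2).1
            nlinarith [sq_nonneg g]
          rw [hK]
          nlinarith [sq_nonneg (x + g), mul_nonneg hB.le (sq_nonneg x)])
    simp only [h0, hg] at hm
    have h3 := Real.exp_pos (K * a)
    have h4 : f a ^ 2 + GG β μ f a ^ 2 ≤ 0 := by
      by_contra hh; push Not at hh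
      have := mul_pos hh h3
      norm_num at hm; linarith
    nlinarith [sq_nonneg (f a), sq_nonneg (GG β μ f a)]
  have ht : Filter.Tendsto f (nhdsWithin 0 (Ioi 0)) (nhds (f 0)) := hfc.continuousAt.tendsto.mono_left nhdsWithin_le_nhds
  have ht2 : Filter.Tendsto f (nhdsWithin 0 (Ioi 0)) (nhds 0) := by
    apply tendsto_const_nhds.congr'
    filter_upwards [Ioo_mem_nhdsGT hy] with a ha
    exact (key a ha.1 ha.2).symm
  have := tendsto_nhds_unique ht ht2
  rw [hf.2.1] at this; norm_num at this

/-- propagation of the barrier -/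
lemma prop_bar {β μ Y s : ℝ} (hβ : 0 < β) {f : ℝ → ℝ} (hf : IsSol β μ f) (hY : 0 < Y) (hμ : μ ≤ Y / 8) (hβY : 2 * β / Y ^ 2 ≤ 1 / 4)
    {y0 : ℝ} (hy0 : Y ≤ y0) (h1 : 0 < s * f y0) (h2 : 0 < s * (GG β μ f y0 - f y0 / 4)) :
    ∀ y, y0 ≤ y → 0 < s * f y ∧ 0 < s * (GG β μ f y - f y / 4) := by
  intro y hy
  have := trapP (u := fun y => s * f y) (v := fun y => s * (GG β μ f y - f y / 4)) (u' := fun y => s * GG β μ f y)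
    (v' := fun y => s * ((2 * β / (β + y) - μ) / y * f y + (1 - 2 * β / (y * (β + y))) * GG β μ f y - GG β μ f y / 4)) (Y := y0)
    (fun z hz => (hf.2.2 z (by linarith)).const_mul s)
    (fun z hz => ((GG_hasDeriv hβ hf (by linarith)).sub ((hf.2.2 z (by linarith)).div_const 4)).const_mul s)
    (by
      intro z hz p1 p2
      have hz0 : 0 < z := by linarith
      have hYz : Y ≤ z := by linarith
      refine ⟨by nlinarith, ?_⟩
      have c1 : -(1/8) ≤ (2 * β / (β + z) - μ) / z := by
        rw [le_div_iff₀ hz0]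
        have : 0 ≤ 2 * β / (β + z) := by positivity
        linarith
      have c2 : 2 * β / (z * (β + z)) ≤ 1 / 4 := by
        refine le_trans ?_ hβY
        gcongr; nlinarith
      generalize GG β μ f z = g at *
      generalize (2 * β / (β + z) - μ) / z = p at *
      generalize 2 * β / (z * (β + z)) = r at *
      have e : s * (p * f z + (1 - r) * g - g / 4) = (p + (3/4 - r)/4) * (s * f z) + (3/4 - r) * (s * (g - f z / 4)) := by ring
      rw [e]
      apply add_nonneg <;> apply mul_nonneg <;> linarith) h1 h2 y hy
  exact ⟨h1.trans_le this.1, h2.trans_le this.2⟩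

/-- trapped solutions have no zeros and satisfy a growth bound -/
lemma trapped_ne {β μ Y : ℝ} (hβ : 0 < β) {f : ℝ → ℝ} (hf : IsSol β μ f) (hY : 0 < Y)
    (ht : ∀ y, Y ≤ y → f y * (GG β μ f y - f y / 4) ≤ 0) : ∀ y, Y ≤ y → f y ≠ 0 := by
  intro y hy h0
  have hy0 : 0 < y := by linarith
  have hg := nondeg hβ hf hy0 h0
  have hd := (hf.2.2 y hy0).mul ((GG_hasDeriv hβ hf hy0).sub ((hf.2.2 y hy0).div_const 4))
  have ev := pos_right hd (by simp [h0]) (by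
    simp only [Pi.sub_apply]
    rw [h0]; ring_nf; positivity)
  obtain ⟨z, hz1, hz2⟩ := (ev.and self_mem_nhdsWithin).exists
  have hz2 : y < z := hz2
  have := ht z (by linarith)
  simp only [Pi.mul_apply, Pi.sub_apply] at hz1
  linarith

lemma trapped_growth {β μ Y s : ℝ} (hβ : 0 < β) {f : ℝ → ℝ} (hf : IsSol β μ f) (hY : 0 < Y)
    (hs : ∀ y, Y ≤ y → 0 < s * f y) (ht : ∀ y, Y ≤ y → s * (GG β μ f y - f y / 4) ≤ 0) :
    ∀ y, Y ≤ y → s * f y ≤ s * f Y * Real.exp (y/4) := by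
  intro y hy
  have := mono_of_deriv (u := fun y => -(s * f y * Real.exp (-(y/4)))) (u' := fun y => -(s * (GG β μ f y - f y / 4)) * Real.exp (-(y/4)))
    hy (fun z hz _ => by
      refine ((((hf.2.2 z (by linarith)).const_mul s).mul (((hasDerivAt_id' z).div_const 4).neg.exp)).neg).congr_deriv ?_
      simp only [Pi.neg_apply]; ring) (fun z hz _ => by
      have := ht z hz.le
      exact mul_nonneg (by linarith) (Real.exp_pos _).le)
  have h1 : s * f y * Real.exp (-(y/4)) ≤ s * f Y * Real.exp (-(Y/4)) := by linarith
  have h2 : Real.exp (-(Y/4)) ≤ 1 := by simp; linarith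
  have h3 := hs Y le_rfl
  have h4 : s * f y * Real.exp (-(y/4)) ≤ s * f Y := h1.trans (by nlinarith)
  rw [Real.exp_neg, ← div_eq_mul_inv, div_le_iff₀ (Real.exp_pos _)] at h4
  exact h4

lemma const_sign {u : ℝ → ℝ} {Y : ℝ} (hc : Continuous u) (h : ∀ y, Y ≤ y → u y ≠ 0) :
    ∃ s : ℝ, (s = 1 ∨ s = -1) ∧ ∀ y, Y ≤ y → 0 < s * u y := by
  have h0 := h Y le_rfl
  rcases lt_or_gt_of_ne h0 with h1 | h1
  · refine ⟨-1, Or.inr rfl, fun y hy => ?_⟩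
    by_contra hh; push Not at hh
    obtain ⟨z, hz, hz0⟩ := intermediate_value_Icc hy hc.continuousOn (⟨h1.le, by linarith⟩ : (0:ℝ) ∈ Icc (u Y) (u y))
    exact h z hz.1 hz0
  · refine ⟨1, Or.inl rfl, fun y hy => ?_⟩
    by_contra hh; push Not at hh
    obtain ⟨z, hz, hz0⟩ := intermediate_value_Icc' hy hc.continuousOn (⟨by linarith, h1.le⟩ : (0:ℝ) ∈ Icc (u y) (u Y))
    exact h z hz.1 hz0

lemma wt_le {β y : ℝ} (hβ : 0 < β) (hy : 0 < y) : wt β y ≤ Real.exp (-y) := by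
  have h := (sqfrac hβ hy).2.1
  have h2 := Real.exp_pos (-y)
  rw [wt, abs_of_pos hy, mul_div_assoc]
  nlinarith

lemma quot_hasDeriv (n : ℕ) {β μ : ℝ} (hβ : 0 < β) {f : ℝ → ℝ} (hf : IsSol β μ f) {y : ℝ} (hy : 0 < y) (hP : PP n y ≠ 0) :
    HasDerivAt (fun y => f y / PP n y) (WW n β μ f y / (wt β y * PP n y ^ 2)) y := by
  refine ((hf.2.2 y hy).div (PP_hasDeriv n y) hP).congr_deriv ?_
  have hw := wt_pos hβ hy
  rw [WW]
  field_simp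

lemma first_zero {q : ℝ → ℝ} {a b : ℝ} (hab : a ≤ b) (hq : ContinuousOn q (Icc a b)) (ha : 0 < q a) (hb : q b ≤ 0) :
    ∃ c, a < c ∧ c ≤ b ∧ q c = 0 ∧ ∀ x, a ≤ x → x < c → 0 < q x := by
  have hcl : IsClosed (Icc a b ∩ q ⁻¹' Iic 0) := hq.preimage_isClosed_of_isClosed isClosed_Icc isClosed_Iic
  have hne : (Icc a b ∩ q ⁻¹' Iic 0).Nonempty := ⟨b, ⟨hab, le_rfl⟩, hb⟩
  have hbd : BddBelow (Icc a b ∩ q ⁻¹' Iic 0) := ⟨a, fun x hx => hx.1.1⟩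
  have hc := hcl.csInf_mem hne hbd
  set c := sInf (Icc a b ∩ q ⁻¹' Iic 0)
  obtain ⟨⟨c1, c2⟩, c3⟩ := hc
  have c3 : q c ≤ 0 := c3
  have hpos : ∀ x, a ≤ x → x < c → 0 < q x := by
    intro x h1 h2
    by_contra hh; push Not at hh
    exact absurd (csInf_le hbd ⟨⟨h1, h2.le.trans c2⟩, hh⟩) (not_le.2 h2)
  have hac : a < c := lt_of_le_of_ne c1 (by rintro h; rw [← h] at c3; linarith)
  refine ⟨c, hac, c2, ?_, hpos⟩
  obtain ⟨z, hz, hz0⟩ := intermediate_value_Icc' c1 (hq.mono (Icc_subset_Icc_right c2)) (⟨c3, ha.le⟩ : (0:ℝ) ∈ Icc (q c) (q a))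
  rcases eq_or_lt_of_le hz.2 with h | h
  · rw [← h]; exact hz0
  · have := hpos z hz.1 h; linarith

lemma quot_sign {s x p : ℝ} (hs : s = 1 ∨ s = -1) (hp : 0 < s * p) : (0 < x / p ↔ 0 < s * x) := by
  have h : x / p = (s * x) / (s * p) := by
    rcases hs with h | h <;> subst h
    · simp
    · rw [neg_one_mul, neg_one_mul, neg_div_neg_eq]
  rw [h]
  exact div_pos_iff_of_pos_right hp

lemma endpoint_minus (n : ℕ) {β μ Y s : ℝ} (hβ : 0 < β) {f : ℝ → ℝ} (hf : IsSol β μ f) (hY : 0 < Y)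
    (hP : ∀ y, Y ≤ y → 1 ≤ |PP n y| ∧ |PD n y| ≤ |PP n y|) (hs : s = 1 ∨ s = -1) (hsP : ∀ y, Y ≤ y → 0 < s * PP n y)
    (hμ : μ ≤ n) (h1 : 0 < s * f Y) (h2 : 0 < WW n β μ f Y) : ∃ y, Y ≤ y ∧ 0 < s * f y ∧ 0 < s * (GG β μ f y - f y / 4) := by
  by_contra hcon
  push Not at hcon
  have hPne : ∀ y, Y ≤ y → PP n y ≠ 0 := fun y hy h => by have := hsP y hy; rw [h] at this; simp at this
  have key := trapP (u := fun y => f y / PP n y) (v := WW n β μ f) (u' := fun y => WW n β μ f y / (wt β y * PP n y ^ 2))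
    (v' := fun y => m0 β y * f y * ((n - μ) * PP n y + 2 * β / (β + y) * (PP n y - PD n y))) (Y := Y)
    (fun y hy => quot_hasDeriv n hβ hf (by linarith) (hPne y hy)) (fun y hy => WW_hasDeriv n hβ hf (by linarith))
    (by
      intro y hy p1 p2
      have hy0 : 0 < y := by linarith
      have hw := wt_pos hβ hy0
      refine ⟨by positivity, ?_⟩
      have hm := m0_nonneg hβ hy0.le
      have hPy := (hP y hy).2
      obtain ⟨q, hq⟩ : ∃ q, q = f y / PP n y := ⟨_, rfl⟩
      have hfq : f y = q * PP n y := by rw [hq]; field_simp [hPne y hy]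
      have hq0 : 0 < q := by rw [hq]; exact p1
      have hpp : 0 ≤ PP n y * (PP n y - PD n y) := by
        have : PP n y * PD n y ≤ |PP n y| * |PP n y| := (le_abs_self _).trans (by rw [abs_mul]; gcongr)
        have h3 := abs_mul_abs_self (PP n y)
        nlinarith
      have e : m0 β y * f y * ((n - μ) * PP n y + 2 * β / (β + y) * (PP n y - PD n y)) =
          m0 β y * q * ((n - μ) * PP n y ^ 2 + 2 * β / (β + y) * (PP n y * (PP n y - PD n y))) := by rw [hfq]; ring
      rw [e]
      have : 0 ≤ n - μ := by linarith
      positivity) ((quot_sign hs (hsP Y le_rfl)).2 h1) h2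
  have hsf : ∀ y, Y ≤ y → 0 < s * f y := by
    intro y hy
    have hq := (key y hy).1
    have hq0 : 0 < f Y / PP n Y := (quot_sign hs (hsP Y le_rfl)).2 h1
    exact (quot_sign hs (hsP y hy)).1 (hq0.trans_le hq)
  have hgr := trapped_growth hβ hf hY hsf (fun y hy => hcon y hy (hsf y hy))
  obtain ⟨C, hC, hCb⟩ := poly_exp_bd (pp n) (ε := 1/8) (by norm_num)
  refine growG (q := fun y => f y / PP n y) (Y := Y) (c := WW n β μ f Y / C ^ 2) (C := s * f Y) (by positivity)
    (fun y hy => quot_hasDeriv n hβ hf (by linarith) (hPne y hy)) ?_ ?_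
  · intro y hy
    have hy0 : 0 < y := by linarith
    have hw := wt_pos hβ hy0
    have hb : |PP n y| ≤ C * Real.exp (1/8 * y) := hCb y hy0.le
    have hPn := hPne y hy
    have hden : wt β y * PP n y ^ 2 ≤ C ^ 2 * Real.exp (-(3/4 * y)) := by
      have hp2 : PP n y ^ 2 ≤ C ^ 2 * Real.exp (1/4 * y) := by
        rw [← sq_abs]
        calc |PP n y| ^ 2 ≤ (C * Real.exp (1/8 * y)) ^ 2 := by gcongr
          _ = C ^ 2 * Real.exp (1/4 * y) := by rw [mul_pow, ← Real.exp_nat_mul]; ring_nf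
      calc _ ≤ Real.exp (-y) * (C ^ 2 * Real.exp (1/4 * y)) := by
            gcongr; exact wt_le hβ hy0
        _ = C ^ 2 * (Real.exp (-y) * Real.exp (1/4 * y)) := by ring
        _ = _ := by rw [← Real.exp_add]; ring_nf
    have hW := (key y hy).2
    have hW' : 0 ≤ WW n β μ f y := by linarith
    calc _ = WW n β μ f Y / (C ^ 2 * Real.exp (-(3/4 * y))) := by rw [Real.exp_neg]; field_simp
      _ ≤ WW n β μ f y / (wt β y * PP n y ^ 2) := by
        gcongr
  · intro y hy
    have hy0 : 0 < y := by linarith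
    refine le_trans ?_ (hgr y hy)
    have h3 : f y / PP n y = (s * f y) / |PP n y| := by
      have := hsP y hy
      rcases hs with h | h <;> subst h
      · rw [one_mul] at this ⊢; rw [abs_of_pos this]
      · rw [abs_of_neg (by linarith), neg_one_mul, neg_div_neg_eq]
    rw [h3]
    exact div_le_self (hsf y hy).le (hP y hy).1

lemma endpoint_plus (n : ℕ) {β μ Y s : ℝ} (hβ : 0 < β) {f : ℝ → ℝ} (hf : IsSol β μ f) (hY : 0 < Y)
    (hP : ∀ y, Y ≤ y → 1 ≤ |PP n y| ∧ |PD n y| ≤ |PP n y|) (hs : s = 1 ∨ s = -1) (hsP : ∀ y, Y ≤ y → 0 < s * PP n y)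
    (hμ : n + 4 * β / Y ≤ μ) (h1 : 0 < s * f Y) (h2 : WW n β μ f Y < 0) : ∃ y, Y ≤ y ∧ s * f y < 0 ∧ s * (GG β μ f y - f y / 4) < 0 := by
  by_contra hcon
  push Not at hcon
  have hPne : ∀ y, Y ≤ y → PP n y ≠ 0 := fun y hy h => by have := hsP y hy; rw [h] at this; simp at this
  -- W decreasing while q positive
  have hWdec : ∀ c, Y ≤ c → (∀ x, Y ≤ x → x < c → 0 < f x / PP n x) → WW n β μ f c ≤ WW n β μ f Y := by
    intro c hc hq
    have := mono_of_deriv (u := fun y => -WW n β μ f y) (u' := fun y => -(m0 β y * f y * ((n - μ) * PP n y + 2 * β / (β + y) * (PP n y - PD n y))))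
      hc (fun y hy _ => (WW_hasDeriv n hβ hf (by linarith)).neg) (by
        intro y hy hyc
        have hy0 : 0 < y := by linarith
        have hm := m0_nonneg hβ hy0.le
        have hPy := (hP y hy.le).2
        have p1 := hq y hy.le hyc
        obtain ⟨q, hq⟩ : ∃ q, q = f y / PP n y := ⟨_, rfl⟩
        have hfq : f y = q * PP n y := by rw [hq]; field_simp [hPne y hy.le]
        have hq0 : 0 < q := by rw [hq]; exact p1
        have hpp : PP n y * (PP n y - PD n y) ≤ 2 * PP n y ^ 2 := by
          have : -(PP n y * PD n y) ≤ |PP n y| * |PP n y| := (neg_le_abs _).trans (by rw [abs_mul]; gcongr)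
          have h3 := abs_mul_abs_self (PP n y)
          nlinarith
        have e : -(m0 β y * f y * ((n - μ) * PP n y + 2 * β / (β + y) * (PP n y - PD n y))) =
            m0 β y * q * ((μ - n) * PP n y ^ 2 - 2 * β / (β + y) * (PP n y * (PP n y - PD n y))) := by rw [hfq]; ring
        rw [e]
        have h5 : 2 * β / (β + y) * (PP n y * (PP n y - PD n y)) ≤ (4 * β / Y) * PP n y ^ 2 := by
          calc _ ≤ 2 * β / (β + y) * (2 * PP n y ^ 2) := by gcongr
            _ ≤ 2 * β / Y * (2 * PP n y ^ 2) := by gcongr; linarith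
            _ = _ := by ring
        have h6 : (4 * β / Y) * PP n y ^ 2 ≤ (μ - n) * PP n y ^ 2 := by gcongr; linarith
        apply mul_nonneg (by positivity) (by linarith))
    linarith
  have hqY : 0 < f Y / PP n Y := (quot_sign hs (hsP Y le_rfl)).2 h1
  have hall : ∀ y, Y ≤ y → 0 < f y / PP n y := by
    intro y hy
    by_contra hh; push Not at hh
    obtain ⟨c, c1, c2, c3, c4⟩ := first_zero (q := fun y => f y / PP n y) hy
      (fun x hx => (quot_hasDeriv n hβ hf (by linarith [hx.1]) (hPne x hx.1)).continuousAt.continuousWithinAt) hqY hh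
    have hc0 : 0 < c := by linarith
    have hPc := hPne c c1.le
    have hfc : f c = 0 := by
      rcases div_eq_zero_iff.1 c3 with h | h
      · exact h
      · exact absurd h hPc
    have hW := hWdec c c1.le c4
    have hsg : s * GG β μ f c < 0 := by
      have hw := wt_pos hβ hc0
      have h3 : wt β c * (GG β μ f c * PP n c) < 0 := by
        have e : WW n β μ f c = wt β c * (GG β μ f c * PP n c) := by rw [WW, hfc]; ring
        rw [e] at hW; linarith
      have h4 : GG β μ f c * PP n c < 0 := by
        by_contra h5; push Not at h5
        have := mul_nonneg hw.le h5; linarith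
      have h5 := hsP c c1.le
      have h6 : (s * GG β μ f c) * (s * PP n c) < 0 := by
        have : s * s = 1 := by rcases hs with h | h <;> rw [h] <;> norm_num
        calc _ = (s * s) * (GG β μ f c * PP n c) := by ring
          _ < 0 := by rw [this]; linarith
      by_contra h7; push Not at h7
      have := mul_nonneg h7 h5.le; linarith
    have ev1 := pos_right ((hf.2.2 c hc0).const_mul (-s)) (by rw [hfc]; ring) (by linarith)
    have hdc : ContinuousAt (fun y => s * (GG β μ f y - f y / 4)) c := by
      have hg := GG_cont hβ μ hf.1
      have hfc := hf.1
      apply Continuous.continuousAt; fun_prop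
    have ev2 : ∀ᶠ y in nhdsWithin c (Ioi c), s * (GG β μ f y - f y / 4) < 0 :=
      (hdc.eventually (gt_mem_nhds (by simp only [hfc]; linarith : s * (GG β μ f c - f c / 4) < 0))).filter_mono nhdsWithin_le_nhds
    obtain ⟨z, ⟨z1, z2⟩, z3⟩ := ((ev1.and ev2).and self_mem_nhdsWithin).exists
    have z3 : c < z := z3
    have := hcon z (by linarith) (by linarith)
    linarith
  -- q tends to -∞
  obtain ⟨C, hC, hCb⟩ := poly_exp_bd (pp n) (ε := 1/8) (by norm_num)
  refine growG (q := fun y => - (f y / PP n y)) (Y := Y) (c := -WW n β μ f Y / C ^ 2) (C := 0) (by apply div_pos <;> [linarith; positivity])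
    (fun y hy => (quot_hasDeriv n hβ hf (by linarith) (hPne y hy)).neg) ?_ ?_
  · intro y hy
    have hy0 : 0 < y := by linarith
    have hw := wt_pos hβ hy0
    have hb : |PP n y| ≤ C * Real.exp (1/8 * y) := hCb y hy0.le
    have hPn := hPne y hy
    have hden : wt β y * PP n y ^ 2 ≤ C ^ 2 * Real.exp (-(3/4 * y)) := by
      have hp2 : PP n y ^ 2 ≤ C ^ 2 * Real.exp (1/4 * y) := by
        rw [← sq_abs]
        calc |PP n y| ^ 2 ≤ (C * Real.exp (1/8 * y)) ^ 2 := by gcongr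
          _ = C ^ 2 * Real.exp (1/4 * y) := by rw [mul_pow, ← Real.exp_nat_mul]; ring_nf
      calc _ ≤ Real.exp (-y) * (C ^ 2 * Real.exp (1/4 * y)) := by
            gcongr; exact wt_le hβ hy0
        _ = C ^ 2 * (Real.exp (-y) * Real.exp (1/4 * y)) := by ring
        _ = _ := by rw [← Real.exp_add]; ring_nf
    have hW := hWdec y hy (fun x hx _ => hall x hx)
    have hW' : 0 ≤ -WW n β μ f y := by linarith
    calc _ = -WW n β μ f Y / (C ^ 2 * Real.exp (-(3/4 * y))) := by rw [Real.exp_neg]; field_simp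
      _ ≤ -WW n β μ f y / (wt β y * PP n y ^ 2) := by
        gcongr
      _ = _ := by ring
  · intro y hy
    have := hall y hy
    linarith

lemma trap_exists {β Y s μ1 μ2 : ℝ} (hβ : 0 < β) (hY : 0 < Y) (hs : s = 1 ∨ s = -1) (F : ℝ → ℝ → ℝ)
    (hF : ∀ μ, IsSol β μ (F μ)) (h12 : μ1 ≤ μ2) (hμ : μ2 ≤ Y / 8) (hβY : 2 * β / Y ^ 2 ≤ 1 / 4)
    (h1 : ∃ y, Y ≤ y ∧ 0 < s * F μ1 y ∧ 0 < s * (GG β μ1 (F μ1) y - F μ1 y / 4))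
    (h2 : ∃ y, Y ≤ y ∧ s * F μ2 y < 0 ∧ s * (GG β μ2 (F μ2) y - F μ2 y / 4) < 0) :
    ∃ μ, μ ∈ Icc μ1 μ2 ∧ ∀ y, Y ≤ y → F μ y * (GG β μ (F μ) y - F μ y / 4) ≤ 0 := by
  by_contra hcon
  push Not at hcon
  have hss : s * s = 1 := by rcases hs with h | h <;> rw [h] <;> norm_num
  set U := {μ : ℝ | ∃ y, Y ≤ y ∧ 0 < s * F μ y ∧ 0 < s * (GG β μ (F μ) y - F μ y / 4)} with hU
  set V := {μ : ℝ | ∃ y, Y ≤ y ∧ s * F μ y < 0 ∧ s * (GG β μ (F μ) y - F μ y / 4) < 0} with hV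
  have hUo : IsOpen U := by
    have : U = ⋃ y ∈ Ici Y, ({μ : ℝ | 0 < s * F μ y} ∩ {μ | 0 < s * (GG β μ (F μ) y - F μ y / 4)}) := by
      ext μ; simp [hU, and_left_comm]
    rw [this]
    refine isOpen_biUnion fun y hy => ?_
    obtain ⟨c1, c2⟩ := mu_cont hβ hF (hY.trans_le hy)
    exact (isOpen_lt continuous_const (by fun_prop)).inter (isOpen_lt continuous_const (by fun_prop))
  have hVo : IsOpen V := by
    have : V = ⋃ y ∈ Ici Y, ({μ : ℝ | s * F μ y < 0} ∩ {μ | s * (GG β μ (F μ) y - F μ y / 4) < 0}) := by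
      ext μ; simp [hV, and_left_comm]
    rw [this]
    refine isOpen_biUnion fun y hy => ?_
    obtain ⟨c1, c2⟩ := mu_cont hβ hF (hY.trans_le hy)
    exact (isOpen_lt (by fun_prop) continuous_const).inter (isOpen_lt (by fun_prop) continuous_const)
  have hsub : Icc μ1 μ2 ⊆ U ∪ V := by
    intro μ hm
    obtain ⟨y, hy, hp⟩ := hcon μ hm
    have e : 0 < (s * F μ y) * (s * (GG β μ (F μ) y - F μ y / 4)) := by
      calc 0 < (s * s) * (F μ y * (GG β μ (F μ) y - F μ y / 4)) := by rw [hss]; linarith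
        _ = _ := by ring
    rcases mul_pos_iff.1 e with h | h
    · exact Or.inl ⟨y, hy, h.1, h.2⟩
    · exact Or.inr ⟨y, hy, h.1, h.2⟩
  obtain ⟨μ, hm, ⟨y1, a1, a2, a3⟩, ⟨y2, b1, b2, b3⟩⟩ := isPreconnected_Icc U V hUo hVo hsub ⟨μ1, ⟨le_rfl, h12⟩, h1⟩ ⟨μ2, ⟨h12, le_rfl⟩, h2⟩
  have p1 := prop_bar hβ (hF μ) hY (hm.2.trans hμ) hβY a1 a2 a3 (max y1 y2) (le_max_left _ _)
  have p2 := prop_bar (s := -s) hβ (hF μ) hY (hm.2.trans hμ) hβY b1 (by linarith) (by linarith) (max y1 y2) (le_max_right _ _)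
  linarith [p1.1, p2.1]

noncomputable def cc : ℕ → ℝ → ℝ
  | 0, _ => 1
  | (n+1), T => cT n T

lemma cc_tendsto (n : ℕ) : Filter.Tendsto (cc n) Filter.atTop (nhds 1) := by
  cases n with
  | zero => exact tendsto_const_nhds
  | succ n => exact c_tendsto n

lemma J1_est (n : ℕ) (C0 T0 : ℝ) (hC0 : 0 < C0) (hT0 : 0 < T0) : ∃ C, 0 < C ∧ ∀ β, 0 < β → β ≤ Real.exp (-1) → ∀ f : ℝ → ℝ, Continuous f →
    ∀ T, T0 ≤ T → (∀ y, 0 < y → y ≤ T → |f y - (1 + (-Real.log β) * ((n:ℝ) * PP n y))| ≤ C0 * √y * Real.exp (y/2)) →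
    |J1 n β f T - cc n T * (-Real.log β)| ≤ C := by
  cases n with
  | zero =>
    obtain ⟨C, hC, h⟩ := J1_est_zero C0 T0 hC0 hT0
    refine ⟨C, hC, fun β h1 h2 f hf T hT hR => ?_⟩
    rw [cc, one_mul]
    exact h β h1 h2 f hf T hT hR
  | succ n =>
    obtain ⟨C, hC, h⟩ := J1_est_succ n C0 hC0
    exact ⟨C, hC, fun β h1 h2 f hf T hT hR => h β h1 h2 f hf T (hT0.trans_le hT) hR⟩

def Good (n : ℕ) (Y C : ℝ) : Prop := ∀ β, 0 < β → β ≤ Real.exp (-1) → ∀ μ : ℝ, |μ - n| ≤ 8 / (-Real.log β) → ∀ f, IsSol β μ f →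
  ∀ y, 0 < y → y ≤ Y → |f y - (1 + (-Real.log β) * ((n:ℝ) * PP n y))| ≤ C * √y ∧
    |GG β μ f y - (-Real.log β) * ((n:ℝ) * PD n y)| ≤ C / √y

lemma good_exists (n : ℕ) (Y : ℝ) (hY : 0 < Y) : ∃ C, 0 < C ∧ Good n Y C := by
  obtain ⟨C, hC, h⟩ := R_est (n:ℝ) 8 Y (by positivity) (by norm_num) hY (fun y => n * PP n y) (fun y => n * PD n y) (fun y => n * QQ n y)
    ((QQ_cont n).const_mul _) ((PD_cont n).const_mul _) (nPP_eq n) (fun t => (PP_hasDeriv n t).const_mul _) (fun s _ => N_identity n s)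
  exact ⟨C, hC, h⟩

lemma setup (n : ℕ) : ∃ Y C, 0 < Y ∧ 0 < C ∧ Good n Y C ∧ (∀ y, Y ≤ y → 1 ≤ |PP n y| ∧ |PD n y| ≤ |PP n y|) ∧ 1 / 2 ≤ cc n Y ∧
    (n = 0 → C * √Y ≤ 1 / 2) ∧ (n ≠ 0 → 8 * ((n:ℝ) + 1) ≤ Y) := by
  cases n with
  | zero =>
    obtain ⟨C, hC, h⟩ := good_exists 0 1 one_pos
    refine ⟨min 1 (1 / (4 * C ^ 2)), C, lt_min one_pos (by positivity), hC, ?_, ?_, ?_, ?_, ?_⟩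
    · intro β h1 h2 μ h3 f hf y hy hyY
      exact h β h1 h2 μ h3 f hf y hy (hyY.trans (min_le_left _ _))
    · intro y _; rw [PP_zero_fun, PD_zero_fun]; norm_num
    · norm_num [cc]
    · intro _
      have : √(min 1 (1 / (4 * C ^ 2))) ≤ 1 / (2 * C) := by
        apply Real.sqrt_le_iff.2
        refine ⟨by positivity, (min_le_right _ _).trans (le_of_eq ?_)⟩
        field_simp; norm_num
      calc _ ≤ C * (1 / (2 * C)) := by gcongr
        _ = 1 / 2 := by field_simp
    · intro h; exact absurd rfl h
  | succ n =>
    obtain ⟨Y0, hY0, hP⟩ := PP_large n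
    have hc : ∀ᶠ T in Filter.atTop, 1 / 2 ≤ cc (n+1) T := ((cc_tendsto (n+1)).eventually (lt_mem_nhds (by norm_num : (1/2:ℝ) < 1))).mono (fun _ h => h.le)
    obtain ⟨Y, ⟨h1, h2⟩, h3⟩ := ((hc.and (Filter.eventually_ge_atTop Y0)).and (Filter.eventually_ge_atTop (8 * (((n+1:ℕ):ℝ) + 1)))).exists
    have hY : 0 < Y := hY0.trans_le h2
    obtain ⟨C, hC, h⟩ := good_exists (n+1) Y hY
    exact ⟨Y, C, hY, hC, h, fun y hy => hP y (h2.trans hy), h1, fun h => absurd h (Nat.succ_ne_zero n), fun _ => h3⟩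

lemma log_ge {β L0 : ℝ} (hβ : 0 < β) (h : β ≤ Real.exp (-L0)) : L0 ≤ -Real.log β := by
  have := Real.log_le_log hβ h
  rw [Real.log_exp] at this; linarith

set_option maxHeartbeats 1000000 in
lemma trap (n : ℕ) : ∃ Y C β0 s : ℝ, 0 < Y ∧ 0 < C ∧ 0 < β0 ∧ β0 ≤ Real.exp (-1) ∧ (s = 1 ∨ s = -1) ∧
    (∀ y, Y ≤ y → 1 ≤ |PP n y| ∧ |PD n y| ≤ |PP n y|) ∧ (∀ y, Y ≤ y → 0 < s * PP n y) ∧ (n = 0 → C * √Y ≤ 1 / 2) ∧ Good n Y C ∧ β0 ≤ Y ∧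
    ∀ β, 0 < β → β ≤ β0 → ∃ (μ : ℝ) (f : ℝ → ℝ), IsSol β μ f ∧ |μ - n| ≤ 8 / (-Real.log β) ∧
      (∀ y, Y ≤ y → 0 < s * f y) ∧ (∀ y, Y ≤ y → s * (GG β μ f y - f y / 4) ≤ 0) := by
  obtain ⟨Y, C, hY, hC, hgood, hP, hcc, hn0, hn1⟩ := setup n
  obtain ⟨s, hs, hsP⟩ := const_sign (u := PP n) (Y := Y) (PP_cont n) (fun y hy h => by
    have := (hP y hy).1; rw [h] at this; norm_num at this)
  obtain ⟨C1, hC1, hJ1⟩ := J1_est n C Y hC hY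
  obtain ⟨C2, hC2, hJ2⟩ := J2_est n C Y hC hY
  obtain ⟨L0, hL0⟩ : ∃ L0, L0 = 8 + 64 / Y + (2 + C * √Y) + (8 * C1 + C2) := ⟨_, rfl⟩
  have hsY : 0 ≤ √Y := Real.sqrt_nonneg Y
  have i1 : 0 ≤ 64 / Y := by positivity
  have i2 : 0 ≤ C * √Y := by positivity
  refine ⟨Y, C, min (min (Real.exp (-L0)) (Y ^ 2 / 8)) Y, s, hY, hC, by positivity, ?_, hs, hP, hsP, hn0, hgood, min_le_right _ _, ?_⟩
  · refine (min_le_left _ _).trans ((min_le_left _ _).trans (Real.exp_le_exp.2 ?_)); rw [hL0]; linarith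
  intro β hβ hβ0
  have hβL : β ≤ Real.exp (-L0) := hβ0.trans ((min_le_left _ _).trans (min_le_left _ _))
  have hβY : β ≤ Y ^ 2 / 8 := hβ0.trans ((min_le_left _ _).trans (min_le_right _ _))
  have hβ1 : β ≤ Real.exp (-1) := hβL.trans (Real.exp_le_exp.2 (by rw [hL0]; linarith))
  have hL := log_ge hβ hβL
  have hLs := L_sqrt hβ
  have hgood' := hgood β hβ hβ1
  have hJ1' := hJ1 β hβ hβ1
  have hJ2' := hJ2 β hβ hβ1
  obtain ⟨L, hLdef⟩ : ∃ L, L = -Real.log β := ⟨_, rfl⟩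
  rw [← hLdef] at hL hLs hgood' hJ1' hJ2' ⊢
  have hLpos : 0 < L := by linarith
  choose F hF using fun μ => exists_sol hβ μ
  have hsf : ∀ μ : ℝ, |μ - n| ≤ 8 / L → 0 < s * F μ Y := by
    intro μ hμ
    have hr := (hgood' μ hμ (F μ) (hF μ) Y hY le_rfl).1
    have hsp := hsP Y le_rfl
    have hss : s * s = 1 := by rcases hs with h | h <;> rw [h] <;> norm_num
    have habs : |s| = 1 := by rcases hs with h | h <;> rw [h] <;> norm_num
    have hr2 : |s * F μ Y - s * (1 + L * ((n:ℝ) * PP n Y))| ≤ C * √Y := by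
      rw [← mul_sub, abs_mul, habs, one_mul]; exact hr
    have hr3 := (abs_le.1 hr2).1
    rcases Nat.eq_zero_or_pos n with h0 | h0
    · have h5 := hn0 h0
      subst h0
      rw [PP_zero_fun, mul_one] at hsp
      have : s = 1 := by rcases hs with h | h; exact h; linarith
      subst this
      norm_num at hr3; norm_num; linarith
    · have h6 : (1:ℝ) ≤ n := by exact_mod_cast h0
      have h7 : 1 ≤ s * PP n Y := by
        have := (hP Y le_rfl).1
        have e : |PP n Y| = s * PP n Y := by rw [← abs_of_pos hsp, abs_mul, habs, one_mul]
        rwa [e] at this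
      have h8 : L ≤ L * (n * (s * PP n Y)) := by nlinarith [mul_nonneg (by linarith : (0:ℝ) ≤ n) (by linarith : 0 ≤ s * PP n Y - 1)]
      have h9 : -1 ≤ s := by rcases hs with h | h <;> rw [h]; norm_num
      have e : s * (1 + L * ((n:ℝ) * PP n Y)) = s + L * (n * (s * PP n Y)) := by ring
      rw [e] at hr3
      linarith
  have h8L : 0 < 8 / L := by positivity
  have hWW : ∀ μ : ℝ, |μ - n| ≤ 8 / L → |WW n β μ (F μ) Y - ((n - μ) * (cc n Y * L) + 1)| ≤ 1 := by
    intro μ hμ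
    have hR : ∀ y, 0 < y → y ≤ Y → |F μ y - (1 + L * ((n:ℝ) * PP n y))| ≤ C * √y * Real.exp (y/2) := by
      intro y hy hyY
      refine (hgood' μ hμ (F μ) (hF μ) y hy hyY).1.trans ?_
      have : 1 ≤ Real.exp (y/2) := Real.one_le_exp (by linarith)
      have h3 : 0 ≤ C * √y := by positivity
      nlinarith
    have a1 := hJ1' (F μ) (hF μ).1 Y le_rfl hR
    have a2 := hJ2' (F μ) (hF μ).1 Y le_rfl hR
    rw [WW_eq n hβ (hF μ) hY.le]
    have e : (↑n - μ) * J1 n β (F μ) Y + J2 n β (F μ) Y - ((n - μ) * (cc n Y * L) + 1) =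
      (n - μ) * (J1 n β (F μ) Y - cc n Y * L) + (J2 n β (F μ) Y - 1) := by ring
    rw [e]
    refine (abs_add_le _ _).trans ?_
    rw [abs_mul, abs_sub_comm]
    calc _ ≤ 8 / L * C1 + C2 / L := by gcongr
      _ = (8 * C1 + C2) / L := by ring
      _ ≤ 1 := by rw [div_le_one hLpos]; linarith
  have m1 : |((n:ℝ) - 8 / L) - n| ≤ 8 / L := by rw [sub_sub_cancel_left, abs_neg, abs_of_pos h8L]
  have m2 : |((n:ℝ) + 8 / L) - n| ≤ 8 / L := by rw [add_sub_cancel_left, abs_of_pos h8L]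
  have eL : 8 / L * (cc n Y * L) = 8 * cc n Y := by field_simp
  have hsβ : √β ≤ Y := by
    apply Real.sqrt_le_iff.2; exact ⟨hY.le, by nlinarith [sq_nonneg Y]⟩
  have hβ2 : √β * √β = β := Real.mul_self_sqrt hβ.le
  have h4β : 4 * β / Y ≤ 8 / L := by
    rw [div_le_div_iff₀ hY hLpos]
    have : √β * (L * √β) ≤ Y * 2 := by
      have := Real.sqrt_nonneg β
      gcongr
    nlinarith
  have hup : (n:ℝ) + 8 / L ≤ Y / 8 := by
    rcases Nat.eq_zero_or_pos n with h0 | h0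
    · rw [h0]
      have : 64 / Y ≤ L := by linarith
      rw [div_le_iff₀ hY] at this
      rw [Nat.cast_zero, zero_add, div_le_div_iff₀ hLpos (by norm_num)]; linarith
    · have h3 := hn1 (by omega)
      have : 8 / L ≤ 1 := by rw [div_le_one hLpos]; linarith
      linarith
  obtain ⟨μ, hm, ht⟩ := trap_exists hβ hY hs F hF (by linarith : (n:ℝ) - 8 / L ≤ n + 8 / L) hup
    (by rw [div_le_iff₀ (by positivity)]; linarith)
    (endpoint_minus n hβ (hF _) hY hP hs hsP (by linarith) (hsf _ m1) (by
      have := (abs_le.1 (hWW _ m1)).1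
      rw [sub_sub_cancel, eL] at this
      linarith))
    (endpoint_plus n hβ (hF _) hY hP hs hsP (by linarith) (hsf _ m2) (by
      have := (abs_le.1 (hWW _ m2)).2
      rw [sub_add_cancel_left, neg_mul, eL] at this
      linarith))
  have hμn : |μ - n| ≤ 8 / L := by rw [abs_le]; constructor <;> linarith [hm.1, hm.2]
  have hne := trapped_ne hβ (hF μ) hY ht
  have hsf' := hsf μ hμn
  obtain ⟨s', hs', hp⟩ := const_sign (u := F μ) (Y := Y) (hF μ).1 hne
  have hpos : ∀ y, Y ≤ y → 0 < s * F μ y := by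
    have h0 := hp Y le_rfl
    have : s' = s := by
      rcases hs with h | h <;> rcases hs' with h' | h' <;> subst h <;> subst h' <;> first | rfl | (exfalso; linarith)
    rw [← this]; exact hp
  refine ⟨μ, F μ, hF μ, hμn, hpos, fun y hy => ?_⟩
  have h1 := ht y hy
  have h2 := hpos y hy
  have hss : s * s = 1 := by rcases hs with h | h <;> rw [h] <;> norm_num
  by_contra hh; push Not at hh
  have := mul_pos h2 hh
  have e : (s * F μ y) * (s * (GG β μ (F μ) y - F μ y / 4)) = (s * s) * (F μ y * (GG β μ (F μ) y - F μ y / 4)) := by ring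
  rw [e, hss] at this; linarith

lemma exp5 (y : ℝ) : Real.exp (-y) * Real.exp (y/4) * Real.exp (1/8 * y) = Real.exp (-(5/8 * y)) := by
  rw [← Real.exp_add, ← Real.exp_add]; ring_nf

lemma den_bd (n : ℕ) {β y CP : ℝ} (hβ : 0 < β) (hy0 : 0 < y) (hb : |PP n y| ≤ CP * Real.exp (1/8 * y)) :
    wt β y * PP n y ^ 2 ≤ CP ^ 2 * Real.exp (-(3/4 * y)) := by
  have hw := wt_pos hβ hy0
  have hp2 : PP n y ^ 2 ≤ CP ^ 2 * Real.exp (1/4 * y) := by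
    rw [← sq_abs]
    calc |PP n y| ^ 2 ≤ (CP * Real.exp (1/8 * y)) ^ 2 := by gcongr
      _ = CP ^ 2 * Real.exp (1/4 * y) := by rw [mul_pow, ← Real.exp_nat_mul]; ring_nf
  calc _ ≤ Real.exp (-y) * (CP ^ 2 * Real.exp (1/4 * y)) := by
        gcongr; exact wt_le hβ hy0
    _ = CP ^ 2 * (Real.exp (-y) * Real.exp (1/4 * y)) := by ring
    _ = _ := by rw [← Real.exp_add]; ring_nf

set_option maxHeartbeats 1000000 in
lemma tail_est (n : ℕ) {Y C s : ℝ} (hY : 0 < Y) (hC : 0 < C) (hs : s = 1 ∨ s = -1)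
    (hP : ∀ y, Y ≤ y → 1 ≤ |PP n y| ∧ |PD n y| ≤ |PP n y|) : ∃ K, 0 < K ∧
    ∀ β, 0 < β → β ≤ Real.exp (-1) → β ≤ Y → ∀ (μ : ℝ) (f : ℝ → ℝ), IsSol β μ f → |μ - n| ≤ 8 / (-Real.log β) →
      (∀ y, Y ≤ y → 0 < s * f y) → (∀ y, Y ≤ y → s * (GG β μ f y - f y / 4) ≤ 0) →
      (∀ y, 0 < y → y ≤ Y → |f y - (1 + (-Real.log β) * ((n:ℝ) * PP n y))| ≤ C * √y) →
      (∀ y, Y ≤ y → |WW n β μ f y| ≤ K * Real.exp (-(5/8 * y))) ∧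
      (∀ y, 0 < y → |f y - (1 + (-Real.log β) * ((n:ℝ) * PP n y))| ≤ K * √y * Real.exp (y/2)) := by
  obtain ⟨CP, hCP, hCb'⟩ := poly_exp_bd (pp n) (ε := 1/8) (by norm_num)
  have hCb : ∀ y, 0 ≤ y → |PP n y| ≤ CP * Real.exp (1/8 * y) := hCb'
  have habs : |s| = 1 := by rcases hs with h | h <;> rw [h] <;> norm_num
  have hsY : 0 < √Y := Real.sqrt_pos.2 hY
  obtain ⟨K1, hK1⟩ : ∃ K1, K1 = 1 + n * |PP n Y| + C * √Y := ⟨_, rfl⟩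
  have pK1 : 0 < K1 := by rw [hK1]; positivity
  obtain ⟨K2, hK2⟩ : ∃ K2, K2 = 8 + 8 / Y := ⟨_, rfl⟩
  have pK2 : 0 < K2 := by rw [hK2]; positivity
  obtain ⟨K3, hK3⟩ : ∃ K3, K3 = K1 * K2 * CP / Y := ⟨_, rfl⟩
  have pK3 : 0 < K3 := by rw [hK3]; positivity
  obtain ⟨K4, hK4⟩ : ∃ K4, K4 = 8 / 5 * K3 := ⟨_, rfl⟩
  have pK4 : 0 < K4 := by rw [hK4]; positivity
  obtain ⟨K5, hK5⟩ : ∃ K5, K5 = CP * (32 / 3 * K4 + (1 + C * √Y)) + 1 := ⟨_, rfl⟩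
  have pK5 : 0 < K5 := by rw [hK5]; positivity
  refine ⟨K4 + C + K5 / √Y, by positivity, ?_⟩
  intro β hβ hβ1 hβY μ f hf hμ hsf hsd hR
  obtain ⟨b1, b2, b3⟩ := L_bds hβ hβ1
  obtain ⟨L, hL⟩ : ∃ L, L = -Real.log β := ⟨_, rfl⟩
  rw [← hL] at hR b1 b2 b3 hμ ⊢
  have hL0 : 0 < L := by linarith
  have hfabs : ∀ y, Y ≤ y → |f y| = s * f y := by
    intro y hy
    rw [← abs_of_pos (hsf y hy), abs_mul, habs, one_mul]
  have hfY : |f Y| ≤ K1 * L := by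
    have h1 := hR Y hY le_rfl
    have e : f Y = (f Y - (1 + L * (n * PP n Y))) + 1 + L * (n * PP n Y) := by ring
    rw [e]
    refine (abs_add_le _ _).trans ((add_le_add (abs_add_le _ _) le_rfl).trans ?_)
    rw [abs_one, abs_mul, abs_mul, abs_of_pos hL0, abs_of_nonneg (Nat.cast_nonneg n : (0:ℝ) ≤ (n:ℝ)), hK1]
    have : 0 ≤ C * √Y := by positivity
    nlinarith
  have hPne : ∀ y, Y ≤ y → PP n y ≠ 0 := fun y hy h => by have := (hP y hy).1; rw [h] at this; norm_num at this
  have hfb : ∀ y, Y ≤ y → |f y| ≤ K1 * L * Real.exp (y/4) := by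
    intro y hy
    have := trapped_growth hβ hf hY hsf hsd y hy
    rw [← hfabs y hy, ← hfabs Y le_rfl] at this
    exact this.trans (by gcongr)
  have hW' : ∀ y, Y ≤ y → |m0 β y * f y * ((n - μ) * PP n y + 2 * β / (β + y) * (PP n y - PD n y))| ≤ K3 * Real.exp (-(5/8 * y)) := by
    intro y hy
    have hy0 : 0 < y := by linarith
    have hm : m0 β y ≤ Real.exp (-y) / Y := by
      rw [le_div_iff₀ hY]
      exact le_trans (by have := m0_nonneg hβ hy0.le; gcongr) (m0_le hβ hy0)
    have h1 : |(n - μ) * PP n y + 2 * β / (β + y) * (PP n y - PD n y)| ≤ K2 / L * |PP n y| := by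
      refine (abs_add_le _ _).trans ?_
      rw [abs_mul, abs_mul, abs_sub_comm, abs_of_nonneg (by positivity : 0 ≤ 2 * β / (β + y))]
      have h2 : |PP n y - PD n y| ≤ 2 * |PP n y| := (abs_sub _ _).trans (by linarith [(hP y hy).2])
      have h3 : 2 * β / (β + y) ≤ 2 * (2 / L) / Y := by gcongr; linarith
      calc _ ≤ 8 / L * |PP n y| + 2 * (2 / L) / Y * (2 * |PP n y|) := by gcongr
        _ = _ := by rw [hK2]; field_simp; ring
    rw [abs_mul, abs_mul, abs_of_nonneg (m0_nonneg hβ hy0.le)]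
    calc _ ≤ Real.exp (-y) / Y * (K1 * L * Real.exp (y/4)) * (K2 / L * (CP * Real.exp (1/8 * y))) := by
          gcongr
          · exact hfb y hy
          · exact h1.trans (by gcongr; exact hCb y hy0.le)
      _ = K3 * (Real.exp (-y) * Real.exp (y/4) * Real.exp (1/8 * y)) := by rw [hK3]; field_simp
      _ = _ := by rw [exp5]
  -- bound for W
  have hWone : ∀ σ : ℝ, |σ| = 1 → ∀ y, Y ≤ y → σ * WW n β μ f y ≤ K4 * Real.exp (-(5/8 * y)) := by
    intro σ hσ y0 hy0
    by_contra hcon; push Not at hcon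
    have hmono : ∀ y, y0 ≤ y → σ * WW n β μ f y0 - K4 * Real.exp (-(5/8 * y0)) ≤ σ * WW n β μ f y - K4 * Real.exp (-(5/8 * y)) := by
      intro y hy
      refine mono_of_deriv (u := fun y => σ * WW n β μ f y - K4 * Real.exp (-(5/8 * y)))
        (u' := fun y => σ * (m0 β y * f y * ((n - μ) * PP n y + 2 * β / (β + y) * (PP n y - PD n y))) + K3 * Real.exp (-(5/8 * y))) hy ?_ ?_
      · intro z hz _
        have hz0 : 0 < z := by linarith
        have hh : HasDerivAt (fun t : ℝ => Real.exp (-(5/8 * t))) (Real.exp (-(5/8 * z)) * (-(5/8 * 1))) z :=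
          (((hasDerivAt_id' z).const_mul (5/8:ℝ)).neg).exp
        refine (((WW_hasDeriv n hβ hf hz0).const_mul σ).sub (hh.const_mul K4)).congr_deriv ?_
        rw [hK4]; ring
      · intro z hz _
        have h1 := hW' z (by linarith)
        have h2 : |σ * (m0 β z * f z * ((n - μ) * PP n z + 2 * β / (β + z) * (PP n z - PD n z)))| ≤ K3 * Real.exp (-(5/8 * z)) := by
          rw [abs_mul, hσ, one_mul]; exact h1
        linarith [(abs_le.1 h2).1]
    set δ := σ * WW n β μ f y0 - K4 * Real.exp (-(5/8 * y0)) with hδ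
    have hδ0 : 0 < δ := by linarith
    refine growG (q := fun y => σ * (f y / PP n y)) (Y := y0) (c := δ / CP ^ 2) (C := K1 * L) (by positivity)
      (fun y hy => (quot_hasDeriv n hβ hf (by linarith) (hPne y (by linarith))).const_mul σ) ?_ ?_
    · intro y hy
      have hyp : 0 < y := by linarith
      have hw := wt_pos hβ hyp
      have hPn := hPne y (by linarith)
      have h1 := hmono y hy
      have h2 : 0 < K4 * Real.exp (-(5/8 * y)) := by positivity
      have h3 : δ ≤ σ * WW n β μ f y := by linarith
      have h4 : 0 ≤ σ * WW n β μ f y := by linarith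
      calc δ / CP ^ 2 * Real.exp (3 / 4 * y) = δ / (CP ^ 2 * Real.exp (-(3/4 * y))) := by rw [Real.exp_neg]; field_simp
        _ ≤ σ * WW n β μ f y / (wt β y * PP n y ^ 2) := by
          have := den_bd n hβ hyp (hCb y hyp.le)
          gcongr
        _ = _ := by ring
    · intro y hy
      refine (le_abs_self _).trans ?_
      rw [abs_mul, hσ, one_mul, abs_div]
      exact (div_le_self (abs_nonneg _) (hP y (by linarith)).1).trans (hfb y (by linarith))
  have hWb : ∀ y, Y ≤ y → |WW n β μ f y| ≤ K4 * Real.exp (-(5/8 * y)) := by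
    intro y hy
    rw [abs_le]
    have a := hWone 1 (by norm_num) y hy
    have b := hWone (-1) (by norm_num) y hy
    constructor <;> linarith
  refine ⟨fun y hy => (hWb y hy).trans ?_, ?_⟩
  · have : 0 ≤ C + K5 / √Y := by positivity
    gcongr; linarith
  intro y hy
  have hey : 1 ≤ Real.exp (y/2) := Real.one_le_exp (by linarith)
  rcases le_total y Y with hyY | hyY
  · refine (hR y hy hyY).trans ?_
    calc C * √y = C * √y * 1 := by ring
      _ ≤ _ := by
        gcongr
        have : 0 ≤ K4 + K5 / √Y := by positivity
        linarith
  · have hq := cmp_deriv (R := fun y => f y / PP n y) (R' := fun y => WW n β μ f y / (wt β y * PP n y ^ 2))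
      (H := fun y => 32 / 3 * K4 * Real.exp (3/8 * y)) (H' := fun y => 4 * K4 * Real.exp (3/8 * y)) hyY
      (fun z hz => (quot_hasDeriv n hβ hf (by linarith [hz.1]) (hPne z hz.1)).continuousAt.continuousWithinAt)
      (by fun_prop) (fun z hz _ => quot_hasDeriv n hβ hf (by linarith) (hPne z hz.le))
      (fun z hz _ => by
        refine ((((hasDerivAt_id' z).const_mul (3/8:ℝ)).exp).const_mul (32 / 3 * K4)).congr_deriv ?_
        ring)
      (by
        intro z hz _
        have hz0 : 0 < z := by linarith
        have hw : Real.exp (-z) / 4 ≤ wt β z := by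
          rw [wt, abs_of_pos hz0, div_le_div_iff₀ (by norm_num) (by positivity)]
          have : (β + z) ^ 2 ≤ z ^ 2 * 4 := by nlinarith
          have h2 := Real.exp_pos (-z)
          nlinarith
        have hp2 : 1 ≤ PP n z ^ 2 := by
          rw [← sq_abs]; nlinarith [(hP z hz.le).1]
        have hden : Real.exp (-z) / 4 ≤ wt β z * PP n z ^ 2 := by
          have h2 := Real.exp_pos (-z)
          nlinarith
        have h2 := Real.exp_pos (-z)
        rw [abs_div, abs_of_pos (by linarith : 0 < wt β z * PP n z ^ 2)]
        calc _ ≤ K4 * Real.exp (-(5/8 * z)) / (Real.exp (-z) / 4) := by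
              gcongr; exact hWb z hz.le
          _ = 4 * K4 * (Real.exp (-(5/8 * z)) / Real.exp (-z)) := by field_simp
          _ = _ := by rw [← Real.exp_sub]; ring_nf)
    have hqY : |f Y / PP n Y - L * n| ≤ 1 + C * √Y := by
      have hPY := hPne Y le_rfl
      have e : f Y / PP n Y - L * n = (f Y - L * (n * PP n Y)) / PP n Y := by field_simp
      rw [e, abs_div]
      refine (div_le_self (abs_nonneg _) (hP Y le_rfl).1).trans ?_
      have e2 : f Y - L * (n * PP n Y) = 1 + (f Y - (1 + L * (n * PP n Y))) := by ring
      rw [e2]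
      refine (abs_add_le _ _).trans ?_
      rw [abs_one]
      have := hR Y hY le_rfl
      linarith
    have hPy := hPne y hyY
    have e : f y - (1 + L * (n * PP n y)) = PP n y * ((f y / PP n y - f Y / PP n Y) + (f Y / PP n Y - L * n)) - 1 := by
      have : PP n y * (f y / PP n y) = f y := by field_simp
      linear_combination -this
    have hb := hCb y hy.le
    have hq2 : |f y / PP n y - f Y / PP n Y| ≤ 32 / 3 * K4 * Real.exp (3/8 * y) := by
      refine hq.trans ?_
      have : 0 < 32 / 3 * K4 * Real.exp (3/8 * Y) := by positivity
      linarith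
    have hsy : √Y ≤ √y := Real.sqrt_le_sqrt hyY
    have h38 : 1 ≤ Real.exp (3/8 * y) := Real.one_le_exp (by linarith)
    rw [e]
    refine (abs_sub _ _).trans ?_
    rw [abs_mul, abs_one]
    calc _ ≤ CP * Real.exp (1/8 * y) * (32 / 3 * K4 * Real.exp (3/8 * y) + (1 + C * √Y) * Real.exp (3/8 * y)) + 1 * Real.exp (y/2) := by
          gcongr
          · refine (abs_add_le _ _).trans (add_le_add hq2 (hqY.trans ?_))
            have : 0 ≤ 1 + C * √Y := by positivity
            nlinarith
          · linarith
      _ = CP * (32 / 3 * K4 + (1 + C * √Y)) * (Real.exp (1/8 * y) * Real.exp (3/8 * y)) + 1 * Real.exp (y/2) := by ring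
      _ = K5 * Real.exp (y/2) := by rw [← Real.exp_add, hK5]; ring_nf
      _ = K5 / √Y * √Y * Real.exp (y/2) := by field_simp
      _ ≤ _ := by
        gcongr
        linarith

lemma mu_asymp (n : ℕ) {Y C s : ℝ} (hY : 0 < Y) (hC : 0 < C) (hs : s = 1 ∨ s = -1)
    (hP : ∀ y, Y ≤ y → 1 ≤ |PP n y| ∧ |PD n y| ≤ |PP n y|) : ∃ K, 0 < K ∧
    ∀ β, 0 < β → β ≤ Real.exp (-1) → β ≤ Y → ∀ (μ : ℝ) (f : ℝ → ℝ), IsSol β μ f → |μ - n| ≤ 8 / (-Real.log β) →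
      (∀ y, Y ≤ y → 0 < s * f y) → (∀ y, Y ≤ y → s * (GG β μ f y - f y / 4) ≤ 0) →
      (∀ y, 0 < y → y ≤ Y → |f y - (1 + (-Real.log β) * ((n:ℝ) * PP n y))| ≤ C * √y) →
      |μ - n - 1 / (-Real.log β)| ≤ K / (-Real.log β) ^ 2 := by
  obtain ⟨K, hK, hmain⟩ := tail_est n hY hC hs hP
  obtain ⟨C1, hC1, hJ1⟩ := J1_est n K Y hK hY
  obtain ⟨C2, hC2, hJ2⟩ := J2_est n K Y hK hY
  refine ⟨8 * C1 + C2, by positivity, ?_⟩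
  intro β hβ hβ1 hβY μ f hf hμ hsf hsd hR
  obtain ⟨h1, h2⟩ := hmain β hβ hβ1 hβY μ f hf hμ hsf hsd hR
  obtain ⟨b1, b2, b3⟩ := L_bds hβ hβ1
  have hJ1' := hJ1 β hβ hβ1 f hf.1
  have hJ2' := hJ2 β hβ hβ1 f hf.1
  obtain ⟨L, hL⟩ : ∃ L, L = -Real.log β := ⟨_, rfl⟩
  rw [← hL] at hR b1 b2 b3 hμ h2 hJ1' hJ2' ⊢
  have hL0 : 0 < L := by linarith
  have key : ∀ T, Y ≤ T → |(n - μ) * (cc n T * L) + 1| ≤ K * Real.exp (-(5/8 * T)) + (8 * C1 + C2) / L := by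
    intro T hT
    have a1 := hJ1' T hT (fun y hy _ => h2 y hy)
    have a2 := hJ2' T hT (fun y hy _ => h2 y hy)
    have a3 := h1 T hT
    rw [WW_eq n hβ hf (by linarith)] at a3
    have e : (n - μ) * (cc n T * L) + 1 = ((↑n - μ) * J1 n β f T + J2 n β f T) - (n - μ) * (J1 n β f T - cc n T * L) - (J2 n β f T - 1) := by ring
    rw [e]
    refine (abs_sub _ _).trans ((add_le_add (abs_sub _ _) le_rfl).trans ?_)
    rw [abs_mul, abs_sub_comm (n:ℝ) μ]
    calc _ ≤ K * Real.exp (-(5/8 * T)) + 8 / L * C1 + C2 / L := by gcongr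
      _ = _ := by ring
  have lim1 : Filter.Tendsto (fun T => |(n - μ) * (cc n T * L) + 1|) Filter.atTop (nhds |(n - μ) * (1 * L) + 1|) :=
    ((((cc_tendsto n).mul_const L).const_mul _).add_const 1).abs
  have lim2 : Filter.Tendsto (fun T => K * Real.exp (-(5/8 * T)) + (8 * C1 + C2) / L) Filter.atTop (nhds (K * 0 + (8 * C1 + C2) / L)) := by
    apply Filter.Tendsto.add_const
    apply Filter.Tendsto.const_mul
    apply Real.tendsto_exp_neg_atTop_nhds_zero.comp
    exact Filter.tendsto_id.const_mul_atTop (by norm_num)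
  have h3 := le_of_tendsto_of_tendsto lim1 lim2 (by
    filter_upwards [Filter.eventually_ge_atTop Y] with T hT using key T hT)
  rw [mul_zero, zero_add, one_mul] at h3
  have e : μ - n - 1 / L = -((n - μ) * L + 1) / L := by field_simp; ring
  rw [e, abs_div, abs_neg, abs_of_pos hL0, div_le_div_iff₀ hL0 (by positivity)]
  rw [le_div_iff₀ hL0] at h3
  nlinarith

lemma uniq_zero {v v' : ℝ → ℝ} {a b : ℝ} (hab : a < b) (hv : ∀ y, a ≤ y → y ≤ b → HasDerivAt v (v' y) y)
    (hp : ∀ y, a ≤ y → y ≤ b → 0 < v' y) (ha : v a < 0) (hb : 0 < v b) :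
    ∃ z, a < z ∧ z < b ∧ v z = 0 ∧ ∀ y, a ≤ y → y ≤ b → v y = 0 → y = z := by
  have hc : ContinuousOn v (Icc a b) := fun y hy => (hv y hy.1 hy.2).continuousAt.continuousWithinAt
  have hm : StrictMonoOn v (Icc a b) := by
    apply strictMonoOn_of_deriv_pos (convex_Icc a b) hc
    intro y hy
    rw [interior_Icc] at hy
    rw [(hv y hy.1.le hy.2.le).deriv]
    exact hp y hy.1.le hy.2.le
  obtain ⟨z, hz, hz0⟩ := intermediate_value_Icc hab.le hc ⟨ha.le, hb.le⟩
  refine ⟨z, lt_of_le_of_ne hz.1 (fun h => ?_), lt_of_le_of_ne hz.2 (fun h => ?_), hz0, fun y h1 h2 h3 => ?_⟩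
  · subst h; linarith
  · subst h; linarith
  · exact hm.injOn ⟨h1, h2⟩ hz (h3.trans hz0.symm)

lemma stab {P p : ℝ → ℝ} {a b : ℝ} (hP : ∀ y, HasDerivAt P (p y) y) (hp : Continuous p) (t : Finset ℝ)
    (ht : ∀ x ∈ t, a < x ∧ x < b ∧ P x = 0 ∧ p x ≠ 0) (ht' : ∀ y, a ≤ y → y ≤ b → P y = 0 → y ∈ t) :
    ∃ ε, 0 < ε ∧ ∀ u u' : ℝ → ℝ, (∀ y, a ≤ y → y ≤ b → HasDerivAt u (u' y) y ∧ |u y - P y| ≤ ε ∧ |u' y - p y| ≤ ε) →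
      {y | a ≤ y ∧ y ≤ b ∧ u y = 0}.Finite ∧ {y | a ≤ y ∧ y ≤ b ∧ u y = 0}.ncard = t.card := by
  have hPc : Continuous P := continuous_iff_continuousAt.2 fun y => (hP y).continuousAt
  -- radius
  have e1 : ∀ x ∈ t, ∀ᶠ ρ in nhdsWithin (0:ℝ) (Ioi 0), ∀ y, |y - x| ≤ ρ → a < y ∧ y < b ∧ p x ^ 2 / 2 < p x * p y := by
    intro x hx
    obtain ⟨h1, h2, h3, h4⟩ := ht x hx
    have hpos : 0 < p x ^ 2 := by positivity
    have hev : ∀ᶠ y in nhds x, a < y ∧ y < b ∧ p x ^ 2 / 2 < p x * p y := by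
      refine (lt_mem_nhds h1).and ((gt_mem_nhds h2).and ?_)
      have : Continuous (fun y => p x * p y) := by fun_prop
      exact (this.tendsto x).eventually_const_lt (by nlinarith)
    obtain ⟨r, hr, hr'⟩ := Metric.eventually_nhds_iff.1 hev
    filter_upwards [Ioo_mem_nhdsGT hr] with ρ hρ y hy
    exact hr' (by rw [Real.dist_eq]; exact lt_of_le_of_lt hy hρ.2)
  have e2 : ∀ x ∈ t, ∀ᶠ ρ in nhdsWithin (0:ℝ) (Ioi 0), ∀ x' ∈ t, x' ≠ x → 2 * ρ < |x' - x| := by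
    intro x hx
    rw [Filter.eventually_all_finset]
    intro x' hx'
    by_cases h : x' = x
    · exact Filter.Eventually.of_forall fun ρ hne => absurd h hne
    · have : 0 < |x' - x| := abs_pos.2 (sub_ne_zero.2 h)
      filter_upwards [Ioo_mem_nhdsGT (half_pos this)] with ρ hρ _
      linarith [hρ.2]
  obtain ⟨ρ, hρ1, hρ2, hρ⟩ := (((Filter.eventually_all_finset t).2 e1).and (((Filter.eventually_all_finset t).2 e2).and self_mem_nhdsWithin)).exists
  have hρ0 : 0 < ρ := hρ
  -- lower bound off the balls
  obtain ⟨m, hm, hmK⟩ : ∃ m, 0 < m ∧ ∀ y, a ≤ y → y ≤ b → (∀ x ∈ t, ρ ≤ |y - x|) → m ≤ |P y| := by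
    have hK : IsCompact (Icc a b ∩ ⋂ x ∈ t, {y | ρ ≤ |y - x|}) := by
      apply isCompact_Icc.inter_right
      exact isClosed_biInter fun x _ => isClosed_le continuous_const (by fun_prop)
    rcases (Icc a b ∩ ⋂ x ∈ t, {y | ρ ≤ |y - x|}).eq_empty_or_nonempty with he | hne
    · refine ⟨1, one_pos, fun y h1 h2 h3 => ?_⟩
      have : y ∈ (Icc a b ∩ ⋂ x ∈ t, {y | ρ ≤ |y - x|}) := ⟨⟨h1, h2⟩, by simpa using h3⟩
      rw [he] at this; exact absurd this (by simp)
    · obtain ⟨y0, hy0, hmin⟩ := hK.exists_isMinOn hne (hPc.abs).continuousOn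
      refine ⟨|P y0|, abs_pos.2 fun h => ?_, fun y h1 h2 h3 => ?_⟩
      · have hy0t := ht' y0 hy0.1.1 hy0.1.2 h
        have := hy0.2
        simp only [mem_iInter] at this
        have h9 := this y0 hy0t
        have h9' : ρ ≤ |y0 - y0| := h9
        rw [sub_self, abs_zero] at h9'; linarith
      · exact hmin (show y ∈ _ from ⟨⟨h1, h2⟩, by simpa using h3⟩)
  have e3 : ∀ᶠ ε in nhdsWithin (0:ℝ) (Ioi 0), ∀ x ∈ t, ε < |p x| / 2 := by
    rw [Filter.eventually_all_finset]
    intro x hx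
    have : 0 < |p x| := abs_pos.2 (ht x hx).2.2.2
    filter_upwards [Ioo_mem_nhdsGT (half_pos this)] with ε hε
    exact hε.2
  obtain ⟨ε, hε1, hε2, hε⟩ := (e3.and ((show ∀ᶠ ε in nhdsWithin (0:ℝ) (Ioi 0), ε ∈ Ioo 0 m from Ioo_mem_nhdsGT hm).and self_mem_nhdsWithin)).exists
  have hε0 : 0 < ε := hε
  have hεm : ε < m := hε2.2
  refine ⟨ε, hε0, ?_⟩
  intro u u' hu
  have off : ∀ y, a ≤ y → y ≤ b → (∀ x ∈ t, ρ ≤ |y - x|) → u y ≠ 0 := by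
    intro y h1 h2 h3 h0
    have h4 := hmK y h1 h2 h3
    have h5 := (hu y h1 h2).2.1
    rw [h0, zero_sub, abs_neg] at h5; linarith
  have one : ∀ x ∈ t, ∃ z, x - ρ < z ∧ z < x + ρ ∧ u z = 0 ∧ ∀ y, x - ρ ≤ y → y ≤ x + ρ → u y = 0 → y = z := by
    intro x hx
    obtain ⟨q1, q2, q3, q4⟩ := ht x hx
    have hin : ∀ y, x - ρ ≤ y → y ≤ x + ρ → a < y ∧ y < b ∧ p x ^ 2 / 2 < p x * p y := fun y h1 h2 =>
      hρ1 x hx y (abs_le.2 ⟨by linarith, by linarith⟩)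
    have hpx : 0 < |p x| := abs_pos.2 q4
    -- P at endpoints
    have key : ∀ y, x - ρ ≤ y → y ≤ x + ρ → 0 < p x * u' y := by
      intro y h1 h2
      obtain ⟨i1, i2, i3⟩ := hin y h1 h2
      have h5 := (hu y i1.le i2.le).2.2
      have h6 : |p x * (u' y - p y)| ≤ |p x| * ε := by rw [abs_mul]; gcongr
      have h7 := (abs_le.1 h6).1
      have h8 : |p x| * ε < p x ^ 2 / 2 := by
        have := hε1 x hx
        have := mul_lt_mul_of_pos_left this hpx
        rw [← sq_abs]; nlinarith
      nlinarith
    have mono : ∀ c d, x - ρ ≤ c → c < d → d ≤ x + ρ → p x * P c < p x * P d := by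
      intro c d h1 h2 h3
      have hm : StrictMonoOn (fun y => p x * P y) (Icc (x - ρ) (x + ρ)) := by
        apply strictMonoOn_of_deriv_pos (convex_Icc _ _) (by fun_prop)
        intro y hy
        rw [interior_Icc] at hy
        rw [((hP y).const_mul (p x)).deriv]
        have := (hin y hy.1.le hy.2.le).2.2
        have : 0 ≤ p x ^ 2 := by positivity
        linarith
      exact hm ⟨h1, by linarith⟩ ⟨by linarith, h3⟩ h2
    have sep : ∀ y, |y - x| = ρ → ∀ x' ∈ t, ρ ≤ |y - x'| := by
      intro y hy x' hx'
      by_cases h : x' = x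
      · rw [h, hy]
      · have h1 := hρ2 x hx x' hx' h
        have h2 := abs_sub_le x' y x
        rw [abs_sub_comm x' y] at h2
        linarith
    have hbd : ∀ y, |y - x| = ρ → a ≤ y → y ≤ b → |p x * (u y - P y)| < |p x * P y| := by
      intro y hy h1 h2
      rw [abs_mul, abs_mul]
      apply mul_lt_mul_of_pos_left _ hpx
      have := hmK y h1 h2 (sep y hy)
      have := (hu y h1 h2).2.1
      linarith
    have hl : p x * u (x - ρ) < 0 := by
      have i := hin (x - ρ) le_rfl (by linarith)
      have h1 := hbd (x - ρ) (by rw [show x - ρ - x = -ρ by ring, abs_neg, abs_of_pos hρ0]) i.1.le i.2.1.le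
      have h2 := mono (x - ρ) x le_rfl (by linarith) (by linarith)
      rw [q3, mul_zero] at h2
      rw [abs_of_neg h2] at h1
      have := (abs_lt.1 h1).2
      linarith
    have hr : 0 < p x * u (x + ρ) := by
      have i := hin (x + ρ) (by linarith) le_rfl
      have h1 := hbd (x + ρ) (by rw [show x + ρ - x = ρ by ring, abs_of_pos hρ0]) i.1.le i.2.1.le
      have h2 := mono x (x + ρ) (by linarith) (by linarith) le_rfl
      rw [q3, mul_zero] at h2
      rw [abs_of_pos h2] at h1
      have := (abs_lt.1 h1).1
      linarith
    obtain ⟨z, z1, z2, z3, z4⟩ := uniq_zero (v := fun y => p x * u y) (v' := fun y => p x * u' y) (a := x - ρ) (b := x + ρ) (by linarith)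
      (fun y h1 h2 => ((hu y (hin y h1 h2).1.le (hin y h1 h2).2.1.le).1).const_mul (p x)) key hl hr
    refine ⟨z, z1, z2, (mul_eq_zero.1 z3).resolve_left q4, fun y h1 h2 h3 => z4 y h1 h2 (by simp [h3])⟩
  choose! zf hz1 hz2 hz3 hz4 using one
  have himg : {y | a ≤ y ∧ y ≤ b ∧ u y = 0} = (t.image zf : Finset ℝ) := by
    ext y
    simp only [mem_ofPred_eq, Finset.coe_image, mem_image, Finset.mem_coe]
    constructor
    · rintro ⟨h1, h2, h3⟩
      by_contra hcon
      refine off y h1 h2 (fun x hx => ?_) h3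
      by_contra hlt
      push Not at hlt
      have := abs_lt.1 hlt
      exact hcon ⟨x, hx, (hz4 x hx y (by linarith) (by linarith) h3).symm⟩
    · rintro ⟨x, hx, rfl⟩
      have := hρ1 x hx (zf x) (abs_le.2 ⟨by linarith [hz1 x hx], by linarith [hz2 x hx]⟩)
      exact ⟨this.1.le, this.2.1.le, hz3 x hx⟩
  rw [himg]
  refine ⟨Finset.finite_toSet _, ?_⟩
  rw [Set.ncard_coe_finset, Finset.card_image_of_injOn]
  intro x hx x' hx' h
  by_contra hne
  have h1 := hρ2 x' hx' x hx hne
  have h2 := hz1 x hx; have h3 := hz2 x hx; have h4 := hz1 x' hx'; have h5 := hz2 x' hx'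
  rw [h] at h2 h3
  have : |x - x'| ≤ 2 * ρ := abs_le.2 ⟨by linarith, by linarith⟩
  linarith

lemma zeros_zero {Y C β s : ℝ} {f : ℝ → ℝ} (hC : 0 < C) (hCY : C * √Y ≤ 1 / 2)
    (hR : ∀ y, 0 < y → y ≤ Y → |f y - (1 + (-Real.log β) * (((0:ℕ):ℝ) * PP 0 y))| ≤ C * √y)
    (hs : ∀ y, Y ≤ y → 0 < s * f y) : {y | 0 < y ∧ f y = 0} = ∅ := by
  ext y
  simp only [mem_ofPred_eq, mem_empty_iff_false, iff_false, not_and]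
  intro hy h0
  rcases le_total y Y with h | h
  · have h1 := hR y hy h
    rw [h0] at h1
    have h2 : C * √y ≤ C * √Y := by gcongr
    norm_num at h1
    linarith
  · have := hs y h; rw [h0] at this; simp at this

set_option maxHeartbeats 1000000 in
lemma zeros_succ (n : ℕ) {Y C s : ℝ} (hY : 0 < Y) (hC : 0 < C)
    (hP : ∀ y, Y ≤ y → 1 ≤ |PP (n+1) y| ∧ |PD (n+1) y| ≤ |PP (n+1) y|) (hG : Good (n+1) Y C) :
    ∃ L0 : ℝ, ∀ β, 0 < β → β ≤ Real.exp (-1) → L0 ≤ -Real.log β → ∀ (μ : ℝ) (f : ℝ → ℝ), IsSol β μ f →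
      |μ - (n+1 : ℕ)| ≤ 8 / (-Real.log β) → (∀ y, Y ≤ y → 0 < s * f y) →
      {y | 0 < y ∧ f y = 0}.Finite ∧ {y | 0 < y ∧ f y = 0}.ncard = n + 1 := by
  obtain ⟨t, htc, ht⟩ := pp_roots n
  -- δ
  obtain ⟨δ, hδ, hδY, hPD⟩ : ∃ δ, 0 < δ ∧ δ ≤ Y ∧ ∀ y, 0 ≤ y → y ≤ δ → PD (n+1) y ≤ -1/2 := by
    have hev : ∀ᶠ y in nhds (0:ℝ), PD (n+1) y < -1/2 :=
      ((PD_cont (n+1)).tendsto 0).eventually_lt_const (by rw [(PP_at_zero n).2]; norm_num)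
    obtain ⟨r, hr, hr'⟩ := Metric.eventually_nhds_iff.1 hev
    refine ⟨min (r/2) Y, by positivity, min_le_right _ _, fun y h1 h2 => (hr' ?_).le⟩
    rw [Real.dist_eq, sub_zero, abs_of_nonneg h1]
    have := h2.trans (min_le_left _ _); linarith
  have hPn : ∀ y, 0 ≤ y → y ≤ δ → PP (n+1) y ≤ -y/2 := by
    intro y h1 h2
    have := mono_of_deriv (u := fun y => -y/2 - PP (n+1) y) (u' := fun y => -1/2 - PD (n+1) y) h1
      (fun z _ _ => (((hasDerivAt_id z).neg.div_const 2).sub (PP_hasDeriv (n+1) z)))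
      (fun z h3 h4 => by have := hPD z h3.le (h4.le.trans h2); linarith)
    simp only [(PP_at_zero n).1] at this
    linarith
  obtain ⟨M0, hM0⟩ := cont_bdd (QQ_cont (n+1)) 0 Y
  obtain ⟨M, hM⟩ : ∃ M, M = 1 + ((n:ℝ)+1) * |M0| := ⟨_, rfl⟩
  have hM1 : 1 ≤ M := by rw [hM]; have : 0 ≤ ((n:ℝ)+1) * |M0| := by positivity
                         linarith
  obtain ⟨N, hNd⟩ : ∃ N : ℝ, N = ((n+1 : ℕ) : ℝ) := ⟨_, rfl⟩
  have hN : 1 ≤ N := by rw [hNd]; push_cast; linarith [(n.cast_nonneg : (0:ℝ) ≤ n)]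
  have hPM : ∀ y, 0 ≤ y → y ≤ Y → -(M * y) ≤ N * PP (n+1) y := by
    intro y h1 h2
    rw [hNd, nPP_eq, ← hNd]
    have h3 : |QQ (n+1) y| ≤ |M0| := (hM0.2 y h1 h2).trans (le_abs_self _)
    have h4 := (abs_le.1 h3).1
    have h5 : -M ≤ N * QQ (n+1) y := by
      rw [hM, hNd]; push_cast; have : (0:ℝ) ≤ n := n.cast_nonneg
      nlinarith
    nlinarith
  have hroot : ∀ x, 0 < x → PP (n+1) x = 0 → δ < x ∧ x < Y := by
    intro x hx h0
    constructor
    · by_contra h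
      have := hPn x hx.le (not_lt.1 h)
      linarith
    · by_contra h
      have := (hP x (not_lt.1 h)).1
      rw [h0] at this; norm_num at this
  obtain ⟨ε, hε, hstab⟩ := stab (a := δ) (b := Y) (PP_hasDeriv (n+1)) (PD_cont (n+1)) t
    (fun x hx => by
      obtain ⟨h1, h2⟩ := (ht x).1 hx
      obtain ⟨h3, h4⟩ := hroot x h1 h2
      exact ⟨h3, h4, h2, PP_PD_ne (n+1) h1 h2⟩)
    (fun y h1 _ h3 => (ht y).2 ⟨by linarith, h3⟩)
  refine ⟨1 + 16 * C ^ 2 * M + 1 / (4 * M * δ) + 2 * (1 + C * √δ) / δ + (1 + C * √Y) / ε + C / √δ / ε, ?_⟩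
  intro β hβ hβ1 hL μ f hf hμ hs
  have hg := hG β hβ hβ1 μ hμ f hf
  obtain ⟨L, hLd⟩ : ∃ L, L = -Real.log β := ⟨_, rfl⟩
  rw [← hLd] at hL hg
  simp only [← hNd] at hg
  have hsδ : 0 < √δ := Real.sqrt_pos.2 hδ
  have hsY : 0 < √Y := Real.sqrt_pos.2 hY
  have k1 : 0 ≤ 16 * C ^ 2 * M := by positivity
  have k2 : 0 ≤ 1 / (4 * M * δ) := by positivity
  have k3 : 0 ≤ 2 * (1 + C * √δ) / δ := by positivity
  have k4 : 0 ≤ (1 + C * √Y) / ε := by positivity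
  have k5 : 0 ≤ C / √δ / ε := by positivity
  have l1 : 16 * C ^ 2 * M < L := by linarith
  have l2 : 1 / (4 * M * δ) < L := by linarith
  have l3 : 2 * (1 + C * √δ) / δ < L := by linarith
  have l4 : (1 + C * √Y) / ε < L := by linarith
  have l5 : C / √δ / ε < L := by linarith
  have hL0 : 0 < L := by linarith
  clear hL k1 k2 k3 k4 k5
  have hM0' : 0 < M := by linarith
  obtain ⟨a, ha⟩ : ∃ a, a = 1 / (4 * M * L) := ⟨_, rfl⟩
  have ha0 : 0 < a := by rw [ha]; positivity
  have haδ : a < δ := by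
    rw [ha, div_lt_iff₀ (by positivity)]
    rw [div_lt_iff₀ (by positivity)] at l2; nlinarith
  have haL : M * L * a = 1 / 4 := by rw [ha]; field_simp
  -- C √a < 1/4·... : (C √a)^2 = C^2 /(4 M L)
  have hCa : C < L * √a / 2 := by
    have h1 : C ^ 2 < (L * √a / 2) ^ 2 := by
      rw [div_pow, mul_pow, Real.sq_sqrt ha0.le]
      have : L ^ 2 * a = L / (4 * M) := by rw [ha]; field_simp
      rw [this, div_div, lt_div_iff₀ (by positivity)]; nlinarith
    exact lt_of_pow_lt_pow_left₀ 2 (by positivity) h1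
  have hCa2 : C * √a ≤ 1 / 8 := by
    have h1 : C * √a ≤ L * √a / 2 * √a := by gcongr
    have h2 : L * √a / 2 * √a = L * a / 2 := by
      have := Real.mul_self_sqrt ha0.le
      linear_combination L / 2 * this
    have : L * a ≤ 1/4 := by rw [← haL]; nlinarith [mul_pos hL0 ha0]
    linarith
  have fpos : ∀ y, 0 < y → y ≤ a → 0 < f y := by
    intro y h1 h2
    have h3 := (abs_le.1 (hg y h1 (by linarith)).1).1
    have h4 := hPM y h1.le (by linarith)
    have h5 : C * √y ≤ 1/8 := le_trans (by gcongr) hCa2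
    have h6 : L * (M * y) ≤ 1/4 := by rw [← haL]; nlinarith [mul_pos hM0' hL0]
    have h7 := mul_le_mul_of_nonneg_left h4 hL0.le
    nlinarith
  have gneg : ∀ y, a ≤ y → y ≤ δ → 0 < - GG β μ f y := by
    intro y h1 h2
    have hy : 0 < y := by linarith
    have h3 := (abs_le.1 (hg y hy (by linarith)).2).2
    have h4 := hPD y hy.le h2
    have hsy : 0 < √y := Real.sqrt_pos.2 hy
    have h5 : C / √y < L / 2 := by
      rw [div_lt_iff₀ hsy]
      have : √a ≤ √y := Real.sqrt_le_sqrt h1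
      have : L * √a ≤ L * √y := by gcongr
      linarith
    have h6 : N * PD (n+1) y ≤ -1/2 := by nlinarith
    have h7 := mul_le_mul_of_nonneg_left h6 hL0.le
    linarith
  have fδ : f δ < 0 := by
    have h3 := (abs_le.1 (hg δ hδ hδY).1).2
    have h4 := hPn δ hδ.le le_rfl
    rw [div_lt_iff₀ hδ] at l3
    have h6 : N * PP (n+1) δ ≤ -δ/2 := by nlinarith
    have h7 := mul_le_mul_of_nonneg_left h6 hL0.le
    linarith
  obtain ⟨z, z1, z2, z3, z4⟩ := uniq_zero (v := fun y => - f y) (v' := fun y => - GG β μ f y) haδ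
    (fun y h1 _ => (hf.2.2 y (by linarith)).neg) gneg (by simpa using fpos a ha0 le_rfl) (by simpa using fδ)
  have hNL : 0 < N * L := by positivity
  obtain ⟨s1, s2⟩ := hstab (fun y => f y / (N * L)) (fun y => GG β μ f y / (N * L)) (by
    intro y h1 h2
    have hy : 0 < y := by linarith
    obtain ⟨q1, q2⟩ := hg y hy h2
    have hLN : L ≤ N * L := by nlinarith
    rw [div_lt_iff₀ hε] at l4 l5
    refine ⟨(hf.2.2 y hy).div_const _, ?_, ?_⟩
    · rw [show f y / (N * L) - PP (n+1) y = ((f y - (1 + L * (N * PP (n+1) y))) + 1) / (N * L) by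
        field_simp; ring]
      rw [abs_div, abs_of_pos hNL, div_le_iff₀ hNL]
      have : √y ≤ √Y := Real.sqrt_le_sqrt h2
      have : C * √y ≤ C * √Y := by gcongr
      have h9 := abs_add_le (f y - (1 + L * (N * PP (n+1) y))) 1
      rw [abs_one] at h9
      nlinarith
    · rw [show GG β μ f y / (N * L) - PD (n+1) y = (GG β μ f y - L * (N * PD (n+1) y)) / (N * L) by
        field_simp]
      rw [abs_div, abs_of_pos hNL, div_le_iff₀ hNL]
      have : √δ ≤ √y := Real.sqrt_le_sqrt h1
      have : C / √y ≤ C / √δ := by gcongr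
      nlinarith)
  have hset : {y | 0 < y ∧ f y = 0} = insert z {y | δ ≤ y ∧ y ≤ Y ∧ f y / (N * L) = 0} := by
    ext y
    simp only [mem_ofPred_eq, mem_insert_iff]
    constructor
    · rintro ⟨h1, h2⟩
      rcases le_total y a with h | h
      · have := fpos y h1 h; linarith
      rcases le_total y δ with h' | h'
      · left; exact z4 y h h' (by simp [h2])
      rcases le_total y Y with h'' | h''
      · right; exact ⟨h', h'', by simp [h2]⟩
      · have := hs y h''; rw [h2] at this; simp at this
    · rintro (rfl | ⟨h1, h2, h3⟩)
      · exact ⟨by linarith, by simpa using z3⟩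
      · exact ⟨by linarith, (div_eq_zero_iff.1 h3).resolve_right hNL.ne'⟩
  rw [hset]
  refine ⟨s1.insert z, ?_⟩
  rw [Set.ncard_insert_of_notMem _ s1, s2, htc]
  rintro ⟨h, _⟩
  linarith

noncomputable def phiF (β : ℝ) (f : ℝ → ℝ) (r : ℝ) : ℝ := f (β * r ^ 2) * (r ^ 2 / (1 + r ^ 2) ^ 2)

lemma Qfun_deriv (r : ℝ) : deriv Qfun r = 8 * r / (1 + r ^ 2) ^ 2 := by
  have h : HasDerivAt Qfun ((4 * (2 * r) * (1 + r ^ 2) - 4 * r ^ 2 * (2 * r)) / (1 + r ^ 2) ^ 2) r := by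
    have h1 : HasDerivAt (fun r : ℝ => 4 * r ^ 2) (4 * (2 * r)) r := by
      simpa using ((hasDerivAt_pow 2 r).const_mul 4)
    have h2 : HasDerivAt (fun r : ℝ => 1 + r ^ 2) (2 * r) r := by
      simpa using ((hasDerivAt_pow 2 r).const_add 1)
    exact h1.div h2 (by positivity)
  rw [h.deriv]; congr 1; ring

lemma w_deriv (r : ℝ) : HasDerivAt (fun r : ℝ => r ^ 2 / (1 + r ^ 2) ^ 2) (2 * r * (1 - r ^ 2) / (1 + r ^ 2) ^ 3) r := by
  have h2 : HasDerivAt (fun r : ℝ => 1 + r ^ 2) (2 * r) r := by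
    simpa using ((hasDerivAt_pow 2 r).const_add 1)
  refine ((hasDerivAt_pow 2 r).div (h2.fun_pow 2) (by positivity)).congr_deriv ?_
  have : (1 + r ^ 2) ≠ 0 := by positivity
  field_simp; push_cast; ring

lemma w_deriv2 (r : ℝ) : HasDerivAt (fun r : ℝ => 2 * r * (1 - r ^ 2) / (1 + r ^ 2) ^ 3) ((2 - 16 * r ^ 2 + 6 * r ^ 4) / (1 + r ^ 2) ^ 4) r := by
  have h2 : HasDerivAt (fun r : ℝ => 1 + r ^ 2) (2 * r) r := by
    simpa using ((hasDerivAt_pow 2 r).const_add 1)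
  have h3 : HasDerivAt (fun r : ℝ => 1 - r ^ 2) (-(2 * r)) r := by
    simpa using ((hasDerivAt_pow 2 r).const_sub 1)
  refine ((((hasDerivAt_id' r).const_mul 2).fun_mul h3).div (h2.fun_pow 3) (by positivity)).congr_deriv ?_
  have : (1 + r ^ 2) ≠ 0 := by positivity
  field_simp; push_cast; ring

lemma y_deriv (β r : ℝ) : HasDerivAt (fun r : ℝ => β * r ^ 2) (2 * β * r) r := by
  refine ((hasDerivAt_pow 2 r).const_mul β).congr_deriv ?_
  push_cast; ring

lemma phi_deriv {β μ : ℝ} (hβ : 0 < β) {f : ℝ → ℝ} (hf : IsSol β μ f) {r : ℝ} (hr : 0 < r) :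
    HasDerivAt (phiF β f) (GG β μ f (β * r ^ 2) * (2 * β * r) * (r ^ 2 / (1 + r ^ 2) ^ 2)
      + f (β * r ^ 2) * (2 * r * (1 - r ^ 2) / (1 + r ^ 2) ^ 3)) r := by
  have h1 : HasDerivAt (fun r => f (β * r ^ 2)) (GG β μ f (β * r ^ 2) * (2 * β * r)) r :=
    (hf.2.2 (β * r ^ 2) (by positivity)).comp r (y_deriv β r)
  exact h1.mul (w_deriv r)

lemma phi_ode {b β μ : ℝ} (hβ : 0 < β) (hb : b = 2 * β) {f : ℝ → ℝ} (hf : IsSol β μ f) {r : ℝ} (hr : 0 < r) :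
    A0 (phiF β f) r - b * r * deriv (phiF β f) r = 2 * b * (1 - μ) * phiF β f r := by
  have hy : 0 < β * r ^ 2 := by positivity
  have hd := (phi_deriv hβ hf hr).deriv
  have hev : deriv (phiF β f) =ᶠ[nhds r] fun r => GG β μ f (β * r ^ 2) * (2 * β * r) * (r ^ 2 / (1 + r ^ 2) ^ 2)
      + f (β * r ^ 2) * (2 * r * (1 - r ^ 2) / (1 + r ^ 2) ^ 3) := by
    filter_upwards [lt_mem_nhds hr] with x hx
    exact (phi_deriv hβ hf hx).deriv
  have h1 : HasDerivAt (fun r => f (β * r ^ 2)) (GG β μ f (β * r ^ 2) * (2 * β * r)) r :=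
    (hf.2.2 (β * r ^ 2) hy).comp r (y_deriv β r)
  have h2 : HasDerivAt (fun r => GG β μ f (β * r ^ 2)) (((2 * β / (β + β * r ^ 2) - μ) / (β * r ^ 2) * f (β * r ^ 2)
      + (1 - 2 * β / (β * r ^ 2 * (β + β * r ^ 2))) * GG β μ f (β * r ^ 2)) * (2 * β * r)) r :=
    HasDerivAt.comp (h₂ := GG β μ f) (h := fun r => β * r ^ 2) r (GG_hasDeriv hβ hf hy) (y_deriv β r)
  have h3 : HasDerivAt (fun r : ℝ => 2 * β * r) (2 * β) r := by
    simpa using (hasDerivAt_id r).const_mul (2 * β)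
  have h4 := (((h2.fun_mul h3).fun_mul (w_deriv r)).fun_add (h1.fun_mul (w_deriv2 r))).deriv
  unfold A0
  rw [hev.deriv_eq, h4, hd, Qfun_deriv]
  unfold phiF Qfun
  generalize GG β μ f (β * r ^ 2) = G
  generalize f (β * r ^ 2) = F
  have e : β + β * r ^ 2 = β * (1 + r ^ 2) := by ring
  rw [e, hb]
  have : (1 + r ^ 2) ≠ 0 := by positivity
  field_simp
  ring

lemma sol_smooth {β μ : ℝ} (hβ : 0 < β) {f : ℝ → ℝ} (hf : IsSol β μ f) (k : ℕ) :
    ContDiffOn ℝ k f (Ioi 0) ∧ ContDiffOn ℝ k (GG β μ f) (Ioi 0) := by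
  induction k with
  | zero =>
    simp only [Nat.cast_zero, contDiffOn_zero]
    exact ⟨hf.1.continuousOn, (GG_cont hβ μ hf.1).continuousOn⟩
  | succ k ih =>
    obtain ⟨ih1, ih2⟩ := ih
    have key : ∀ u v : ℝ → ℝ, (∀ y, 0 < y → HasDerivAt u (v y) y) → ContDiffOn ℝ k v (Ioi 0) →
        ContDiffOn ℝ (k + 1 : ℕ) u (Ioi 0) := by
      intro u v h hv
      push_cast
      rw [contDiffOn_succ_iff_deriv_of_isOpen isOpen_Ioi]
      refine ⟨fun y hy => (h y hy).differentiableAt.differentiableWithinAt, by simp, ?_⟩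
      exact hv.congr fun y hy => (h y hy).deriv
    refine ⟨key _ _ hf.2.2 ih2, key _ _ (fun y hy => GG_hasDeriv hβ hf hy) ?_⟩
    have hid : ContDiffOn ℝ k (fun y : ℝ => y) (Ioi 0) := contDiffOn_id
    have hby : ContDiffOn ℝ k (fun y : ℝ => β + y) (Ioi 0) := contDiffOn_const.add hid
    refine ContDiffOn.add (ContDiffOn.mul (ContDiffOn.div (ContDiffOn.sub (ContDiffOn.div contDiffOn_const hby ?_) contDiffOn_const) hid ?_) ih1)
      (ContDiffOn.mul (ContDiffOn.sub contDiffOn_const (ContDiffOn.div contDiffOn_const (hid.mul hby) ?_)) ih2)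
    · intro y hy; have : (0:ℝ) < y := hy; positivity
    · intro y hy; have : (0:ℝ) < y := hy; positivity
    · intro y hy; have : (0:ℝ) < y := hy; positivity

lemma phi_smooth {β μ : ℝ} (hβ : 0 < β) {f : ℝ → ℝ} (hf : IsSol β μ f) :
    ContDiffOn ℝ (⊤ : ℕ∞) (phiF β f) (Ioi 0) := by
  rw [contDiffOn_infty]
  intro k
  have h1 := (sol_smooth hβ hf k).1
  have h2 : ContDiff ℝ k (fun r : ℝ => β * r ^ 2) := by fun_prop
  have h3 : ContDiff ℝ k (fun r : ℝ => r ^ 2 / (1 + r ^ 2) ^ 2) := by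
    refine ContDiff.div (by fun_prop) (by fun_prop) (fun r => by positivity)
  refine ContDiffOn.mul (h1.comp h2.contDiffOn ?_) h3.contDiffOn
  intro r hr
  have : (0:ℝ) < r := hr
  show (0:ℝ) < β * r ^ 2
  positivity

lemma phi_zero {β : ℝ} {f : ℝ → ℝ} {r : ℝ} (hr : 0 < r) : phiF β f r = 0 ↔ f (β * r ^ 2) = 0 := by
  unfold phiF
  have : r ^ 2 / (1 + r ^ 2) ^ 2 ≠ 0 := by positivity
  simp [mul_eq_zero, this]

lemma phi_int {b β K : ℝ} (hβ : 0 < β) (hb : b = 2 * β) {f : ℝ → ℝ} (hf : Continuous f)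
    (hK : ∀ y, 0 < y → |f y| ≤ K * Real.exp (y / 4)) :
    MeasureTheory.IntegrableOn (fun r => (phiF β f r) ^ 2 * omegaB b r) (Set.Ioi 0) := by
  have hg : Integrable (fun r : ℝ => K ^ 2 * Real.exp (-(β / 2) * r ^ 2)) :=
    (integrable_exp_neg_mul_sq (by positivity)).const_mul _
  have he : ∀ r ∈ Ioi (0:ℝ), (fun r => f (β * r ^ 2) ^ 2 * (r ^ 3 / (8 * (1 + r ^ 2) ^ 2)) * Real.exp (-(β * r ^ 2))) r = (phiF β f r) ^ 2 * omegaB b r := by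
    intro r hr
    have hr0 : (0:ℝ) < r := hr
    unfold phiF omegaB Ufun
    simp only
    rw [hb, show -(2 * β) * r ^ 2 / 2 = -(β * r ^ 2) by ring]
    generalize Real.exp (-(β * r ^ 2)) = E
    generalize f (β * r ^ 2) = F
    field_simp
  refine IntegrableOn.congr_fun (f := fun r => f (β * r ^ 2) ^ 2 * (r ^ 3 / (8 * (1 + r ^ 2) ^ 2)) * Real.exp (-(β * r ^ 2))) ?_ he measurableSet_Ioi
  have hc : Continuous (fun r : ℝ => f (β * r ^ 2) ^ 2 * (r ^ 3 / (8 * (1 + r ^ 2) ^ 2)) * Real.exp (-(β * r ^ 2))) := by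
    have : ∀ r : ℝ, 8 * (1 + r ^ 2) ^ 2 ≠ 0 := fun r => by positivity
    fun_prop (disch := assumption)
  refine Integrable.mono' hg.integrableOn hc.aestronglyMeasurable ?_
  refine (ae_restrict_iff' measurableSet_Ioi).2 (Filter.Eventually.of_forall fun r hr => ?_)
  have hr0 : (0:ℝ) < r := hr
  have hy : 0 < β * r ^ 2 := by positivity
  rw [Real.norm_eq_abs, abs_of_nonneg (by positivity)]
  have h1 := hK _ hy
  have h2 : f (β * r ^ 2) ^ 2 ≤ (K * Real.exp (β * r ^ 2 / 4)) ^ 2 := by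
    rw [← sq_abs]; gcongr
  have h3 : r ^ 3 / (8 * (1 + r ^ 2) ^ 2) ≤ 1 := by
    rw [div_le_one (by positivity)]
    nlinarith [sq_nonneg (r - 1), sq_nonneg (r ^ 2 - r), sq_nonneg r, sq_nonneg (r^2)]
  calc f (β * r ^ 2) ^ 2 * (r ^ 3 / (8 * (1 + r ^ 2) ^ 2)) * Real.exp (-(β * r ^ 2))
      ≤ (K * Real.exp (β * r ^ 2 / 4)) ^ 2 * 1 * Real.exp (-(β * r ^ 2)) := by gcongr
    _ = K ^ 2 * Real.exp (-(β / 2) * r ^ 2) := by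
      rw [mul_pow, ← Real.exp_nat_mul, mul_one, mul_assoc, ← Real.exp_add]
      congr 2; push_cast; ring

lemma phi_zeros {β : ℝ} (hβ : 0 < β) {f : ℝ → ℝ} {n : ℕ} (h1 : {y | 0 < y ∧ f y = 0}.Finite)
    (h2 : {y | 0 < y ∧ f y = 0}.ncard = n) :
    {r : ℝ | 0 < r ∧ phiF β f r = 0}.Finite ∧ {r : ℝ | 0 < r ∧ phiF β f r = 0}.ncard = n := by
  have himg : {r : ℝ | 0 < r ∧ phiF β f r = 0} = (fun y => √(y / β)) '' {y | 0 < y ∧ f y = 0} := by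
    ext r
    simp only [mem_ofPred_eq, mem_image]
    constructor
    · rintro ⟨hr, h⟩
      refine ⟨β * r ^ 2, ⟨by positivity, (phi_zero hr).1 h⟩, ?_⟩
      rw [mul_div_cancel_left₀ _ hβ.ne', Real.sqrt_sq hr.le]
    · rintro ⟨y, ⟨hy, h⟩, rfl⟩
      have hr : 0 < √(y / β) := Real.sqrt_pos.2 (by positivity)
      refine ⟨hr, (phi_zero hr).2 ?_⟩
      rw [Real.sq_sqrt (by positivity), mul_div_cancel₀ _ hβ.ne', h]
  rw [himg]
  refine ⟨h1.image _, ?_⟩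
  rw [Set.ncard_image_of_injOn, h2]
  intro y hy y' hy' h
  have a1 : 0 < y := hy.1
  have a2 : 0 < y' := hy'.1
  have h' : √(y / β) = √(y' / β) := h
  rw [Real.sqrt_inj (by positivity) (by positivity)] at h'
  field_simp at h'
  exact h'

lemma alpha_bd {b β K μ : ℝ} {n : ℕ} (hb0 : 0 < b) (hb1 : b ≤ 1 / 2) (hb : b = 2 * β) (hK : 0 < K)
    (h : |μ - n - 1 / (-Real.log β)| ≤ K / (-Real.log β) ^ 2) :
    |-1 / Real.log b - (μ - n)| ≤ (K + 1) / (Real.log b) ^ 2 := by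
  have hβ : 0 < β := by linarith
  have hlog : Real.log b = Real.log 2 + Real.log β := by rw [hb, Real.log_mul (by norm_num) hβ.ne']
  have l2 : 0 < Real.log 2 := Real.log_pos (by norm_num)
  have l2' : Real.log 2 ≤ 1 := by have := Real.log_le_sub_one_of_pos (x := 2) (by norm_num); linarith
  obtain ⟨ℓ, hℓ⟩ : ∃ ℓ, ℓ = -Real.log b := ⟨_, rfl⟩
  obtain ⟨L, hL⟩ : ∃ L, L = -Real.log β := ⟨_, rfl⟩
  have hℓ0 : 0 < ℓ := by
    have := Real.log_neg hb0 (by linarith); linarith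
  have hLℓ : L = ℓ + Real.log 2 := by linarith
  rw [← hL] at h
  rw [show Real.log b = -ℓ by linarith, show -1 / -ℓ = 1 / ℓ by rw [neg_div_neg_eq], neg_sq]
  have hL0 : 0 < L := by linarith
  have h1 : K / L ^ 2 ≤ K / ℓ ^ 2 := by
    have : ℓ ≤ L := by linarith
    gcongr
  have h2 : |1 / ℓ - 1 / L| ≤ 1 / ℓ ^ 2 := by
    have e : 1 / ℓ - 1 / L = Real.log 2 / (ℓ * L) := by
      have : L - ℓ = Real.log 2 := by linarith
      rw [← this]; field_simp
    rw [e, abs_of_nonneg (by positivity), div_le_div_iff₀ (by positivity) (by positivity)]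
    have : ℓ * ℓ ≤ ℓ * L := by gcongr; linarith
    nlinarith [mul_pos hℓ0 hℓ0]
  have e : 1 / ℓ - (μ - n) = (1 / ℓ - 1 / L) - (μ - n - 1 / L) := by ring
  rw [e, add_div]
  have := abs_sub (1 / ℓ - 1 / L) (μ - n - 1 / L)
  linarith

lemma f_bd {β μ Y s : ℝ} (hβ : 0 < β) {f : ℝ → ℝ} (hf : IsSol β μ f) (hY : 0 < Y) (hs1 : s = 1 ∨ s = -1)
    (hs : ∀ y, Y ≤ y → 0 < s * f y) (ht : ∀ y, Y ≤ y → s * (GG β μ f y - f y / 4) ≤ 0) :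
    ∃ K, ∀ y, 0 < y → |f y| ≤ K * Real.exp (y / 4) := by
  obtain ⟨M, hM0, hM⟩ := cont_bdd hf.1 0 Y
  have habs : |s| = 1 := by rcases hs1 with h | h <;> rw [h] <;> norm_num
  refine ⟨M, fun y hy => ?_⟩
  rcases le_total y Y with h | h
  · have h1 := hM y hy.le h
    have h2 : 1 ≤ Real.exp (y / 4) := Real.one_le_exp (by positivity)
    nlinarith
  · have h1 := trapped_growth hβ hf hY hs ht y h
    have h2 : s * f Y ≤ M := by
      rw [← abs_of_pos (hs Y le_rfl), abs_mul, habs, one_mul]; exact hM Y hY.le le_rfl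
    rw [show |f y| = s * f y by rw [← abs_of_pos (hs y h), abs_mul, habs, one_mul]]
    exact h1.trans (by gcongr)

theorem statement2 (n : ℕ) :
    ∃ C : ℝ, 0 < C ∧ ∃ bstar : ℝ, bstar ∈ Set.Ioo (0:ℝ) 1 ∧
      ∀ b : ℝ, 0 < b → b ≤ bstar →
        ∃ αbar : ℝ, |αbar| ≤ C / (Real.log b) ^ 2 ∧
          ∃ φ : ℝ → ℝ,
            ContDiffOn ℝ (⊤ : ℕ∞) φ (Set.Ioi 0) ∧
            (∃ r ∈ Set.Ioi (0:ℝ), φ r ≠ 0) ∧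
            MeasureTheory.IntegrableOn (fun r => (φ r) ^ 2 * omegaB b r) (Set.Ioi 0) ∧
            (∀ r ∈ Set.Ioi (0:ℝ),
              A0 φ r - b * r * deriv φ r
                = 2 * b * (1 - (n : ℝ) + 1 / Real.log b + αbar) * φ r) ∧
            {r : ℝ | 0 < r ∧ φ r = 0}.Finite ∧
            {r : ℝ | 0 < r ∧ φ r = 0}.ncard = n := by
  obtain ⟨Y, C, β0, s, hY, hC, hβ0, hβ0e, hs, hP, hsP, hn0, hG, hβ0Y, htrap⟩ := trap n
  obtain ⟨K, hK, hasy⟩ := mu_asymp n hY hC hs hP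
  have hzeros : ∃ L0 : ℝ, ∀ β, 0 < β → β ≤ Real.exp (-1) → L0 ≤ -Real.log β → ∀ (μ : ℝ) (f : ℝ → ℝ), IsSol β μ f →
      |μ - n| ≤ 8 / (-Real.log β) → (∀ y, Y ≤ y → 0 < s * f y) →
      {y | 0 < y ∧ f y = 0}.Finite ∧ {y | 0 < y ∧ f y = 0}.ncard = n := by
    rcases n with _ | n
    · refine ⟨0, fun β hβ hβ1 _ μ f hf hμ hsf => ?_⟩
      rw [zeros_zero hC (hn0 rfl) (fun y h1 h2 => (hG β hβ hβ1 μ hμ f hf y h1 h2).1) hsf]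
      simp
    · exact zeros_succ n hY hC hP hG
  obtain ⟨L0, hz⟩ := hzeros
  refine ⟨K + 1, by positivity, min (2 * min β0 (Real.exp (-L0))) (1 / 2),
    ⟨by positivity, lt_of_le_of_lt (min_le_right _ _) (by norm_num)⟩, ?_⟩
  intro b hb hbs
  obtain ⟨β, hbβ⟩ : ∃ β, b = 2 * β := ⟨b / 2, by ring⟩
  have hβ : 0 < β := by linarith
  have hb2 : b ≤ 1 / 2 := hbs.trans (min_le_right _ _)
  have hβm : β ≤ min β0 (Real.exp (-L0)) := by
    have := hbs.trans (min_le_left _ _); linarith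
  have hββ0 := hβm.trans (min_le_left _ _)
  obtain ⟨μ, f, hf, hμ, hsf, hsd⟩ := htrap β hβ hββ0
  have hβ1 := hββ0.trans hβ0e
  have hg := hG β hβ hβ1 μ hμ f hf
  have hm := hasy β hβ hβ1 (hββ0.trans hβ0Y) μ f hf hμ hsf hsd (fun y h1 h2 => (hg y h1 h2).1)
  obtain ⟨z1, z2⟩ := hz β hβ hβ1 (log_ge hβ (hβm.trans (min_le_right _ _))) μ f hf hμ hsf
  obtain ⟨KK, hKK⟩ := f_bd hβ hf hY hs hsf hsd
  obtain ⟨y1, y2⟩ := phi_zeros hβ z1 z2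
  refine ⟨-1 / Real.log b - (μ - n), alpha_bd hb hb2 hbβ hK hm, phiF β f, phi_smooth hβ hf, ?_,
    phi_int hβ hbβ hf.1 hKK, ?_, y1, y2⟩
  · have hr : 0 < √(Y / β) := Real.sqrt_pos.2 (by positivity)
    refine ⟨√(Y / β), hr, fun h => ?_⟩
    rw [phi_zero hr, Real.sq_sqrt (by positivity), mul_div_cancel₀ _ hβ.ne'] at h
    have := hsf Y le_rfl
    rw [h] at this; simp at this
  · intro r hr
    rw [phi_ode hβ hbβ hf hr]
    congr 2; ring
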